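/- Let d be a positive squarefree integer (d ≠ 1, 3). Then rk₃ Cl(ℚ(√(−3d))) − rk₃ Cl(ℚ(√d)) ∈ {0, 1}. -/

import Mathlib

section
namespace Sch

/-- The ring of Eisenstein integers. -/
abbrev Zw := QuadraticAlgebra ℤ (-1) (-1)

open QuadraticAlgebra

/-- the primitive cube root of unity -/
def w : Zw := ⟨0, 1⟩

@[simp] lemma w_re : w.re = 0 := rfl
@[simp] lemma w_im : w.im = 1 := rfl

lemma w_sq : w * w = -1 - w := by
  ext <;> simp [w]

lemma w_sq' : w ^ 2 = -1 - w := by rw [sq, w_sq]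

lemma w_cube : w ^ 3 = 1 := by
  rw [pow_succ, w_sq', sub_mul, w_sq]; ring

lemma nm (z : Zw) : norm z = z.re ^ 2 - z.re * z.im + z.im ^ 2 := by
  rw [norm_def]; ring

lemma nm_nonneg (z : Zw) : 0 ≤ norm z := by
  rw [nm]; nlinarith [sq_nonneg (z.re - z.im), sq_nonneg z.re, sq_nonneg z.im]

lemma nm_eq_zero {z : Zw} (h : norm z = 0) : z = 0 := by
  rw [nm] at h
  have h1 : z.re ^ 2 = 0 := by
    nlinarith [sq_nonneg (z.re - 2 * z.im), sq_nonneg z.re, sq_nonneg z.im]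
  have h2 : z.im ^ 2 = 0 := by
    nlinarith [sq_nonneg (z.im - 2 * z.re), sq_nonneg z.re, sq_nonneg z.im]
  ext
  · simpa using h1
  · simpa using h2

instance : IsDomain Zw := by
  have : NoZeroDivisors Zw := ⟨fun {a b} h => by
    have h1 : norm a * norm b = 0 := by rw [← map_mul, h, QuadraticAlgebra.norm_zero]
    rcases mul_eq_zero.1 h1 with h | h
    · exact Or.inl (nm_eq_zero h)
    · exact Or.inr (nm_eq_zero h)⟩
  exact NoZeroDivisors.to_isDomain _

lemma mul_star_self (z : Zw) : z * star z = ((norm z : ℤ) : Zw) := by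
  have := algebraMap_norm_eq_mul_star z
  rw [← this]; rfl

lemma dvd_int {n : ℤ} {z : Zw} : (n : Zw) ∣ z ↔ n ∣ z.re ∧ n ∣ z.im := by
  have : (n : Zw) = algebraMap ℤ Zw n := rfl
  rw [this, algebraMap_dvd_iff]

lemma dvd_nat {n : ℕ} {z : Zw} : (n : Zw) ∣ z ↔ (n : ℤ) ∣ z.re ∧ (n : ℤ) ∣ z.im := by
  rw [← dvd_int]; simp

lemma int_dvd_int {m n : ℤ} : (m : Zw) ∣ (n : Zw) ↔ m ∣ n := by
  rw [dvd_int]; simp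

lemma decomp (z : Zw) : z = (z.re : Zw) + (z.im : Zw) * w := by
  ext <;> simp

lemma dvd_cancel {p : ℕ} (hp : p.Prime) {n : ℤ} (hn : ¬ (p : ℤ) ∣ n) {z : Zw}
    (h : (p : Zw) ∣ (n : Zw) * z) : (p : Zw) ∣ z := by
  rw [dvd_nat] at *
  have hp' := Nat.prime_iff_prime_int.1 hp
  simp at h
  exact ⟨(hp'.dvd_or_dvd h.1).resolve_left hn, (hp'.dvd_or_dvd h.2).resolve_left hn⟩

lemma dvd_cancel' {p : ℕ} (hp : p.Prime) {y : Zw} (hn : ¬ (p : ℤ) ∣ norm y) {z : Zw}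
    (h : (p : Zw) ∣ y * z) : (p : Zw) ∣ z := by
  apply dvd_cancel hp hn
  rw [← mul_star_self]
  convert h.mul_left (star y) using 1
  ring

lemma frob1 {p : ℕ} (hp : p.Prime) (z : Zw) :
    (p : Zw) ∣ z ^ p - ((z.re : Zw) + (z.im : Zw) * w ^ p) := by
  have := Fact.mk hp
  have key : ∀ n : ℤ, (p : ℤ) ∣ n ^ p - n := by
    intro n
    have : ((n ^ p - n : ℤ) : ZMod p) = 0 := by
      push_cast; rw [ZMod.pow_card, sub_self]
    exact (ZMod.intCast_zmod_eq_zero_iff_dvd _ _).1 this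
  have key' : ∀ n : ℤ, (p : Zw) ∣ (n : Zw) ^ p - n := by
    intro n
    have := int_dvd_int.2 (key n)
    push_cast at this; exact this
  obtain ⟨r, hr⟩ := exists_add_pow_prime_eq hp (z.re : Zw) ((z.im : Zw) * w)
  have h0 := decomp z
  have h2 : z ^ p - ((z.re : Zw) + (z.im : Zw) * w ^ p) =
     ((z.re : Zw) ^ p - z.re) + ((z.im : Zw) ^ p - z.im) * w ^ p + p * (z.re * (z.im * w) * r) := by
    conv_lhs => rw [h0]
    simp only [re_add, im_add, re_mul, im_mul, w_re, w_im, re_intCast, im_intCast]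
    rw [hr]
    push_cast
    simp
    ring
  rw [h2]
  exact dvd_add (dvd_add (key' _) ((key' _).mul_right _)) (dvd_mul_right _ _)

lemma sub_dvd_pow {a x y : Zw} (n : ℕ) (h : a ∣ x - y) : a ∣ x ^ n - y ^ n :=
  h.trans (sub_dvd_pow_sub_pow x y n)

lemma w_pow_mod {m n : ℕ} (h : m % 3 = n % 3) : w ^ m = w ^ n := by
  rw [← Nat.div_add_mod m 3, ← Nat.div_add_mod n 3, h, pow_add, pow_add, pow_mul, pow_mul, w_cube]
  simp

lemma psq_mod {p : ℕ} (hp : p.Prime) (h3 : p ≠ 3) : p ^ 2 % 3 = 1 := by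
  have : p % 3 ≠ 0 := fun h => h3 ((Nat.prime_dvd_prime_iff_eq Nat.prime_three hp).1
    (Nat.dvd_of_mod_eq_zero h)).symm
  have h2 : p % 3 = 1 ∨ p % 3 = 2 := by omega
  rcases h2 with h | h <;> simp [Nat.pow_mod, h]

lemma three_mul_div {p : ℕ} (hp : p.Prime) (h3 : p ≠ 3) : 3 * ((p ^ 2 - 1) / 3) = p ^ 2 - 1 := by
  have := psq_mod hp h3
  have : 0 < p ^ 2 := by positivity [hp.pos]
  omega

lemma frob2 {p : ℕ} (hp : p.Prime) (h3 : p ≠ 3) (z : Zw) : (p : Zw) ∣ z ^ (p ^ 2) - z := by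
  have h1 := frob1 hp z
  set y : Zw := (z.re : Zw) + (z.im : Zw) * w ^ p with hy
  obtain ⟨r, hr⟩ := exists_add_pow_prime_eq hp (z.re : Zw) ((z.im : Zw) * w ^ p)
  have key' : ∀ n : ℤ, (p : Zw) ∣ (n : Zw) ^ p - n := by
    intro n
    have := frob1 hp (n : Zw)
    simpa using this
  have h4 : w ^ (p ^ 2) = w := by
    conv_rhs => rw [← pow_one w]
    exact w_pow_mod (psq_mod hp h3)
  have h2 : y ^ p - z = ((z.re : Zw) ^ p - z.re) + ((z.im : Zw) ^ p - z.im) * w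
      + p * (z.re * (z.im * w ^ p) * r) := by
    conv_lhs => rw [decomp z, hy, hr, mul_pow, ← pow_mul, ← sq, h4]
    ring
  have h5 : (p : Zw) ∣ y ^ p - z := by
    rw [h2]
    exact dvd_add (dvd_add (key' _) ((key' _).mul_right _)) (dvd_mul_right _ _)
  have h6 := sub_dvd_pow p h1
  rw [← pow_mul, ← sq] at h6
  have := dvd_add h6 h5
  simpa using this

lemma fermat {p : ℕ} (hp : p.Prime) (h3 : p ≠ 3) {z : Zw} (hz : ¬ (p : ℤ) ∣ norm z) :
    (p : Zw) ∣ z ^ (p ^ 2 - 1) - 1 := by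
  apply dvd_cancel' hp hz
  have := frob2 hp h3 z
  have h0 : 0 < p ^ 2 := by positivity [hp.pos]
  obtain ⟨k, hk⟩ : ∃ k, p ^ 2 = k + 1 := ⟨p ^ 2 - 1, by omega⟩
  rw [hk] at this ⊢
  convert this using 1
  simp [pow_succ]; ring

lemma mu3_cases {x : Zw} (h : x ^ 3 = 1) : x = 1 ∨ x = w ∨ x = w ^ 2 := by
  have h1 : (x - 1) * ((x - w) * (x - w ^ 2)) = 0 := by
    have e : (x - 1) * ((x - w) * (x - w ^ 2)) = x ^ 3 - x^2 * (1 + w + w^2)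
      + x * (w + w ^2 + w^3) - w^3 := by ring
    rw [e, h, w_cube, w_sq']; ring
  rcases mul_eq_zero.1 h1 with h | h
  · left; exact sub_eq_zero.1 h
  rcases mul_eq_zero.1 h with h | h
  · right; left; exact sub_eq_zero.1 h
  · right; right; exact sub_eq_zero.1 h

lemma w_ne_one : w ≠ 1 := by
  intro h; have := congrArg re h; simp at this

lemma mu3_eq {d : ℕ} (hd : d ≠ 1) {x y : Zw} (hx : x ^ 3 = 1) (hy : y ^ 3 = 1)
    (h : (d : Zw) ∣ x - y) : x = y := by
  have hu : ∀ n : ℤ, (n = 1 ∨ n = -1) → ¬ ((d : ℤ) ∣ n) := by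
    rintro n (rfl | rfl) h
    · exact hd (by have := Int.eq_one_of_dvd_one (by positivity) h; exact_mod_cast this)
    · have := Int.eq_one_of_dvd_one (by positivity) ((dvd_neg (a := (d:ℤ))).1 h)
      exact hd (by exact_mod_cast this)
  rw [dvd_nat] at h
  rcases mu3_cases hx with rfl | rfl | rfl <;> rcases mu3_cases hy with rfl | rfl | rfl <;>
    first
    | rfl
    | (exfalso; rw [w_sq'] at h; simp at h; revert h; have := hu 1; have := hu (-1); grind)
    | (exfalso; simp at h; revert h; have := hu 1; have := hu (-1); grind)

lemma eval_cube {p : ℕ} (hp : p.Prime) (h3 : p ≠ 3) {y ρ x : Zw} (hx : x ^ 3 = 1)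
    (hρ : ¬ (p : ℤ) ∣ norm ρ) (h1 : (p : Zw) ∣ y - ρ ^ 3)
    (h : (p : Zw) ∣ y ^ ((p ^ 2 - 1) / 3) - x) : x = 1 := by
  have h2 := sub_dvd_pow ((p ^ 2 - 1) / 3) h1
  rw [← pow_mul, three_mul_div hp h3] at h2
  have h4 := fermat hp h3 hρ
  apply mu3_eq hp.ne_one hx (by simp)
  have := dvd_add h2 h4
  have := dvd_sub this h
  convert this using 1
  ring

end Sch
end

section
namespace Sch
open QuadraticAlgebra

/-- powers of `w` with integer exponent -/
def wz (n : ℤ) : Zw := w ^ (n % 3).toNat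

lemma wz_congr {m n : ℤ} (h : (3 : ℤ) ∣ m - n) : wz m = wz n := by
  unfold wz
  have : m % 3 = n % 3 := by omega
  rw [this]

lemma wz_nat (n : ℕ) : wz n = w ^ n := by
  unfold wz
  apply w_pow_mod
  omega

lemma wz_add (m n : ℤ) : wz (m + n) = wz m * wz n := by
  unfold wz
  rw [← pow_add]
  apply w_pow_mod
  omega

lemma wz_zero : wz 0 = 1 := by simp [wz]

lemma wz_eq_one {n : ℤ} (h : (3 : ℤ) ∣ n) : wz n = 1 := by
  rw [← wz_zero]; exact wz_congr (by simpa using h)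

lemma wz_cube (n : ℤ) : wz n ^ 3 = 1 := by
  unfold wz; rw [← pow_mul, mul_comm, pow_mul, w_cube, one_pow]

lemma wz_ne_zero (n : ℤ) : wz n ≠ 0 := fun h => by
  have := wz_cube n; rw [h] at this; simp at this

lemma eval_cube' {p : ℕ} (hp : p.Prime) (h3 : p ≠ 3) {y ρ x m : Zw} (hx : x ^ 3 = 1)
    (hρ : ¬ (p : ℤ) ∣ norm ρ) (hm : ¬ (p : ℤ) ∣ norm m) (h1 : (p : Zw) ∣ m ^ 3 * y - ρ ^ 3)
    (h : (p : Zw) ∣ y ^ ((p ^ 2 - 1) / 3) - x) : x = 1 := by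
  apply eval_cube hp h3 hx hρ h1
  rw [mul_pow, ← pow_mul, three_mul_div hp h3]
  have := fermat hp h3 hm
  have := dvd_add (this.mul_right (y ^ ((p ^ 2 - 1) / 3))) h
  convert this using 1
  ring

/-- The cubic residue symbol attached to `δ`. -/
structure Rec (δ : Zw) (X : ℤ →* Zw) : Prop where
  a : ∀ p : ℕ, p.Prime → p ≠ 3 → ¬ (p : ℤ) ∣ norm δ →
    (p : Zw) ∣ (δ * (norm δ : ℤ)) ^ ((p ^ 2 - 1) / 3) - X p
  b : ∀ m n : ℤ, δ ∣ ((m - n : ℤ) : Zw) → X m = X n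
  u : ∀ n : ℤ, IsCoprime n (norm δ) → X n ^ 3 = 1
  c : ∀ b : ℤ, δ.im = 3 * b → X 3 = wz (δ.re * b)

lemma Rec.mul {δ δ' : Zw} {X X' : ℤ →* Zw} (h : Rec δ X) (h' : Rec δ' X')
    {b b' : ℤ} (hb : δ.im = 3 * b) (hb' : δ'.im = 3 * b') (ha : ¬ (3 : ℤ) ∣ δ.re)
    (ha' : ¬ (3 : ℤ) ∣ δ'.re) :
    Rec (δ * δ') (X * X') where
  a := by
    intro p hp h3 hn
    rw [map_mul] at hn ⊢
    have h1 := h.a p hp h3 (fun hh => hn (hh.mul_right _))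
    have h2 := h'.a p hp h3 (fun hh => hn (hh.mul_left _))
    have e : δ * δ' * ((norm δ * norm δ' : ℤ) : Zw) = (δ * (norm δ : ℤ)) * (δ' * (norm δ' : ℤ)) := by
      push_cast; ring
    rw [e, mul_pow, MonoidHom.mul_apply]
    have := dvd_add (h1.mul_right ((δ' * (norm δ' : ℤ)) ^ ((p ^ 2 - 1) / 3))) (h2.mul_left (X p))
    convert this using 1
    ring
  b := by
    intro m n hmn
    rw [MonoidHom.mul_apply, MonoidHom.mul_apply, h.b m n ((dvd_mul_right _ _).trans hmn),
      h'.b m n ((dvd_mul_left _ _).trans hmn)]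
  u := by
    intro n hn
    rw [map_mul] at hn
    rw [MonoidHom.mul_apply, mul_pow, h.u n hn.of_mul_right_left, h'.u n hn.of_mul_right_right,
      one_mul]
  c := by
    intro c hc
    rw [MonoidHom.mul_apply, h.c b hb, h'.c b' hb', ← wz_add]
    apply wz_congr
    simp only [re_mul, im_mul, hb, hb'] at hc ⊢
    have hc' : c = δ.re * b' + b * δ'.re - 3 * (b * b') := by linarith
    subst hc'
    have s1 : (3 : ℤ) ∣ δ.re ^ 2 - 1 := by
      have : δ.re % 3 = 1 ∨ δ.re % 3 = 2 := by omega
      rcases this with h | h <;> (apply Int.dvd_of_emod_eq_zero; simp [Int.sub_emod, pow_two, Int.mul_emod, h])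
    have s2 : (3 : ℤ) ∣ δ'.re ^ 2 - 1 := by
      have : δ'.re % 3 = 1 ∨ δ'.re % 3 = 2 := by omega
      rcases this with h | h <;> (apply Int.dvd_of_emod_eq_zero; simp [Int.sub_emod, pow_two, Int.mul_emod, h])
    obtain ⟨k1, hk1⟩ := s1
    obtain ⟨k2, hk2⟩ := s2
    have e1 : δ.re ^ 2 = 3 * k1 + 1 := by linarith
    have e2 : δ'.re ^ 2 = 3 * k2 + 1 := by linarith
    refine ⟨- k1 * (δ'.re * b') - k2 * (δ.re * b) + δ.re * δ'.re * (b * b') + 3 * b * b' * (δ.re * b' + b * δ'.re - 3 * (b * b')), ?_⟩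
    linear_combination (-1 : ℤ) * (δ'.re * b') * e1 - (δ.re * b) * e2

lemma rec_int {q : ℤ} (hq : ¬ (3 : ℤ) ∣ q) : Rec (q : Zw) 1 where
  a := by
    intro p hp h3 hn
    rw [norm_intCast, Int.cast_id] at hn ⊢
    have : (q : Zw) * ((q ^ 2 : ℤ) : Zw) = (q : Zw) ^ 3 := by push_cast; ring
    rw [this, ← pow_mul, three_mul_div hp h3]
    simp only [MonoidHom.one_apply]
    apply fermat hp h3
    rwa [norm_intCast, Int.cast_id]
  b := by simp
  u := by simp
  c := by
    intro b hb
    simp at hb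
    subst hb
    simp [wz_zero]

end Sch
end

section
namespace Sch
open QuadraticAlgebra

/-- homomorphism out of `Zw` -/
noncomputable def homOf {A : Type*} [CommRing A] (r : A) (hr : r * r = -1 - r) : Zw →+* A :=
  (QuadraticAlgebra.lift (R := ℤ) (a := -1) (b := -1) ⟨r, by rw [hr]; simp; ring⟩).toRingHom

lemma homOf_w {A : Type*} [CommRing A] (r : A) (hr : r * r = -1 - r) : homOf r hr w = r := by
  simp [homOf, w, QuadraticAlgebra.lift]

lemma hom_apply {A : Type*} [CommRing A] (f : Zw →+* A) (z : Zw) :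
    f z = z.re + z.im * f w := by
  conv_lhs => rw [decomp z]
  simp

lemma hom_w {A : Type*} [CommRing A] (f : Zw →+* A) : f w * f w = -1 - f w := by
  rw [← map_mul, w_sq]; simp

lemma dvd_of_homs {p : ℕ} [Fact p.Prime] (h3 : p ≠ 3) {z : Zw}
    (h : ∀ f : Zw →+* AlgebraicClosure (ZMod p), f z = 0) : (p : Zw) ∣ z := by
  set F := AlgebraicClosure (ZMod p)
  have hp := Fact.out (p := p.Prime)
  have : CharP F p := charP_of_injective_algebraMap (algebraMap (ZMod p) F).injective p
  have h3' : (3 : F) ≠ 0 := by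
    intro h
    have h' : ((3 : ℕ) : F) = 0 := by exact_mod_cast h
    rw [CharP.cast_eq_zero_iff F p] at h'
    exact h3 ((Nat.prime_dvd_prime_iff_eq hp Nat.prime_three).1 h')
  obtain ⟨r, hr⟩ : ∃ r : F, r * r = -1 - r := by
    obtain ⟨r, hr⟩ := IsAlgClosed.exists_root (k := F) (Polynomial.X ^ 2 + Polynomial.X + 1)
      (by
        have : (Polynomial.X ^ 2 + Polynomial.X + 1 : Polynomial F).degree = 2 := by compute_degree!
        rw [this]; norm_num)
    refine ⟨r, ?_⟩
    simp at hr
    linear_combination hr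
  have hr' : (-1 - r) * (-1 - r) = -1 - (-1 - r) := by linear_combination hr
  have e1 := h (homOf r hr)
  have e2 := h (homOf (-1 - r) hr')
  rw [hom_apply, homOf_w] at e1 e2
  have h5 : r - (-1 - r) ≠ 0 := by
    intro h0
    apply h3'
    linear_combination (-2 * r - 1) * h0 + 4 * hr
  have h6 : (z.im : F) = 0 := by
    have : (z.im : F) * (r - (-1 - r)) = 0 := by linear_combination e1 - e2
    exact (mul_eq_zero.1 this).resolve_right h5
  have h7 : (z.re : F) = 0 := by rw [h6] at e1; simpa using e1
  rw [dvd_nat]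
  exact ⟨(CharP.intCast_eq_zero_iff F p _).1 h7, (CharP.intCast_eq_zero_iff F p _).1 h6⟩

section
variable {l : ℕ} [Fact l.Prime]

lemma hom_mu3_inj (h3 : l ≠ 3) (φ : Zw →+* ZMod l) {x y : Zw} (hx : x ^ 3 = 1) (hy : y ^ 3 = 1)
    (h : φ x = φ y) : x = y := by
  have hp := Fact.out (p := l.Prime)
  have h3' : (3 : ZMod l) ≠ 0 := by
    intro h
    have h' : ((3 : ℕ) : ZMod l) = 0 := by exact_mod_cast h
    rw [ZMod.natCast_eq_zero_iff] at h'
    exact h3 ((Nat.prime_dvd_prime_iff_eq hp Nat.prime_three).1 h')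
  have hw := hom_w φ
  set r := φ w with hr
  have n1 : r ≠ 1 := by
    intro h; rw [h] at hw; apply h3'; linear_combination hw
  have n2 : r ≠ -1 - r := by
    intro h; apply h3'; linear_combination 4 * hw - (2 * r + 1) * h
  have n3 : -1 - r ≠ 1 := by
    intro h
    have : r = -2 := by linear_combination -h
    rw [this] at hw; apply h3'; linear_combination hw
  rcases mu3_cases hx with rfl | rfl | rfl <;> rcases mu3_cases hy with rfl | rfl | rfl <;>
    first
    | rfl
    | (exfalso; simp only [w_sq', map_sub, map_neg, map_one, ← hr] at h
       first
       | exact n1 h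
       | exact n1 h.symm
       | exact n2 h
       | exact n2 h.symm
       | exact n3 h
       | exact n3 h.symm)

lemma exists_hom (hl : l % 3 = 1) {δ : Zw} (hδ : (l : ℤ) ∣ norm δ) :
    ∃ φ : Zw →+* ZMod l, φ δ = 0 := by
  have hp := Fact.out (p := l.Prime)
  obtain ⟨r, hr⟩ : ∃ r : ZMod l, r * r = -1 - r := by
    obtain ⟨g, hg⟩ := IsCyclic.exists_ofOrder_eq_natCard (α := (ZMod l)ˣ)
    have hc : Nat.card (ZMod l)ˣ = l - 1 := by
      rw [Nat.card_eq_fintype_card, ZMod.card_units_eq_totient, Nat.totient_prime hp]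
    have h2 := hp.two_le
    have hk : 3 * ((l - 1) / 3) = l - 1 := by omega
    set r := g ^ ((l - 1) / 3) with hr
    have hr3 : r ^ 3 = 1 := by
      rw [hr, ← pow_mul, mul_comm, hk, ← hc, ← hg, pow_orderOf_eq_one]
    have hr1 : r ≠ 1 := by
      intro h
      have := orderOf_dvd_of_pow_eq_one (hr.symm.trans h)
      rw [hg, hc] at this
      have := Nat.le_of_dvd (by omega) this
      omega
    refine ⟨r, ?_⟩
    have h4 : ((r : ZMod l) - 1) * ((r : ZMod l) * r + r + 1) = 0 := by
      have : (r : ZMod l) ^ 3 = 1 := by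
        have := congrArg Units.val hr3
        rwa [Units.val_pow_eq_pow_val, Units.val_one] at this
      linear_combination this
    have h5 : (r : ZMod l) - 1 ≠ 0 := by
      intro h; apply hr1; ext; simpa using sub_eq_zero.1 h
    linear_combination (mul_eq_zero.1 h4).resolve_left h5
  have hr' : (-1 - r) * (-1 - r) = -1 - (-1 - r) := by linear_combination hr
  have h0 : homOf r hr δ * homOf (-1 - r) hr' δ = 0 := by
    rw [hom_apply (homOf r hr) δ, hom_apply (homOf (-1 - r) hr') δ, homOf_w, homOf_w]
    have h1 : ((norm δ : ℤ) : ZMod l) = 0 := (ZMod.intCast_zmod_eq_zero_iff_dvd _ _).2 hδ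
    rw [nm] at h1
    push_cast at h1
    linear_combination h1 - (δ.im : ZMod l) ^ 2 * hr
  rcases mul_eq_zero.1 h0 with h | h
  · exact ⟨_, h⟩
  · exact ⟨_, h⟩

lemma exists_char (hl : l % 3 = 1) (φ : Zw →+* ZMod l) :
    ∃ χ : MulChar (ZMod l) Zw, ∀ x, x ≠ 0 → χ x ^ 3 = 1 ∧ φ (χ x) = x ^ ((l - 1) / 3) := by
  classical
  have hp := Fact.out (p := l.Prime)
  have h2 := hp.two_le
  have h3 : l ≠ 3 := by rintro rfl; omega
  have hk : ((l - 1) / 3) * 3 = l - 1 := by omega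
  have h1 : ∀ x : ZMod l, x ≠ 0 → ∃ v : Zw, v ^ 3 = 1 ∧ φ v = x ^ ((l - 1) / 3) := by
    intro x hx
    set y := x ^ ((l - 1) / 3) with hy
    have hy3 : y ^ 3 = 1 := by rw [hy, ← pow_mul, hk, ZMod.pow_card_sub_one_eq_one hx]
    have hw := hom_w φ
    have : (y - 1) * ((y - φ w) * (y - (-1 - φ w))) = 0 := by
      linear_combination hy3 + (1 - y) * hw
    rcases mul_eq_zero.1 this with h | h
    · exact ⟨1, by simp, by rw [map_one]; exact (sub_eq_zero.1 h).symm⟩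
    rcases mul_eq_zero.1 h with h | h
    · exact ⟨w, w_cube, (sub_eq_zero.1 h).symm⟩
    · exact ⟨w ^ 2, by rw [← pow_mul, mul_comm, pow_mul, w_cube, one_pow], by
        rw [w_sq']; simp; exact (sub_eq_zero.1 h).symm⟩
  choose v hv1 hv2 using h1
  refine ⟨⟨⟨⟨fun x => if h : x = 0 then 0 else v x h, ?_⟩, ?_⟩, ?_⟩, ?_⟩
  · simp only [one_ne_zero, dite_false]
    apply hom_mu3_inj h3 φ (hv1 _ _) (by simp)
    rw [hv2]; simp
  · intro x y
    by_cases hx : x = 0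
    · simp [hx]
    by_cases hy : y = 0
    · simp [hy]
    simp only [mul_eq_zero, hx, hy, or_self, dite_false]
    apply hom_mu3_inj h3 φ (hv1 _ _) (by rw [mul_pow, hv1, hv1, one_mul])
    rw [map_mul, hv2, hv2, hv2, mul_pow]
  · intro x hx
    have : x = 0 := by by_contra h; exact hx (Ne.isUnit h)
    simp [this]
  · intro x hx
    change (if h : x = 0 then 0 else v x h) ^ 3 = 1 ∧ φ (if h : x = 0 then 0 else v x h) = _
    rw [dif_neg hx]
    exact ⟨hv1 _ _, hv2 _ _⟩

end

end Sch
end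

section
namespace Sch
open QuadraticAlgebra

section
variable {l : ℕ} [Fact l.Prime]

lemma chi_cube {φ : Zw →+* ZMod l} {χ : MulChar (ZMod l) Zw}
    (H : ∀ x, x ≠ 0 → χ x ^ 3 = 1 ∧ φ (χ x) = x ^ ((l - 1) / 3)) : χ ^ 3 = 1 := by
  apply MulChar.ext
  intro x
  simp only [MulChar.pow_apply_coe, MulChar.one_apply_coe]
  exact (H _ x.ne_zero).1

lemma chi_ne_one (hl : l % 3 = 1) {φ : Zw →+* ZMod l} {χ : MulChar (ZMod l) Zw}
    (H : ∀ x, x ≠ 0 → χ x ^ 3 = 1 ∧ φ (χ x) = x ^ ((l - 1) / 3)) : χ ≠ 1 := by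
  intro h
  have hp := Fact.out (p := l.Prime)
  obtain ⟨g, hg⟩ := IsCyclic.exists_ofOrder_eq_natCard (α := (ZMod l)ˣ)
  have hc : Nat.card (ZMod l)ˣ = l - 1 := by
    rw [Nat.card_eq_fintype_card, ZMod.card_units_eq_totient, Nat.totient_prime hp]
  have h2 := (H g g.ne_zero).2
  rw [h, MulChar.one_apply_coe, map_one] at h2
  have h3 : g ^ ((l - 1) / 3) = 1 := by
    ext; rw [Units.val_pow_eq_pow_val, ← h2, Units.val_one]
  have := orderOf_dvd_of_pow_eq_one h3
  rw [hg, hc] at this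
  have h4 := hp.two_le
  have := Nat.le_of_dvd (by omega) this
  omega

lemma chi_order (hl : l % 3 = 1) {φ : Zw →+* ZMod l} {χ : MulChar (ZMod l) Zw}
    (H : ∀ x, x ≠ 0 → χ x ^ 3 = 1 ∧ φ (χ x) = x ^ ((l - 1) / 3)) : orderOf χ = 3 :=
  orderOf_eq_prime (chi_cube H) (chi_ne_one hl H)

lemma star_mu3 {x : Zw} (h : x ^ 3 = 1) : x * star x = 1 := by
  rcases mu3_cases h with rfl | rfl | rfl
  · simp
  · ext <;> simp
  · rw [w_sq']; ext <;> simp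

lemma norm_J (hl : l % 3 = 1) {φ : Zw →+* ZMod l} {χ : MulChar (ZMod l) Zw}
    (H : ∀ x, x ≠ 0 → χ x ^ 3 = 1 ∧ φ (χ x) = x ^ ((l - 1) / 3)) :
    norm (jacobiSum χ χ) = l := by
  have hp := Fact.out (p := l.Prime)
  have hinj : Function.Injective (algebraMap Zw (FractionRing Zw)) :=
    IsFractionRing.injective Zw (FractionRing Zw)
  have hst : χ.ringHomComp (starRingEnd Zw) = χ⁻¹ := by
    rw [eq_inv_iff_mul_eq_one]
    apply MulChar.ext
    intro x
    rw [MulChar.mul_apply, MulChar.ringHomComp_apply, MulChar.one_apply_coe, mul_comm]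
    exact star_mu3 (H _ x.ne_zero).1
  have hinv : jacobiSum χ⁻¹ χ⁻¹ = star (jacobiSum χ χ) := by
    rw [← hst, jacobiSum_ringHomComp]; rfl
  have hc0 : ringChar (FractionRing Zw) = 0 := by
    have : CharZero (FractionRing Zw) := charZero_of_injective_algebraMap hinj
    exact ringChar.eq_zero
  have hcl : ringChar (ZMod l) = l := ZMod.ringChar_zmod_n l
  have hχ' := chi_ne_one hl H
  have hχ2 : χ * χ ≠ 1 := by
    intro h
    have := chi_cube H
    rw [pow_succ, sq, h, one_mul] at this
    exact hχ' this
  have key := jacobiSum_mul_jacobiSum_inv (F := ZMod l) (F' := FractionRing Zw)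
    (by rw [hc0, hcl]; exact hp.ne_zero.symm)
    (χ := χ.ringHomComp (algebraMap Zw (FractionRing Zw)))
    (φ := χ.ringHomComp (algebraMap Zw (FractionRing Zw)))
    ((MulChar.ringHomComp_ne_one_iff hinj).mpr hχ')
    ((MulChar.ringHomComp_ne_one_iff hinj).mpr hχ')
    (by rw [← MulChar.ringHomComp_mul]; exact (MulChar.ringHomComp_ne_one_iff hinj).mpr hχ2)
  rw [MulChar.ringHomComp_inv, jacobiSum_ringHomComp, jacobiSum_ringHomComp, ← map_mul, hinv,
    mul_star_self, ZMod.card] at key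
  have : ((norm (jacobiSum χ χ) : ℤ) : Zw) = ((l : ℤ) : Zw) := by
    apply hinj; rw [key]; simp
  exact_mod_cast this

lemma J_mod (hl : l % 3 = 1) {φ : Zw →+* ZMod l} {χ : MulChar (ZMod l) Zw}
    (H : ∀ x, x ≠ 0 → χ x ^ 3 = 1 ∧ φ (χ x) = x ^ ((l - 1) / 3)) :
    ∃ k : Zw, jacobiSum χ χ = -1 + 3 * k := by
  have hw : IsPrimitiveRoot w 3 := by
    have h := IsPrimitiveRoot.orderOf w
    rwa [orderOf_eq_prime w_cube w_ne_one] at h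
  have h3 := chi_cube H
  have hc : 3 ∣ Fintype.card (ZMod l) - 1 := by rw [ZMod.card]; omega
  obtain ⟨z, -, hz⟩ := exists_jacobiSum_eq_neg_one_add (F := ZMod l) (R := Zw) (χ := χ) (ψ := χ)
    (μ := w) (n := 3) (by norm_num) h3 h3 hc hw
  refine ⟨z * -w, ?_⟩
  rw [hz]
  have : (w - 1) ^ 2 = 3 * -w := by
    have : (w - 1) ^ 2 = w * w - 2 * w + 1 := by ring
    rw [this, w_sq]; ring
  rw [this]; ring

lemma phi_J (hl : l % 3 = 1) {φ : Zw →+* ZMod l} {χ : MulChar (ZMod l) Zw}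
    (H : ∀ x, x ≠ 0 → χ x ^ 3 = 1 ∧ φ (χ x) = x ^ ((l - 1) / 3)) :
    φ (jacobiSum χ χ) = 0 := by
  have hp := Fact.out (p := l.Prime)
  have h2 := hp.two_le
  have h7 : 7 ≤ l := by
    have : l ≠ 4 := by rintro rfl; revert hp; decide
    omega
  set k := (l - 1) / 3 with hk
  have H' : ∀ x, φ (χ x) = x ^ k := by
    intro x
    by_cases hx : x = 0
    · subst hx
      rw [MulChar.map_zero, map_zero, zero_pow (by omega)]
    · exact (H x hx).2
  rw [jacobiSum, map_sum]
  simp only [map_mul, H']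
  have : ∀ x : ZMod l, x ^ k * (1 - x) ^ k = ∑ i ∈ Finset.range (k + 1),
      (((-1) ^ i * (k.choose i) : ZMod l)) * x ^ (k + i) := by
    intro x
    rw [sub_eq_add_neg, add_comm, add_pow, Finset.mul_sum]
    apply Finset.sum_congr rfl
    intro i hi
    rw [neg_pow, pow_add]
    ring
  simp only [this]
  rw [Finset.sum_comm]
  apply Finset.sum_eq_zero
  intro i hi
  rw [← Finset.mul_sum, FiniteField.sum_pow_lt_card_sub_one, mul_zero]
  rw [ZMod.card]
  simp at hi
  omega

lemma J_frob (hl : l % 3 = 1) {φ : Zw →+* ZMod l} {χ : MulChar (ZMod l) Zw}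
    (H : ∀ x, x ≠ 0 → χ x ^ 3 = 1 ∧ φ (χ x) = x ^ ((l - 1) / 3))
    {p : ℕ} (hp : p.Prime) (h3 : p ≠ 3) (hpl : p ≠ l) :
    (p : Zw) ∣ (jacobiSum χ χ * (l : Zw)) ^ ((p ^ 2 - 1) / 3) - χ p := by
  have hlp := Fact.out (p := l.Prime)
  have := Fact.mk hp
  apply dvd_of_homs h3
  intro f
  set F := AlgebraicClosure (ZMod p)
  have : CharP F p := charP_of_injective_algebraMap (algebraMap (ZMod p) F).injective p
  have hch : ringChar F ≠ ringChar (ZMod l) := by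
    rw [ringChar.eq F p, ZMod.ringChar_zmod_n]
    exact hpl
  let ψ := AddChar.FiniteField.primitiveChar (ZMod l) F hch
  let FF := CyclotomicField ψ.n F
  have : CharP FF p := charP_of_injective_algebraMap (algebraMap F FF).injective p
  let f' : Zw →+* FF := (algebraMap F FF).comp f
  suffices h : f' ((jacobiSum χ χ * (l : Zw)) ^ ((p ^ 2 - 1) / 3) - χ p) = 0 by
    apply (algebraMap F FF).injective
    rw [map_zero]; exact h
  let χ' : MulChar (ZMod l) FF := χ.ringHomComp f'
  have hpu : (p : ZMod l) ≠ 0 := by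
    rw [Ne, ZMod.natCast_eq_zero_iff]
    intro h
    exact hpl ((Nat.prime_dvd_prime_iff_eq hlp hp).1 h).symm
  have hlF : (l : FF) ≠ 0 := by
    rw [Ne, CharP.cast_eq_zero_iff FF p]
    intro h
    exact hpl ((Nat.prime_dvd_prime_iff_eq hp hlp).1 h)
  have hχ3 : χ' ^ 3 = 1 := by
    rw [MulChar.ringHomComp_pow, chi_cube H, MulChar.ringHomComp_one]
  have hχ3' : ∀ x : (ZMod l)ˣ, χ' x ^ 3 = 1 := by
    intro x
    rw [← MulChar.pow_apply_coe, hχ3, MulChar.one_apply_coe]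
  have hχ1 : χ' ≠ 1 := by
    intro h
    have h0 := chi_ne_one hl H
    apply h0
    apply MulChar.ext
    intro x
    rw [MulChar.one_apply_coe]
    have hx := (H x x.ne_zero).1
    have h5 : f' (χ x) = 1 := by
      have := congrArg (fun c : MulChar (ZMod l) FF => c x) h
      simpa [χ', MulChar.ringHomComp_apply] using this
    have hw := hom_w f'
    have h33 : (3 : FF) ≠ 0 := by
      intro h
      have h' : ((3 : ℕ) : FF) = 0 := by exact_mod_cast h
      rw [CharP.cast_eq_zero_iff FF p] at h'
      exact h3 ((Nat.prime_dvd_prime_iff_eq hp Nat.prime_three).1 h')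
    have n1 : f' w ≠ 1 := by
      intro h; rw [h] at hw; apply h33; linear_combination hw
    rcases mu3_cases hx with h6 | h6 | h6
    · exact h6
    · rw [h6] at h5; exact absurd h5 n1
    · rw [h6] at h5
      exfalso; apply n1
      have e : f' (w ^ 3) = 1 := by rw [w_cube, map_one]
      rw [pow_succ, map_mul, h5, one_mul] at e
      exact e
  have hord : orderOf χ' = 3 := orderOf_eq_prime hχ3 hχ1
  have hg3 := gaussSum_pow_eq_prod_jacobiSum (χ := χ') (ψ := ψ.char) (by rw [hord]; norm_num) ψ.prim
  have hg0 : gaussSum χ' ψ.char ≠ 0 :=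
    gaussSum_ne_zero_of_nontrivial (by rw [ZMod.card]; exact hlF) hχ1 ψ.prim
  set g := gaussSum χ' ψ.char with hg
  rw [hord, ZMod.card] at hg3
  have hm1 : χ' (-1) = 1 := by
    have h1 : χ' (-1) ^ 3 = 1 := by
      simpa using hχ3' (-1)
    have h2 : χ' (-1) ^ 2 = 1 := by rw [← map_pow]; simp
    calc χ' (-1) = χ' (-1) ^ 3 * 1 := by rw [← h2]; linear_combination (-1 - χ' (-1)^2) * χ' (-1) * h2
      _ = 1 := by rw [h1, one_mul]
  have hJ : ∏ i ∈ Finset.Ico 1 (3 - 1), jacobiSum χ' (χ' ^ i) = f' (jacobiSum χ χ) := by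
    have : Finset.Ico 1 (3 - 1) = {1} := by decide
    rw [this, Finset.prod_singleton, pow_one, jacobiSum_ringHomComp]
  rw [hm1, hJ, one_mul] at hg3
  -- Frobenius
  have hχp2 : χ' ^ (p * p) = χ' := by
    rw [← sq, ← Nat.div_add_mod (p ^ 2) 3, psq_mod hp h3, pow_add, pow_mul, hχ3, one_pow, one_mul,
      pow_one]
  have hfr : g ^ (p * p) = gaussSum χ' (ψ.char ^ (p * p)) := by
    rw [pow_mul, hg, gaussSum_frob p, gaussSum_frob p, ← pow_mul, ← pow_mul, hχp2]
  have hsh := gaussSum_mulShift χ' ψ.char (Units.mk0 (p : ZMod l) hpu * Units.mk0 (p : ZMod l) hpu)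
  have hsh2 : ψ.char.mulShift ((Units.mk0 (p : ZMod l) hpu * Units.mk0 (p : ZMod l) hpu : (ZMod l)ˣ) : ZMod l)
      = ψ.char ^ (p * p) := by
    rw [AddChar.pow_mulShift]; simp
  rw [hsh2, ← hfr, ← hg] at hsh
  simp only [Units.val_mul, Units.val_mk0, map_mul] at hsh
  have hχp3 : χ' p ^ 3 = 1 := by
    simpa using hχ3' (Units.mk0 (p : ZMod l) hpu)
  have hpp : 0 < p ^ 2 := by positivity [hp.pos]
  have hgp : g ^ (p ^ 2 - 1) = χ' p := by
    have e : g ^ (p * p) = g ^ (p ^ 2 - 1) * g := by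
      rw [← pow_succ, ← sq]; congr 1; omega
    rw [e] at hsh
    apply mul_right_cancel₀ hg0
    linear_combination χ' p * hsh - g ^ (p ^ 2 - 1) * g * hχp3
  rw [← three_mul_div hp h3, pow_mul, hg3] at hgp
  rw [map_sub, map_pow, map_mul, map_natCast, mul_comm, hgp]
  simp [χ', MulChar.ringHomComp_apply]

end

end Sch
end

section
namespace Sch
open QuadraticAlgebra

lemma X_neg_one {X : ℤ →* Zw} (h : X (-1) ^ 3 = 1) : X (-1) = 1 := by
  have h2 : X (-1) ^ 2 = 1 := by rw [← map_pow]; simp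
  calc X (-1) = X (-1) ^ 3 := by rw [pow_succ, h2, one_mul]
    _ = 1 := h

/-- Multiplicative induction: two monoid homs agreeing on primes agree. -/
lemma X_eq_of_primes {X Y : ℤ → Zw} (hX : ∀ a b, X (a * b) = X a * X b)
    (S : ℤ → Prop) (hS : ∀ a b, S (a * b) → S a ∧ S b)
    (hY : ∀ a b, S (a * b) → Y (a * b) = Y a * Y b)
    (hX1 : X 1 = Y 1) (hXn : X (-1) = Y (-1))
    {n : ℤ} (hn : n ≠ 0) (hSn : S n)
    (h : ∀ p : ℕ, p.Prime → (p : ℤ) ∣ n → X p = Y p) : X n = Y n := by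
  have key : ∀ m : ℕ, m ≠ 0 → S m → (m : ℤ) ∣ n → X m = Y m := by
    intro m
    induction m using induction_on_primes with
    | zero => simp
    | one => intro _ _ _; simpa using hX1
    | prime_mul p a hp ih =>
      intro h0 hs hd
      push_cast at hs hd ⊢
      rw [hX, hY _ _ hs, h p hp ((dvd_mul_right _ _).trans hd),
        ih (by rintro rfl; simp at h0) (hS _ _ hs).2 ((dvd_mul_left _ _).trans hd)]
  rcases Int.natAbs_eq n with h1 | h1
  · rw [h1] at hSn ⊢
    exact key _ (by simpa using hn) hSn (by simp)
  · have e : n = (-1) * (n.natAbs : ℤ) := by rw [neg_one_mul]; exact h1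
    rw [e] at hSn ⊢
    rw [hX, hY _ _ hSn, hXn, key _ (by simpa using hn) (hS _ _ hSn).2 (by simp)]

lemma X_one_of_primes {X : ℤ →* Zw} (hX : X (-1) = 1) {n : ℤ} (hn : n ≠ 0)
    (h : ∀ p : ℕ, p.Prime → (p : ℤ) ∣ n → X p = 1) : X n = 1 :=
  X_eq_of_primes (X := X) (Y := fun _ => 1) (map_mul X) (fun _ => True) (by simp) (by simp)
    (by simp) hX hn trivial h

lemma sq_mod3 {a : ℤ} (h : ¬ (3 : ℤ) ∣ a) : ∃ k, a ^ 2 = 3 * k + 1 := by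
  have : a % 3 = 1 ∨ a % 3 = 2 := by omega
  have : a ^ 2 % 3 = 1 := by
    rcases this with h | h <;> simp [pow_two, Int.mul_emod, h]
  exact ⟨a ^ 2 / 3, by omega⟩

lemma wz_sq_mul {a b : ℤ} (h : ¬ (3 : ℤ) ∣ a * b) :
    wz (((a * b) ^ 2 - 1) / 3) = wz ((a ^ 2 - 1) / 3) * wz ((b ^ 2 - 1) / 3) := by
  rw [← wz_add]
  apply wz_congr
  obtain ⟨k, hk⟩ := sq_mod3 (a := a) (fun h' => h (h'.mul_right _))
  obtain ⟨m, hm⟩ := sq_mod3 (a := b) (fun h' => h (h'.mul_left _))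
  have e1 : (a ^ 2 - 1) / 3 = k := by omega
  have e2 : (b ^ 2 - 1) / 3 = m := by omega
  have e3 : ((a * b) ^ 2 - 1) / 3 = 3 * k * m + k + m := by
    rw [mul_pow, hk, hm]
    have : (3 * k + 1) * (3 * m + 1) - 1 = 3 * (3 * k * m + k + m) := by ring
    rw [this]; simp
  rw [e1, e2, e3]
  exact ⟨k * m, by ring⟩

lemma wz_prime {p : ℕ} (hp : p.Prime) (h3 : p ≠ 3) :
    wz (((p : ℤ) ^ 2 - 1) / 3) = w ^ ((p ^ 2 - 1) / 3) := by
  rw [← wz_nat]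
  congr 1
  have hpp : 0 < p ^ 2 := by positivity [hp.pos]
  have := three_mul_div hp h3
  zify [hpp] at this ⊢

section
variable {l : ℕ} [Fact l.Prime]

/-- `χ` as a function on integers. -/
noncomputable def chiX (χ : MulChar (ZMod l) Zw) : ℤ →* Zw :=
  χ.toMonoidHom.comp (Int.castRingHom (ZMod l) : ℤ →* ZMod l)

lemma chiX_apply (χ : MulChar (ZMod l) Zw) (n : ℤ) : chiX χ n = χ (n : ZMod l) := rfl

lemma not_dvd_norm_int {p : ℕ} (hp : p.Prime) {n : ℤ} (h : ¬ (p : ℤ) ∣ n) :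
    ¬ (p : ℤ) ∣ norm (n : Zw) := by
  rw [norm_intCast, Int.cast_id]
  exact fun h' => h ((Nat.prime_iff_prime_int.1 hp).dvd_of_dvd_pow h')

/-- `√-3` -/
def s3 : Zw := ⟨1, 2⟩

lemma s3_sq : s3 * s3 = -3 := by ext <;> simp [s3]

lemma norm_s3 : norm s3 = 3 := by rw [nm]; simp [s3]

lemma rec_J (hl : l % 3 = 1) {φ : Zw →+* ZMod l} {χ : MulChar (ZMod l) Zw}
    (H : ∀ x, x ≠ 0 → χ x ^ 3 = 1 ∧ φ (χ x) = x ^ ((l - 1) / 3)) :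
    Rec (jacobiSum χ χ) (chiX χ) := by
  have hlp := Fact.out (p := l.Prime)
  have hlz := Nat.prime_iff_prime_int.1 hlp
  have hl3 : l ≠ 3 := by rintro rfl; omega
  have hN := norm_J hl H
  have hfrob := fun {p : ℕ} (hp : p.Prime) (h3 : p ≠ 3) (hpl : p ≠ l) => J_frob hl H hp h3 hpl
  have hφ := phi_J hl H
  obtain ⟨K, hK⟩ := J_mod hl H
  set δ := jacobiSum χ χ with hδ
  have hu : ∀ n : ℤ, ¬ (l : ℤ) ∣ n → chiX χ n ^ 3 = 1 := by
    intro n hn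
    rw [chiX_apply]
    refine (H _ ?_).1
    rwa [Ne, ZMod.intCast_zmod_eq_zero_iff_dvd]
  have hn1 : chiX χ (-1) = 1 := X_neg_one (hu _ (by
    rw [dvd_neg]; intro h; exact hlz.not_isUnit (isUnit_of_dvd_one h)))
  have hcong : ∀ m n : ℤ, (l : ℤ) ∣ m - n → chiX χ m = chiX χ n := by
    intro m n h
    rw [chiX_apply, chiX_apply]
    congr 1
    have := (ZMod.intCast_zmod_eq_zero_iff_dvd _ _).2 h
    push_cast at this
    exact sub_eq_zero.1 this
  have ha : ∀ p : ℕ, p.Prime → p ≠ 3 → ¬ (p : ℤ) ∣ norm δ →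
      (p : Zw) ∣ (δ * (norm δ : ℤ)) ^ ((p ^ 2 - 1) / 3) - chiX χ p := by
    intro p hp h3 hn
    rw [hN] at hn ⊢
    have hpl : p ≠ l := by rintro rfl; simp at hn
    have := hfrob hp h3 hpl
    rw [chiX_apply]
    simpa using this
  refine ⟨ha, ?_, ?_, ?_⟩
  · intro m n hmn
    apply hcong
    have h1 : norm δ ∣ norm ((m - n : ℤ) : Zw) := map_dvd QuadraticAlgebra.norm hmn
    rw [norm_intCast, Int.cast_id, hN] at h1
    exact hlz.dvd_of_dvd_pow h1
  · intro n hn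
    rw [hN] at hn
    apply hu
    intro h
    exact hlz.not_isUnit (hn.symm.isUnit_of_dvd' dvd_rfl h)
  intro b hb
  set a := δ.re with hae
  have hδd : δ = (a : Zw) + ((3 * b : ℤ) : Zw) * w := by rw [← hb]; exact decomp δ
  have hN' : (l : ℤ) = a ^ 2 - 3 * a * b + 9 * b ^ 2 := by
    rw [← hN, nm, ← hae, hb]; ring
  have ha3 : ¬ (3 : ℤ) ∣ a := by
    intro h
    have : (3 : ℤ) ∣ l := by rw [hN']; obtain ⟨c, hc⟩ := h; rw [hc]; exact ⟨3 * c^2 - 3 * c * b + 3 * b^2, by ring⟩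
    have : 3 ∣ l := by exact_mod_cast this
    omega
  have hl0 := hlp.pos
  have ha0 : a ≠ 0 := by rintro h; rw [h] at ha3; simp at ha3
  have hb0 : b ≠ 0 := by
    rintro rfl
    have : (l : ℤ) = a * a := by rw [hN']; ring
    have h1 := hlz.irreducible.isUnit_or_isUnit this
    simp at h1
    have : (l : ℤ) = 1 := by
      rcases Int.isUnit_iff.1 h1 with h | h <;> rw [this, h] <;> norm_num
    exact hlp.ne_one (by exact_mod_cast this)
  -- gcd facts
  have hab : ∀ p : ℕ, p.Prime → (p : ℤ) ∣ a → (p : ℤ) ∣ b → False := by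
    rintro p hp ⟨c, hc⟩ ⟨d, hd⟩
    have : (l : ℤ) = p * (p * (c ^ 2 - 3 * c * d + 9 * d ^ 2)) := by rw [hN', hc, hd]; ring
    rcases hlz.irreducible.isUnit_or_isUnit this with h | h
    · exact (Nat.prime_iff_prime_int.1 hp).not_isUnit h
    · exact (Nat.prime_iff_prime_int.1 hp).not_isUnit (isUnit_of_mul_isUnit_left h)
  have hpl : ∀ p : ℕ, p.Prime → p ≠ l → ¬ (p : ℤ) ∣ l := by
    intro p hp hne h
    exact hne ((Nat.prime_dvd_prime_iff_eq hp hlp).1 (by exact_mod_cast h))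
  have nsq : ∀ {p : ℕ} (hp : p.Prime) {n : ℤ}, ¬ (p : ℤ) ∣ n → ¬ (p : ℤ) ∣ n ^ 2 :=
    fun hp n h h' => h ((Nat.prime_iff_prime_int.1 hp).dvd_of_dvd_pow h')
  -- p ∣ b gives X p = 1
  have hXb : ∀ p : ℕ, p.Prime → p ≠ 3 → (p : ℤ) ∣ b → chiX χ p = 1 := by
    intro p hp h3 hpb
    have hpa : ¬ (p : ℤ) ∣ a := fun h => hab p hp h hpb
    obtain ⟨c, hc⟩ := hpb
    have hpN : ¬ (p : ℤ) ∣ norm δ := by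
      rw [hN, hN']
      intro h
      apply nsq hp hpa
      have : (p : ℤ) ∣ (a ^ 2 - 3 * a * b + 9 * b ^ 2) + b * (3 * a - 9 * b) :=
        dvd_add h ((Dvd.intro _ hc.symm).mul_right _)
      convert this using 1; ring
    have hpl' : ¬ (l : ℤ) ∣ p := by
      intro h
      have : l = p := (Nat.prime_dvd_prime_iff_eq hlp hp).1 (by exact_mod_cast h)
      apply hpN; rw [hN, this]
    refine eval_cube hp h3 (ρ := (a : Zw)) (hu _ hpl') (not_dvd_norm_int hp hpa) ?_ (ha p hp h3 hpN)
    rw [hN, hN', hδd, hc]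
    refine ⟨-(3 * a ^ 2 * c) + 9 * p * c ^ 2 * a + 3 * c * w * (a ^ 2 - 3 * a * (p * c) + 9 * (p * c) ^ 2), ?_⟩
    push_cast; ring
  -- X a
  have hXa : chiX χ a = wz ((a ^ 2 - 1) / 3) := by
    apply X_eq_of_primes (X := chiX χ) (Y := fun a => wz ((a ^ 2 - 1) / 3)) (map_mul _)
      (fun a => ¬ (3 : ℤ) ∣ a) (fun x y h => ⟨fun h' => h (h'.mul_right _), fun h' => h (h'.mul_left _)⟩)
      (fun x y h => wz_sq_mul h) (by simp [wz_zero]) (by simp [wz_zero, hn1]) ha0 ha3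
    intro p hp hpa
    have h3 : p ≠ 3 := by rintro rfl; exact ha3 hpa
    have hpb : ¬ (p : ℤ) ∣ b := fun h => hab p hp hpa h
    have hp3 : ¬ (p : ℤ) ∣ 3 := fun h => h3 ((Nat.prime_dvd_prime_iff_eq hp Nat.prime_three).1 (by exact_mod_cast h))
    have hp3b : ¬ (p : ℤ) ∣ 3 * b := fun h => ((Nat.prime_iff_prime_int.1 hp).dvd_or_dvd h).elim hp3 hpb
    obtain ⟨c, hc⟩ := hpa
    have hpN : ¬ (p : ℤ) ∣ norm δ := by
      rw [hN, hN']
      intro h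
      apply nsq hp hp3b
      have : (p : ℤ) ∣ (a ^ 2 - 3 * a * b + 9 * b ^ 2) + a * (3 * b - a) :=
        dvd_add h ((Dvd.intro _ hc.symm).mul_right _)
      convert this using 1; ring
    have hpl' : ¬ (l : ℤ) ∣ p := by
      intro h
      have : l = p := (Nat.prime_dvd_prime_iff_eq hlp hp).1 (by exact_mod_cast h)
      apply hpN; rw [hN, this]
    change chiX χ p = wz (((p : ℤ) ^ 2 - 1) / 3)
    rw [wz_prime hp h3]
    apply mu3_eq hp.ne_one (hu _ hpl') (by rw [← pow_mul, mul_comm, pow_mul, w_cube, one_pow])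
    have h1 := ha p hp h3 hpN
    have h2 : (p : Zw) ∣ δ * (norm δ : ℤ) - ((3 * b : ℤ) : Zw) ^ 3 * w := by
      rw [hN, hN', hδd, hc]
      refine ⟨c * (p ^ 2 * c ^ 2 - 3 * p * c * b + 9 * b ^ 2) + 3 * b * w * (p * c ^ 2 - 3 * c * b), ?_⟩
      push_cast; ring
    have h4 := sub_dvd_pow ((p ^ 2 - 1) / 3) h2
    rw [mul_pow (((3 * b : ℤ) : Zw) ^ 3) w, ← pow_mul, three_mul_div hp h3] at h4
    have h5 := fermat hp h3 (not_dvd_norm_int hp hp3b)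
    have := dvd_sub (dvd_add h4 (h5.mul_right (w ^ ((p ^ 2 - 1) / 3)))) h1
    convert this using 1
    ring
  -- decompose b
  obtain ⟨k, b0, hb03, hbk⟩ : ∃ (k : ℕ) (b0 : ℤ), ¬ (3 : ℤ) ∣ b0 ∧ b = 3 ^ k * b0 := by
    obtain ⟨k, b0, h1, h2⟩ := (Int.finiteMultiplicity_iff (a := 3) (b := b)).2 ⟨by norm_num, hb0⟩ |>.exists_eq_pow_mul_and_not_dvd |> fun ⟨c, h1, h2⟩ => (⟨_, c, h2, h1⟩ : ∃ (k : ℕ) (b0 : ℤ), ¬ (3 : ℤ) ∣ b0 ∧ b = 3 ^ k * b0)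
    exact ⟨k, b0, h1, h2⟩
  have hXb0 : chiX χ b0 = 1 := by
    apply X_one_of_primes hn1 (by rintro rfl; simp at hb03)
    intro p hp hpb
    exact hXb p hp (by rintro rfl; exact hb03 hpb) (by rw [hbk]; exact hpb.mul_left _)
  have h3u : chiX χ 3 ^ 3 = 1 := hu 3 (fun h => hl3 ((Nat.prime_dvd_prime_iff_eq hlp Nat.prime_three).1 (by exact_mod_cast h)))
  have hXbk : chiX χ b = chiX χ 3 ^ k := by
    rw [hbk, map_mul, map_pow, hXb0, mul_one]
  -- relation with φ w
  have hr0 : φ w ≠ 0 := by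
    intro h
    have := hom_w φ
    rw [h] at this
    simp at this
  have hr := (H _ hr0)
  have hr2 : χ (φ w) = w ^ ((l - 1) / 3) := by
    apply hom_mu3_inj hl3 φ hr.1 (by rw [← pow_mul, mul_comm, pow_mul, w_cube, one_pow])
    rw [hr.2, map_pow]
  have hrel : chiX χ 3 * chiX χ b * w ^ ((l - 1) / 3) = chiX χ a := by
    rw [← hr2, chiX_apply, chiX_apply]
    have hna : chiX χ a = chiX χ (-a) := by
      rw [← neg_one_mul a, map_mul, hn1, one_mul]
    rw [hna, chiX_apply, ← map_mul, ← map_mul]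
    congr 1
    rw [hδd] at hφ
    rw [map_add, map_mul, map_intCast, map_intCast] at hφ
    push_cast at hφ ⊢
    linear_combination hφ
  have hl' : wz (((l - 1) / 3 : ℕ) : ℤ) = wz ((a ^ 2 - 1) / 3 - a * b) := by
    apply wz_congr
    obtain ⟨m, hm⟩ := sq_mod3 ha3
    have e1 : (a ^ 2 - 1) / 3 = m := by omega
    have e2 : (((l - 1) / 3 : ℕ) : ℤ) * 3 = l - 1 := by omega
    rw [e1]
    refine ⟨b ^ 2, ?_⟩
    have : 3 * ((((l - 1) / 3 : ℕ) : ℤ) - (m - a * b)) = 3 * (3 * b ^ 2) := by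
      linear_combination e2 + hN' + hm
    linarith
  rw [hXbk, hXa, ← wz_nat, hl', sub_eq_add_neg, wz_add, ← pow_succ', mul_comm, mul_assoc] at hrel
  have hrel2 : chiX χ 3 ^ (k + 1) = wz (a * b) := by
    have h1 := mul_left_cancel₀ (wz_ne_zero _) (hrel.trans (mul_one _).symm)
    have h2 : wz (a * b) * wz (-(a * b)) = 1 := by rw [← wz_add, add_neg_cancel, wz_zero]
    calc _ = wz (a * b) * (wz (-(a * b)) * chiX χ 3 ^ (k + 1)) := by rw [← mul_assoc, h2, one_mul]
      _ = _ := by rw [h1, mul_one]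
  rcases Nat.eq_zero_or_pos k with hk | hk
  · rw [hk, zero_add, pow_one] at hrel2; exact hrel2
  have h3b : (3 : ℤ) ∣ b := by
    rw [hbk]; exact (dvd_pow_self 3 (by omega)).mul_right _
  have hwab : wz (a * b) = 1 := wz_eq_one (h3b.mul_left _)
  rw [hwab] at hrel2 ⊢
  -- X (2a-3b) = 1
  have hXc : chiX χ (2 * a - 3 * b) = 1 := by
    have hc3 : ¬ (3 : ℤ) ∣ 2 * a - 3 * b := by
      intro h; apply ha3; omega
    apply X_one_of_primes hn1 (by intro h; rw [h] at hc3; simp at hc3)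
    intro p hp hpc
    have h3 : p ≠ 3 := by rintro rfl; exact hc3 hpc
    by_cases hp2 : p = 2
    · subst hp2
      apply hXb 2 hp h3
      push_cast at hpc ⊢
      omega
    have hp2' : ¬ (p : ℤ) ∣ 2 := fun h => hp2 ((Nat.prime_dvd_prime_iff_eq hp Nat.prime_two).1 (by exact_mod_cast h))
    have hp3 : ¬ (p : ℤ) ∣ 3 := fun h => h3 ((Nat.prime_dvd_prime_iff_eq hp Nat.prime_three).1 (by exact_mod_cast h))
    have hpz := Nat.prime_iff_prime_int.1 hp
    have hpb : ¬ (p : ℤ) ∣ b := by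
      intro h
      have : (p : ℤ) ∣ 2 * a := by
        have := dvd_add hpc (h.mul_left 3)
        simpa using this
      exact hab p hp ((hpz.dvd_or_dvd this).resolve_left hp2') h
    obtain ⟨c, hc⟩ := hpc
    have hpN : ¬ (p : ℤ) ∣ norm δ := by
      rw [hN, hN']
      intro h
      have h1 : (p : ℤ) ∣ 3 * (3 * (3 * b ^ 2)) := by
        have : (p : ℤ) ∣ 4 * (a ^ 2 - 3 * a * b + 9 * b ^ 2) - (2 * a - 3 * b) * (2 * a - 3 * b) :=
          dvd_sub (h.mul_left _) ((Dvd.intro _ hc.symm).mul_right _)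
        convert this using 1; ring
      have h1 := (hpz.dvd_or_dvd h1).resolve_left hp3
      have h1 := (hpz.dvd_or_dvd h1).resolve_left hp3
      have h1 := (hpz.dvd_or_dvd h1).resolve_left hp3
      exact nsq hp hpb h1
    have hpl' : ¬ (l : ℤ) ∣ p := by
      intro h
      have : l = p := (Nat.prime_dvd_prime_iff_eq hlp hp).1 (by exact_mod_cast h)
      apply hpN; rw [hN, this]
    refine eval_cube' hp h3 (ρ := ((-3 * b : ℤ) : Zw) * s3) (m := ((2 : ℤ) : Zw)) (hu _ hpl') ?_
      (not_dvd_norm_int hp hp2') ?_ (ha p hp h3 hpN)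
    · rw [map_mul, norm_s3]
      intro h
      rcases hpz.dvd_or_dvd h with h | h
      · refine not_dvd_norm_int hp ?_ h
        intro h
        rw [neg_mul, dvd_neg] at h
        exact (hpz.dvd_or_dvd h).elim hp3 hpb
      · exact hp3 h
    · have e1 : ((2 : ℤ) : Zw) * δ = ((p * c : ℤ) : Zw) + 3 * b * s3 := by
        rw [← hc, hδd]
        have : s3 = 1 + 2 * w := by ext <;> simp [s3]
        rw [this]
        push_cast; ring
      have e2 : 4 * ((norm δ : ℤ) : Zw) = ((p * c : ℤ) : Zw) ^ 2 + 27 * b ^ 2 := by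
        rw [← hc, hN, hN']; push_cast; ring
      have e3 : s3 ^ 3 = -3 * s3 := by rw [pow_succ, sq, s3_sq]
      have e4 : ((2 : ℤ) : Zw) ^ 3 * (δ * (norm δ : ℤ)) = (((2 : ℤ) : Zw) * δ) * (4 * ((norm δ : ℤ) : Zw)) := by
        push_cast; ring
      rw [e4, e1, e2, mul_pow, e3]
      refine ⟨c * (p ^ 2 * c ^ 2 + 27 * b ^ 2) + 3 * b * s3 * p * c ^ 2, ?_⟩
      push_cast; ring
  have hX2 : chiX χ 3 ^ (2 * k) = 1 := by
    have h1 : chiX χ ((2 * a - 3 * b) ^ 2) = chiX χ (-1 * 3 ^ 3 * b ^ 2) := by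
      apply hcong
      rw [hN']
      exact ⟨4, by ring⟩
    rw [map_pow, hXc, map_mul, map_mul, map_pow, map_pow, hn1, h3u, hXbk] at h1
    rw [mul_comm, pow_mul]
    simpa using h1.symm
  calc chiX χ 3 = chiX χ 3 ^ 3 * chiX χ 3 ^ (2 * k) * chiX χ 3  := by rw [h3u, hX2, one_mul, one_mul]
    _ = (chiX χ 3 ^ (k + 1)) ^ 2 * chiX χ 3 ^ 2 := by ring
    _ = (chiX χ 3 ^ (k + 1)) ^ 2 * chiX χ 3 ^ 2 * (chiX χ 3 ^ (2 * k)) := by rw [hX2, mul_one]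
    _ = ((chiX χ 3 ^ (k + 1)) ^ 2) ^ 2 := by ring
    _ = 1 := by rw [hrel2]; simp

end
end Sch
end

section
namespace Sch
open QuadraticAlgebra

lemma inert_dvd {l : ℕ} (hl : l.Prime) (h2 : l % 3 = 2) {δ : Zw} (h : (l : ℤ) ∣ norm δ) :
    (l : Zw) ∣ δ := by
  have h3 : l ≠ 3 := by rintro rfl; omega
  have h1 := frob1 hl δ
  have e1 : (δ.re : Zw) + (δ.im : Zw) * w ^ l = star δ := by
    rw [w_pow_mod (show l % 3 = 2 % 3 by omega), w_sq']
    ext <;> simp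
  rw [e1] at h1
  have h4 : (l : Zw) ∣ δ ^ (l + 1) := by
    have h5 : (l : Zw) ∣ δ * star δ := by
      rw [mul_star_self]
      have := int_dvd_int.2 h
      simpa using this
    have := dvd_add (h1.mul_left δ) h5
    convert this using 1
    ring
  have h6 : l + 1 ≤ l ^ 2 := by nlinarith [hl.two_le]
  have h7 := frob2 hl h3 δ
  have h8 : (l : Zw) ∣ δ ^ (l ^ 2) := h4.trans (pow_dvd_pow _ h6)
  have := dvd_sub h8 h7
  simpa using this

lemma exists_rec_aux (n : ℕ) : ∀ δ : Zw, (norm δ).natAbs = n → ¬ (3 : ℤ) ∣ δ.re → (3 : ℤ) ∣ δ.im →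
    ∃ X, Rec δ X := by
  induction n using Nat.strong_induction_on with
  | _ n ih =>
  intro δ hn hre him
  have hN := nm δ
  have hnn := nm_nonneg δ
  obtain ⟨b, hb⟩ := him
  obtain ⟨k, hk⟩ := sq_mod3 hre
  by_cases h1 : n = 1
  · have hN1 : norm δ = 1 := by omega
    rw [hN, hb] at hN1
    have hb0 : b = 0 := by
      by_contra h
      have : 1 ≤ b ^ 2 := by
        have : 0 < b ^ 2 := by positivity
        omega
      nlinarith [sq_nonneg (2 * δ.re - 3 * b)]
    have : δ = (δ.re : Zw) := by
      ext <;> simp [hb, hb0]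
    rw [this]
    exact ⟨_, rec_int hre⟩
  obtain ⟨l, hl, hln⟩ := Nat.exists_prime_and_dvd h1
  have hld : (l : ℤ) ∣ norm δ := by
    rw [← Int.natAbs_dvd_natAbs, hn]; simpa using hln
  have hn0 : n ≠ 0 := by
    rintro rfl
    have : norm δ = 0 := by omega
    rw [nm_eq_zero this] at hre
    simp at hre
  have hl3 : l ≠ 3 := by
    rintro rfl
    rw [hN, hb] at hld
    push_cast at hld
    have e : δ.re ^ 2 - δ.re * (3 * b) + (3 * b) ^ 2 = 3 * (k - δ.re * b + 3 * b ^ 2) + 1 := by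
      rw [hk]; ring
    rw [e] at hld
    omega
  have hl30 : l % 3 ≠ 0 := fun h => hl3 ((Nat.prime_dvd_prime_iff_eq Nat.prime_three hl).1
    (Nat.dvd_of_mod_eq_zero h)).symm
  have := Fact.mk hl
  have h2l := hl.two_le
  have hl3' : ¬ (3 : ℤ) ∣ (l : ℤ) := by omega
  rcases (show l % 3 = 1 ∨ l % 3 = 2 by omega) with hl1 | hl2
  · obtain ⟨φ, hφ⟩ := exists_hom hl1 hld
    obtain ⟨χ, H⟩ := exists_char hl1 φ
    have hR := rec_J hl1 H
    have hJN := norm_J hl1 H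
    have hφJ := phi_J hl1 H
    obtain ⟨K, hK⟩ := J_mod hl1 H
    set J := jacobiSum χ χ with hJ
    have hd : (l : Zw) ∣ δ * star J := by
      set z := δ * star J with hz
      have z1 : φ z = 0 := by rw [hz, map_mul, hφ, zero_mul]
      have z2 : φ (star z) = 0 := by rw [hz, star_mul, star_star, map_mul, hφJ, zero_mul]
      rw [hom_apply] at z1 z2
      simp only [re_star, im_star] at z2
      push_cast at z2
      have hw := hom_w φ
      have h33 : (3 : ZMod l) ≠ 0 := by
        intro h
        have h' : ((3 : ℕ) : ZMod l) = 0 := by exact_mod_cast h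
        rw [ZMod.natCast_eq_zero_iff] at h'
        exact hl3 ((Nat.prime_dvd_prime_iff_eq hl Nat.prime_three).1 h')
      have z3 : (z.im : ZMod l) = 0 := by
        have : (z.im : ZMod l) * 3 = 0 := by
          linear_combination (-(1 + 2 * φ w)) * (z1 - z2) + (4 * (z.im : ZMod l)) * hw
        exact (mul_eq_zero.1 this).resolve_right h33
      have z4 : (z.re : ZMod l) = 0 := by rw [z3] at z1; simpa using z1
      rw [dvd_nat]
      exact ⟨(ZMod.intCast_zmod_eq_zero_iff_dvd _ _).1 z4, (ZMod.intCast_zmod_eq_zero_iff_dvd _ _).1 z3⟩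
    obtain ⟨δ', hδ'⟩ := hd
    have hl0 : (l : Zw) ≠ 0 := by
      have := hl.ne_zero
      exact_mod_cast this
    have hdd : δ = J * δ' := by
      apply mul_left_cancel₀ hl0
      have e := mul_star_self J
      rw [hJN] at e
      push_cast at e
      calc (l : Zw) * δ = J * (δ * star J) := by rw [← e]; ring
        _ = _ := by rw [hδ']; ring
    have hNm : norm δ = l * norm δ' := by rw [hdd, map_mul, hJN]
    have hnn' := nm_nonneg δ'
    have hJre : J.re = -1 + 3 * K.re := by rw [hK]; simp
    have hJim : J.im = 3 * K.im := by rw [hK]; simp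
    have h3J : ¬ (3 : ℤ) ∣ J.re := by omega
    have hre' : δ.re = J.re * δ'.re - J.im * δ'.im := by rw [hdd]; simp; ring
    have him' : δ.im = J.re * δ'.im + J.im * δ'.re - J.im * δ'.im := by rw [hdd]; simp; ring
    have c1 : ¬ (3 : ℤ) ∣ δ'.re := by
      rintro ⟨c, hc⟩
      apply hre
      rw [hre', hc, hJim]
      exact ⟨J.re * c - K.im * δ'.im, by ring⟩
    have c2 : (3 : ℤ) ∣ δ'.im := by
      rw [hJre, hJim, hb] at him'
      exact ⟨K.re * δ'.im + K.im * δ'.re - K.im * δ'.im - b, by linarith⟩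
    obtain ⟨X, hX⟩ := ih (norm δ').natAbs (by
      have : (norm δ).natAbs = l * (norm δ').natAbs := by rw [hNm, Int.natAbs_mul]; simp
      rw [hn] at this
      have : 0 < (norm δ').natAbs := by
        rcases Nat.eq_zero_or_pos (norm δ').natAbs with h | h
        · rw [h] at this; omega
        · exact h
      nlinarith) δ' rfl c1 c2
    obtain ⟨b', hb'⟩ := c2
    exact ⟨_, hdd ▸ hR.mul hX hJim hb' h3J c1⟩
  · obtain ⟨δ', hdd⟩ := inert_dvd hl hl2 hld
    have hdd' : δ = ((l : ℤ) : Zw) * δ' := by rw [hdd]; simp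
    have hre' : δ.re = l * δ'.re := by rw [hdd']; simp
    have him' : δ.im = l * δ'.im := by rw [hdd']; simp
    have hNm : norm δ = l ^ 2 * norm δ' := by rw [hdd', map_mul, norm_intCast, Int.cast_id]
    have c1 : ¬ (3 : ℤ) ∣ δ'.re := fun h => hre (by rw [hre']; exact h.mul_left _)
    have c2 : (3 : ℤ) ∣ δ'.im := by
      have : (3 : ℤ) ∣ l * δ'.im := ⟨b, by rw [← him', hb]⟩
      exact (Int.prime_three.dvd_or_dvd this).resolve_left hl3'
    obtain ⟨X, hX⟩ := ih (norm δ').natAbs (by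
      have : (norm δ).natAbs = l ^ 2 * (norm δ').natAbs := by rw [hNm, Int.natAbs_mul]; simp [Int.natAbs_pow]
      rw [hn] at this
      have : 0 < (norm δ').natAbs := by
        rcases Nat.eq_zero_or_pos (norm δ').natAbs with h | h
        · rw [h] at this; omega
        · exact h
      have : 2 ≤ l ^ 2 := by nlinarith
      nlinarith) δ' rfl c1 c2
    obtain ⟨b', hb'⟩ := c2
    exact ⟨_, hdd' ▸ (rec_int hl3').mul hX (b := 0) (by simp) hb' (by simpa using hl3') c1⟩

theorem exists_rec {δ : Zw} (h1 : ¬ (3 : ℤ) ∣ δ.re) (h2 : (3 : ℤ) ∣ δ.im) : ∃ X, Rec δ X :=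
  exists_rec_aux _ δ rfl h1 h2

end Sch
end

section
namespace Sch
open QuadraticAlgebra

/-- `u + 3 v t √-3` -/
def al (u v t : ℤ) : Zw := (u : Zw) + ((3 * v * t : ℤ) : Zw) * s3

lemma norm_add_s3 (a b : ℤ) : norm ((a : Zw) + (b : Zw) * s3) = a ^ 2 + 3 * b ^ 2 := by
  rw [nm]; simp [s3]; ring

lemma norm_al (u v t : ℤ) : norm (al u v t) = u ^ 2 + 27 * v ^ 2 * t ^ 2 := by
  rw [al, norm_add_s3]; ring

/-- `s` is the value of the cubic symbol of `al u v t` at `p`. -/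
def IsVal (u v : ℤ) (p : ℕ) (t : ℤ) (s : Zw) : Prop :=
  s ^ 3 = 1 ∧ (p : Zw) ∣ (al u v t * (norm (al u v t) : ℤ)) ^ ((p ^ 2 - 1) / 3) - s

lemma IsVal.unique {u v : ℤ} {p : ℕ} (hp : p.Prime) {t : ℤ} {s s' : Zw} (h : IsVal u v p t s)
    (h' : IsVal u v p t s') : s = s' := by
  apply mu3_eq hp.ne_one h.1 h'.1
  have := dvd_sub h'.2 h.2
  convert this using 1
  ring

lemma norm_congr {n : ℤ} {z z' : Zw} (h : (n : Zw) ∣ z - z') : n ∣ norm z - norm z' := by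
  obtain ⟨c, hc⟩ := h
  have : z = z' + n * c := by rw [← hc]; ring
  rw [nm, nm, this]
  simp
  exact ⟨2 * z'.re * c.re + n * c.re ^ 2 - z'.re * c.im - c.re * z'.im - n * c.re * c.im
    + 2 * z'.im * c.im + n * c.im ^ 2, by ring⟩

lemma mulnorm_congr {p : ℕ} {z z' : Zw} (h : (p : Zw) ∣ z - z') :
    (p : Zw) ∣ z * (norm z : ℤ) - z' * (norm z' : ℤ) := by
  have h' : ((p : ℤ) : Zw) ∣ z - z' := by simpa using h
  have h1 := int_dvd_int.2 (norm_congr h')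
  push_cast at h1
  have := dvd_add (h.mul_right ((norm z : ℤ) : Zw)) (h1.mul_left z')
  convert this using 1
  ring

lemma IsVal.congr {u v : ℤ} {p : ℕ} {t t' : ℤ} {s : Zw} (h : IsVal u v p t s)
    (ht : (p : ℤ) ∣ t - t') : IsVal u v p t' s := by
  refine ⟨h.1, ?_⟩
  have h1 : (p : Zw) ∣ al u v t' - al u v t := by
    obtain ⟨c, hc⟩ := ht
    have : t = t' + p * c := by linarith
    rw [this, al, al]
    exact ⟨-(3 * v * c * s3), by push_cast; ring⟩
  have := dvd_add (sub_dvd_pow ((p ^ 2 - 1) / 3) (mulnorm_congr h1)) h.2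
  convert this using 1
  ring

lemma IsVal.neg {u v : ℤ} {p : ℕ} (hp : p.Prime) (h3 : p ≠ 3) {t : ℤ} {s : Zw}
    (h : IsVal u v p t s) (hN : ¬ (p : ℤ) ∣ norm (al u v t)) : IsVal u v p (-t) (s ^ 2) := by
  refine ⟨by rw [← pow_mul, mul_comm, pow_mul, h.1, one_pow], ?_⟩
  have hst : al u v (-t) = star (al u v t) := by
    ext <;> simp [al, s3]
  rw [hst, QuadraticAlgebra.norm_star]
  set z := al u v t with hz
  set e := (p ^ 2 - 1) / 3 with he
  have h1 : (z * (norm z : ℤ)) * (star z * (norm z : ℤ)) = ((norm z : ℤ) : Zw) ^ 3 := by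
    rw [← mul_star_self]; ring
  have h2 := fermat hp h3 (not_dvd_norm_int hp hN)
  rw [← three_mul_div hp h3, pow_mul, ← h1, mul_pow] at h2
  -- A*B ≡ 1, A ≡ s
  have h4 := h.2
  have := dvd_sub (h2.mul_left (s ^ 2)) (h4.mul_right (s ^ 2 * (star z * (norm z : ℤ)) ^ e))
  convert this using 1
  have h5 := h.1
  linear_combination (-(star z * (norm z : ℤ)) ^ e) * h5

lemma exists_val {u v : ℤ} (hu : ¬ (3 : ℤ) ∣ u) {p : ℕ} (hp : p.Prime) (h3 : p ≠ 3) {t : ℤ}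
    (hN : ¬ (p : ℤ) ∣ norm (al u v t)) : ∃ s, IsVal u v p t s := by
  obtain ⟨X, hX⟩ := exists_rec (δ := al u v t)
    (by
      have : (al u v t).re = u + 3 * (v * t) := by simp [al, s3]; ring
      rw [this]; omega)
    (by
      have : (al u v t).im = 3 * (2 * (v * t)) := by simp [al, s3]; ring
      rw [this]; exact dvd_mul_right _ _)
  refine ⟨X p, hX.u p ?_, hX.a p hp h3 hN⟩
  exact (Nat.prime_iff_prime_int.1 hp).coprime_iff_not_dvd.2 hN

lemma X_one_of_val {X : ℤ →* Zw} (hX : X (-1) = 1) {n : ℤ} (hn : n ≠ 0)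
    (h : ∀ p : ℕ, p.Prime → (p : ℤ) ∣ n → X p = 1 ∨ (X p ^ 3 = 1 ∧ 3 ∣ padicValInt p n)) :
    X n = 1 := by
  have hn' : n.natAbs ≠ 0 := by simpa using hn
  have e1 : X n = X (n.natAbs : ℤ) := by
    rcases Int.natAbs_eq n with h1 | h1
    · rw [← h1]
    · have e : n = (-1) * (n.natAbs : ℤ) := by rw [neg_one_mul]; exact h1
      conv_lhs => rw [e]
      rw [map_mul, hX, one_mul]
  rw [e1]
  conv_lhs => rw [← Nat.prod_factorization_pow_eq_self hn']
  rw [Finsupp.prod, Nat.cast_prod, map_prod]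
  apply Finset.prod_eq_one
  intro p hp
  have hp' := hp
  simp at hp'
  have hp1 : p.Prime := hp'.1
  have hp2 : p ∣ n.natAbs := hp'.2.1
  push_cast
  rw [map_pow]
  rcases h p hp1 (Int.natCast_dvd.2 hp2) with h1 | ⟨h1, c, hc⟩
  · rw [h1, one_pow]
  · have : n.natAbs.factorization p = padicValInt p n := by
      rw [Nat.factorization_def _ hp1]; rfl
    rw [this, hc, pow_mul, h1, one_pow]

theorem main_rec (E u v x y : ℤ) (huv : IsCoprime u v) (hu3 : ¬ (3 : ℤ) ∣ u) (hxy : IsCoprime x y)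
    (hy3 : ¬ (3 : ℤ) ∣ y) (hc : IsCoprime (x ^ 2 - E * y ^ 2) (u ^ 2 + 27 * E * v ^ 2))
    (hN1 : u ^ 2 + 27 * E * v ^ 2 ≠ 0)
    (hval : ∀ p : ℕ, p.Prime → ¬ (p : ℤ) ∣ 6 * E → 3 ∣ padicValInt p (u ^ 2 + 27 * E * v ^ 2)) :
    ∃ X : ℤ →* Zw, X (-1) = 1 ∧ X (x ^ 2 - E * y ^ 2) = 1 ∧ ((2 : ℤ) ∣ x ^ 2 - E * y ^ 2 → X 2 = 1) ∧
      ∀ p : ℕ, p.Prime → p ≠ 3 → (p : ℤ) ∣ x ^ 2 - E * y ^ 2 → ∀ t : ℤ, (p : ℤ) ∣ x + y * t →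
        ∀ s, IsVal u v p t s → X p = s := by
  have cop : ∀ {p : ℕ} (hp : p.Prime) {a b : ℤ}, IsCoprime a b → (p : ℤ) ∣ a → ¬ (p : ℤ) ∣ b := by
    intro p hp a b h ha hb
    exact (Nat.prime_iff_prime_int.1 hp).not_isUnit (h.isUnit_of_dvd' ha hb)
  have nsq : ∀ {p : ℕ} (hp : p.Prime) {n : ℤ}, ¬ (p : ℤ) ∣ n → ¬ (p : ℤ) ∣ n ^ 2 :=
    fun hp n h h' => h ((Nat.prime_iff_prime_int.1 hp).dvd_of_dvd_pow h')
  have nmul : ∀ {p : ℕ} (hp : p.Prime) {m n : ℤ}, ¬ (p : ℤ) ∣ m → ¬ (p : ℤ) ∣ n → ¬ (p : ℤ) ∣ m * n :=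
    fun hp m n h h' hh => ((Nat.prime_iff_prime_int.1 hp).dvd_or_dvd hh).elim h h'
  have n3 : ∀ {p : ℕ} (hp : p.Prime), p ≠ 3 → ¬ (p : ℤ) ∣ 3 :=
    fun hp h3 h => h3 ((Nat.prime_dvd_prime_iff_eq hp Nat.prime_three).1 (by exact_mod_cast h))
  have hy0 : y ≠ 0 := by rintro rfl; simp at hy3
  set g := (Int.gcd v y : ℤ) with hg
  have hg0 : g ≠ 0 := by
    rw [hg]; simp [Int.gcd_eq_zero_iff, hy0]
  obtain ⟨v', hv'⟩ : g ∣ v := Int.gcd_dvd_left _ _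
  obtain ⟨y', hy'⟩ : g ∣ y := Int.gcd_dvd_right _ _
  have hvyc : IsCoprime v' y' := by
    have := Int.gcd_eq_gcd_ab v y
    refine ⟨Int.gcdA v y, Int.gcdB v y, ?_⟩
    apply mul_left_cancel₀ hg0
    rw [← hg] at this
    linear_combination -this - (Int.gcdA v y) * hv' - (Int.gcdB v y) * hy'
  have hy'3 : ¬ (3 : ℤ) ∣ y' := fun h => hy3 (by rw [hy']; exact h.mul_left _)
  by_cases hv0 : v = 0
  · refine ⟨1, rfl, rfl, fun _ => rfl, ?_⟩
    intro p hp h3 hpN t ht s hs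
    symm
    subst hv0
    have hpu : ¬ (p : ℤ) ∣ u := by
      intro h
      have := cop hp hc hpN
      apply this
      simpa using h.trans (dvd_pow_self u two_ne_zero)
    refine eval_cube hp h3 (ρ := (u : Zw)) hs.1 (not_dvd_norm_int hp hpu) ?_ hs.2
    rw [norm_al, al]
    exact ⟨0, by push_cast; ring⟩
  set δ : Zw := ((u * y' : ℤ) : Zw) + ((-3 * v' * x : ℤ) : Zw) * s3 with hδ
  have hδN : norm δ = 27 * v' ^ 2 * (x ^ 2 - E * y ^ 2) + y' ^ 2 * (u ^ 2 + 27 * E * v ^ 2) := by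
    rw [hδ, norm_add_s3]
    have : v' * y = v * y' := by rw [hy', hv']; ring
    linear_combination (27 * E * (v' * y + v * y')) * this
  have hδN' : norm δ = (u * y') ^ 2 + 27 * (v' * x) ^ 2 := by
    rw [hδ, norm_add_s3]; ring
  have hre : δ.re = u * y' + 3 * (- v' * x) := by rw [hδ]; simp [s3]; ring
  have him : δ.im = 3 * (-2 * v' * x) := by rw [hδ]; simp [s3]; ring
  have huy : ¬ (3 : ℤ) ∣ u * y' := fun h => (Int.prime_three.dvd_or_dvd h).elim hu3 hy'3
  obtain ⟨X, hX⟩ := exists_rec (δ := δ) (by rw [hre]; omega) (by rw [him]; exact dvd_mul_right _ _)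
  have hu : ∀ p : ℕ, p.Prime → ¬ (p : ℤ) ∣ norm δ → X p ^ 3 = 1 := by
    intro p hp h
    exact hX.u p ((Nat.prime_iff_prime_int.1 hp).coprime_iff_not_dvd.2 h)
  have hXn1 : X (-1) = 1 := X_neg_one (hX.u _ (isCoprime_one_left.neg_left))
  -- evaluation type 1: δ ≡ integer
  have ev1 : ∀ p : ℕ, p.Prime → p ≠ 3 → (p : ℤ) ∣ v' * x → ¬ (p : ℤ) ∣ u * y' → X p = 1 := by
    intro p hp h3 ⟨c, hc⟩ h2
    have hN : ¬ (p : ℤ) ∣ norm δ := by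
      rw [hδN', hc]
      intro h
      apply nsq hp h2
      have := dvd_sub h (Dvd.intro (27 * p * c ^ 2) rfl : (p : ℤ) ∣ p * (27 * p * c ^ 2))
      obtain ⟨k, hk⟩ := this
      exact ⟨k, by push_cast at hk ⊢; linear_combination hk⟩
    refine eval_cube hp h3 (ρ := ((u * y' : ℤ) : Zw)) (hu p hp hN) (not_dvd_norm_int hp h2) ?_ (hX.a p hp h3 hN)
    have := mulnorm_congr (p := p) (z := δ) (z' := ((u * y' : ℤ) : Zw)) ⟨-3 * c * s3, by
      rw [hδ]
      have : (-3 * v' * x) = -3 * (p * c) := by rw [← hc]; ring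
      rw [this]; push_cast; ring⟩
    convert this using 1
    rw [norm_intCast]; push_cast; ring
  -- evaluation type 2
  have ev2 : ∀ p : ℕ, p.Prime → p ≠ 3 → (p : ℤ) ∣ u * y' → ¬ (p : ℤ) ∣ v' * x → X p = 1 := by
    intro p hp h3 ⟨c, hc⟩ h2
    have h33 := n3 hp h3
    have hN : ¬ (p : ℤ) ∣ norm δ := by
      rw [hδN', hc]
      intro h
      apply nmul hp h33 (nmul hp h33 (nmul hp h33 (nsq hp h2)))
      have := dvd_sub h (Dvd.intro (p * c ^ 2) rfl : (p : ℤ) ∣ p * (p * c ^ 2))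
      obtain ⟨k, hk⟩ := this
      exact ⟨k, by push_cast at hk ⊢; linear_combination hk⟩
    refine eval_cube hp h3 (ρ := ((3 * (v' * x) : ℤ) : Zw) * s3) (hu p hp hN) ?_ ?_ (hX.a p hp h3 hN)
    · rw [map_mul, norm_s3]
      exact nmul hp (not_dvd_norm_int hp (nmul hp h33 h2)) h33
    have := mulnorm_congr (p := p) (z := δ) (z' := ((-3 * v' * x : ℤ) : Zw) * s3) ⟨c, by
      rw [hδ, hc]; push_cast; ring⟩
    convert this using 1
    have e3 : s3 ^ 3 = -3 * s3 := by rw [pow_succ, sq, s3_sq]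
    rw [map_mul, norm_s3, mul_pow, e3, norm_intCast]; push_cast; ring
  have ev3 : ¬ (2 : ℤ) ∣ norm δ → X 2 = 1 := by
    intro h
    have h' : ¬ ((2 : ℕ) : ℤ) ∣ norm δ := by exact_mod_cast h
    have e := eval_cube Nat.prime_two (by norm_num) (ρ := 1) (hu 2 Nat.prime_two h') (by simp)
      (y := δ * (norm δ : ℤ)) ?_ (by simpa using hX.a 2 Nat.prime_two (by norm_num) h')
    · simpa using e
    have h1 : norm δ % 2 = 1 := by omega
    have h3 : ¬ (2 : ℤ) ∣ δ.re := by
      intro h2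
      apply h
      rw [nm, him]
      obtain ⟨c, hc⟩ := h2
      rw [hc]
      exact ⟨2 * c ^ 2 + 6 * c * v' * x + 18 * v' ^ 2 * x ^ 2, by ring⟩
    rw [dvd_nat]
    simp only [re_sub, im_sub, re_mul, im_mul, re_intCast, im_intCast, one_pow, re_one, im_one]
    push_cast
    constructor
    · have : (δ.re * norm δ) % 2 = 1 := by
        rw [Int.mul_emod, h1]; omega
      have h5 : (2 : ℤ) ∣ (-1) * δ.im * 0 := by simp
      simp at *
      omega
    · rw [him]
      simp
      exact ⟨3 * v' * x * norm δ, by ring⟩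
  -- X v' = 1
  have hv'0 : v' ≠ 0 := by rintro rfl; apply hv0; rw [hv']; ring
  have hy'0 : y' ≠ 0 := by rintro rfl; simp at hy'3
  have hg1 : g ∣ v := ⟨v', hv'⟩
  have hXv : X v' = 1 := by
    apply X_one_of_primes hXn1 hv'0
    intro p hp hpv
    have hpv2 : (p : ℤ) ∣ v := by rw [hv']; exact hpv.mul_left _
    by_cases h3 : p = 3
    · subst h3
      have := hX.c _ him
      push_cast
      rw [this]
      apply wz_eq_one
      have : (3 : ℤ) ∣ v' := by exact_mod_cast hpv
      obtain ⟨c, hc⟩ := this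
      rw [hc]
      exact ⟨δ.re * (-2 * c * x), by ring⟩
    · exact ev1 p hp h3 (hpv.mul_right _) (nmul hp (fun h => cop hp huv h hpv2) (cop hp hvyc hpv))
  have hXy : X y' = 1 := by
    apply X_one_of_primes hXn1 hy'0
    intro p hp hpy
    have h3 : p ≠ 3 := by rintro rfl; exact hy'3 hpy
    have hpy2 : (p : ℤ) ∣ y := by rw [hy']; exact hpy.mul_left _
    exact ev2 p hp h3 (hpy.mul_left _) (nmul hp (fun h => cop hp hvyc h hpy) (fun h => cop hp hxy h hpy2))
  have h33 : X 3 ^ 3 = 1 := by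
    have := hu 3 Nat.prime_three (by
      rw [hδN']
      intro h
      apply nsq Nat.prime_three (n := u * y') (by exact_mod_cast huy)
      have := dvd_sub h (Dvd.intro (9 * (v' * x) ^ 2) rfl : ((3 : ℕ) : ℤ) ∣ ((3 : ℕ) : ℤ) * (9 * (v' * x) ^ 2))
      obtain ⟨k, hk⟩ := this
      exact ⟨k, by push_cast at hk ⊢; linear_combination hk⟩)
    exact_mod_cast this
  have hXN1 : X (u ^ 2 + 27 * E * v ^ 2) = 1 := by
    apply X_one_of_val hXn1 hN1
    intro p hp hpN
    have hpNA : ¬ (p : ℤ) ∣ x ^ 2 - E * y ^ 2 := fun h => cop hp hc h hpN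
    have hpuv : (p : ℤ) ∣ v → False := by
      intro h
      refine cop hp huv ?_ h
      apply (Nat.prime_iff_prime_int.1 hp).dvd_of_dvd_pow (n := 2)
      have := dvd_sub hpN (h.mul_left (27 * E * v))
      obtain ⟨k, hk⟩ := this
      exact ⟨k, by push_cast at hk ⊢; linear_combination hk⟩
    have hpv' : ¬ (p : ℤ) ∣ v' := fun h => hpuv (by rw [hv']; exact h.mul_left _)
    have h3 : p ≠ 3 := by
      rintro rfl
      apply nsq Nat.prime_three (n := u) (by exact_mod_cast hu3)
      have := dvd_sub hpN (Dvd.intro (9 * E * v ^ 2) rfl : ((3 : ℕ) : ℤ) ∣ ((3 : ℕ) : ℤ) * (9 * E * v ^ 2))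
      obtain ⟨k, hk⟩ := this
      exact ⟨k, by push_cast at hk ⊢; linear_combination hk⟩
    have hNδ : ¬ (p : ℤ) ∣ norm δ := by
      rw [hδN]
      intro h
      have h3' := n3 hp h3
      apply nmul hp h3' (nmul hp h3' (nmul hp h3' (nmul hp (nsq hp hpv') hpNA)))
      have := dvd_sub h (hpN.mul_left (y' ^ 2))
      obtain ⟨k, hk⟩ := this
      exact ⟨k, by push_cast at hk ⊢; linear_combination hk⟩
    by_cases hp2 : p = 2
    · left; subst hp2; exact_mod_cast ev3 (by exact_mod_cast hNδ)
    by_cases hpE : (p : ℤ) ∣ E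
    · left
      have hpu : (p : ℤ) ∣ u := by
        apply (Nat.prime_iff_prime_int.1 hp).dvd_of_dvd_pow (n := 2)
        have := dvd_sub hpN (hpE.mul_left (27 * v ^ 2))
        obtain ⟨k, hk⟩ := this
        exact ⟨k, by push_cast at hk ⊢; linear_combination hk⟩
      apply ev2 p hp h3 (hpu.mul_right _) (nmul hp hpv' _)
      intro h
      apply hpNA
      exact dvd_sub (h.trans (dvd_pow_self _ two_ne_zero)) (hpE.mul_right _)
    · right
      refine ⟨hu p hp hNδ, hval p hp ?_⟩
      have h2 : ¬ (p : ℤ) ∣ 2 :=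
        fun h => hp2 ((Nat.prime_dvd_prime_iff_eq hp Nat.prime_two).1 (by exact_mod_cast h))
      rw [show (6 : ℤ) = 2 * 3 by norm_num]
      exact nmul hp (nmul hp h2 (n3 hp h3)) hpE
  refine ⟨X, hXn1, ?_, ?_, ?_⟩
  · have h1 : X (27 * v' ^ 2 * (x ^ 2 - E * y ^ 2)) = X ((-1) * (y' ^ 2 * (u ^ 2 + 27 * E * v ^ 2))) := by
      apply hX.b
      rw [show 27 * v' ^ 2 * (x ^ 2 - E * y ^ 2) - -1 * (y' ^ 2 * (u ^ 2 + 27 * E * v ^ 2)) = norm δ by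
        rw [hδN]; ring, ← mul_star_self]
      exact dvd_mul_right _ _
    rw [map_mul, map_mul, map_mul, map_mul, map_pow, map_pow, hXv, hXy, hXN1, hXn1,
      show (27 : ℤ) = 3 ^ 3 by norm_num, map_pow, h33] at h1
    simpa using h1
  · intro h2
    apply ev3
    have h2' : ((2 : ℕ) : ℤ) ∣ x ^ 2 - E * y ^ 2 := by exact_mod_cast h2
    have a1 := cop Nat.prime_two hc h2'
    have a2 : ¬ ((2 : ℕ) : ℤ) ∣ y := by
      intro h
      refine cop Nat.prime_two hxy ?_ h
      apply (Nat.prime_iff_prime_int.1 Nat.prime_two).dvd_of_dvd_pow (n := 2)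
      have := dvd_add h2' (h.mul_left (E * y))
      obtain ⟨k, hk⟩ := this
      exact ⟨k, by push_cast at hk ⊢; linear_combination hk⟩
    have a3 : ¬ ((2 : ℕ) : ℤ) ∣ y' := fun h => a2 (by rw [hy']; exact h.mul_left _)
    rw [hδN]
    intro h
    apply nmul Nat.prime_two (nsq Nat.prime_two a3) a1
    have h' : ((2 : ℕ) : ℤ) ∣ 27 * v' ^ 2 * (x ^ 2 - E * y ^ 2) + y' ^ 2 * (u ^ 2 + 27 * E * v ^ 2) := by
      exact_mod_cast h
    have := dvd_sub h' (h2'.mul_left (27 * v' ^ 2))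
    obtain ⟨k, hk⟩ := this
    exact ⟨k, by push_cast at hk ⊢; linear_combination hk⟩
  · intro p hp h3 hpN t ht s hs
    have hpN1 := cop hp hc hpN
    have hpy : ¬ (p : ℤ) ∣ y := by
      intro h
      refine cop hp hxy ?_ h
      apply (Nat.prime_iff_prime_int.1 hp).dvd_of_dvd_pow (n := 2)
      have := dvd_add hpN (h.mul_left (E * y))
      obtain ⟨k, hk⟩ := this
      exact ⟨k, by push_cast at hk ⊢; linear_combination hk⟩
    have hpy' : ¬ (p : ℤ) ∣ y' := fun h => hpy (by rw [hy']; exact h.mul_left _)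
    have hpg : ¬ (p : ℤ) ∣ g := fun h => hpy (by rw [hy']; exact h.mul_right _)
    have hNδ : ¬ (p : ℤ) ∣ norm δ := by
      rw [hδN]
      intro h
      apply nmul hp (nsq hp hpy') hpN1
      have := dvd_sub h (hpN.mul_left (27 * v' ^ 2))
      obtain ⟨k, hk⟩ := this
      exact ⟨k, by push_cast at hk ⊢; linear_combination hk⟩
    have h1 := hX.a p hp h3 hNδ
    apply mu3_eq hp.ne_one (hu p hp hNδ) hs.1
    have h4 : (p : Zw) ∣ (y : Zw) * al u v t - (g : Zw) * δ := by
      obtain ⟨c, hc⟩ := ht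
      refine ⟨3 * v * c * s3, ?_⟩
      rw [al, hδ]
      have e1 : (x : Zw) + y * t = p * c := by exact_mod_cast congrArg (Int.cast (R := Zw)) hc
      have e2 : (v : Zw) = g * v' := by exact_mod_cast congrArg (Int.cast (R := Zw)) hv'
      have e3 : (y : Zw) = g * y' := by exact_mod_cast congrArg (Int.cast (R := Zw)) hy'
      push_cast
      linear_combination 3 * v * s3 * e1 - 3 * x * s3 * e2 + u * e3
    have h5 := sub_dvd_pow ((p ^ 2 - 1) / 3) (mulnorm_congr h4)
    have f1 : ∀ (n : ℤ) (z : Zw), ((n : Zw) * z) * (norm ((n : Zw) * z) : ℤ) = (n : Zw) ^ 3 * (z * (norm z : ℤ)) := by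
      intro n z
      rw [map_mul, norm_intCast]; push_cast; ring
    have f2 : ∀ n : ℤ, ¬ (p : ℤ) ∣ n → (p : Zw) ∣ ((n : Zw) ^ 3) ^ ((p ^ 2 - 1) / 3) - 1 := by
      intro n hn
      rw [← pow_mul, three_mul_div hp h3]
      exact fermat hp h3 (not_dvd_norm_int hp hn)
    rw [f1, f1, mul_pow ((y : Zw) ^ 3), mul_pow ((g : Zw) ^ 3)] at h5
    have g1 := f2 y hpy
    have g2 := f2 g hpg
    set P := (al u v t * (norm (al u v t) : ℤ)) ^ ((p ^ 2 - 1) / 3)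
    set Q := (δ * (norm δ : ℤ)) ^ ((p ^ 2 - 1) / 3)
    have := dvd_add (dvd_sub (dvd_sub (dvd_sub (g1.mul_right P) (g2.mul_right Q)) h5) h1) hs.2
    obtain ⟨k, hk⟩ := this
    exact ⟨k, by linear_combination hk⟩

end Sch
end

section
namespace Sch
open NumberField Ideal Filter Topology

/-- weight of an ideal -/
noncomputable def wt {K : Type*} [Field K] [NumberField K] (s : ℝ) (I : Ideal (𝓞 K)) : ENNReal :=
  ENNReal.ofReal ((absNorm I : ℝ) ^ (-s))

section
variable {K : Type*} [Field K] [NumberField K]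

lemma wt_mul (s : ℝ) (I J : Ideal (𝓞 K)) : wt s (I * J) = wt s I * wt s J := by
  unfold wt
  rw [map_mul, Nat.cast_mul, Real.mul_rpow (by positivity) (by positivity),
    ENNReal.ofReal_mul (by positivity)]

lemma wt_bot {s : ℝ} (hs : 0 < s) : wt s (⊥ : Ideal (𝓞 K)) = 0 := by
  unfold wt
  rw [absNorm_bot, Nat.cast_zero, Real.zero_rpow (by linarith), ENNReal.ofReal_zero]

lemma wt_one (s : ℝ) : wt s (1 : Ideal (𝓞 K)) = 1 := by
  unfold wt; simp

lemma wt_ne_top (s : ℝ) (I : Ideal (𝓞 K)) : wt s I ≠ ⊤ := ENNReal.ofReal_ne_top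

lemma wt_le_half {s : ℝ} (hs : 1 < s) {I : Ideal (𝓞 K)} (hI : I ≠ ⊤) : wt s I ≤ 2⁻¹ := by
  by_cases h0 : I = ⊥
  · rw [h0, wt_bot (by linarith)]; simp
  have h2 : 2 ≤ absNorm I := by
    have h1 : absNorm I ≠ 1 := fun h => hI (absNorm_eq_one_iff.1 h)
    have h3 : absNorm I ≠ 0 := fun h => h0 (absNorm_eq_zero_iff.1 h)
    omega
  unfold wt
  rw [show (2⁻¹ : ENNReal) = ENNReal.ofReal (2⁻¹ : ℝ) by
    rw [ENNReal.ofReal_inv_of_pos (by norm_num)]; simp]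
  apply ENNReal.ofReal_le_ofReal
  have h2' : (2 : ℝ) ≤ absNorm I := by exact_mod_cast h2
  calc (absNorm I : ℝ) ^ (-s) ≤ (absNorm I : ℝ) ^ (-1 : ℝ) :=
        Real.rpow_le_rpow_of_exponent_le (by linarith) (by linarith)
    _ = (absNorm I : ℝ)⁻¹ := Real.rpow_neg_one _
    _ ≤ 2⁻¹ := by gcongr

variable (K) in
lemma zeta_sum (s : ℝ) : ∑' I : Ideal (𝓞 K), wt s I =
    ∑' n : ℕ, ENNReal.ofReal ((Nat.card {I : Ideal (𝓞 K) // absNorm I = n} : ℝ) * (n : ℝ) ^ (-s)) := by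
  rw [← (Equiv.sigmaFiberEquiv (fun I : Ideal (𝓞 K) => absNorm I)).tsum_eq, ENNReal.tsum_sigma']
  congr 1
  ext n
  have hfin : Finite {I : Ideal (𝓞 K) // absNorm I = n} := finite_setOfPred_absNorm_eq n
  have : ∀ b : {I : Ideal (𝓞 K) // absNorm I = n},
      wt s ((Equiv.sigmaFiberEquiv (fun I : Ideal (𝓞 K) => absNorm I)) ⟨n, b⟩)
        = ENNReal.ofReal ((n : ℝ) ^ (-s)) := by
    rintro ⟨I, rfl⟩
    rfl
  rw [tsum_congr this, ENNReal.tsum_const, ENNReal.ofReal_mul (by positivity)]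
  congr 1
  rw [ENat.card_eq_coe_natCard]
  simp

variable (K) in
lemma zeta_eq {s : ℝ} (hs : 1 < s) (h0 : dedekindZeta K s ≠ 0) :
    ∑' I : Ideal (𝓞 K), wt s I ≠ ⊤ ∧
      dedekindZeta K s = (((∑' I : Ideal (𝓞 K), wt s I).toReal : ℝ) : ℂ) := by
  set f : ℕ → ℝ := fun n => (Nat.card {I : Ideal (𝓞 K) // absNorm I = n} : ℝ) * (n : ℝ) ^ (-s) with hf
  have hterm : ∀ n : ℕ, LSeries.term (fun n ↦ (Nat.card {I : Ideal (𝓞 K) // absNorm I = n} : ℂ)) s n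
      = ((f n : ℝ) : ℂ) := by
    intro n
    rw [LSeries.term_def, hf]
    split_ifs with h
    · subst h
      dsimp only
      rw [Nat.cast_zero, Real.zero_rpow (by linarith)]; simp
    · rw [Complex.ofReal_mul, Complex.ofReal_cpow (by positivity), div_eq_mul_inv, Complex.ofReal_neg, Complex.cpow_neg]
      simp
  have hz : dedekindZeta K s = ∑' n, ((f n : ℝ) : ℂ) := by
    rw [dedekindZeta, LSeries]
    exact tsum_congr hterm
  have hsum : Summable f := by
    by_contra h
    apply h0
    rw [hz]
    apply tsum_eq_zero_of_not_summable
    rwa [Complex.summable_ofReal]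
  have hnn : ∀ n, 0 ≤ f n := fun n => by rw [hf]; positivity
  have h1 : ∑' I : Ideal (𝓞 K), wt s I = ENNReal.ofReal (∑' n, f n) := by
    rw [zeta_sum, ENNReal.ofReal_tsum_of_nonneg hnn hsum]
  refine ⟨by rw [h1]; exact ENNReal.ofReal_ne_top, ?_⟩
  rw [h1, ENNReal.toReal_ofReal (tsum_nonneg hnn), hz, Complex.ofReal_tsum]

variable (K) in
lemma zeta_tendsto : (∀ᶠ s : ℝ in 𝓝[>] 1, ∑' I : Ideal (𝓞 K), wt s I ≠ ⊤) ∧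
    Tendsto (fun s : ℝ ↦ (s - 1) * (∑' I : Ideal (𝓞 K), wt s I).toReal) (𝓝[>] 1)
      (𝓝 (dedekindZeta_residue K)) := by
  have h := tendsto_sub_one_mul_dedekindZeta_nhdsGT K
  have hne : ∀ᶠ s : ℝ in 𝓝[>] 1, ((s : ℂ) - 1) * dedekindZeta K s ≠ 0 := by
    apply h.eventually_ne
    exact_mod_cast dedekindZeta_residue_ne_zero K
  have hgt : ∀ᶠ s : ℝ in 𝓝[>] 1, 1 < s := eventually_mem_nhdsWithin
  constructor
  · filter_upwards [hne, hgt] with s h1 h2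
    exact (zeta_eq K h2 (right_ne_zero_of_mul h1)).1
  · have h' : Tendsto (fun s : ℝ ↦ (((s : ℂ) - 1) * dedekindZeta K s).re) (𝓝[>] 1)
      (𝓝 (dedekindZeta_residue K)) := by
      have := (Complex.continuous_re.tendsto _).comp h
      rw [Complex.ofReal_re] at this
      exact this
    refine h'.congr' ?_
    filter_upwards [hne, hgt] with s h1 h2
    rw [(zeta_eq K h2 (right_ne_zero_of_mul h1)).2]
    rw [← Complex.ofReal_one, ← Complex.ofReal_sub, ← Complex.ofReal_mul, Complex.ofReal_re]

end
end Sch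
end

section
namespace Sch
open NumberField Ideal Filter Topology UniqueFactorizationMonoid

section
variable {K : Type*} [Field K] [NumberField K]

/-- nonzero ideals not divisible by any element of `S` -/
def Av (S : Finset (Ideal (𝓞 K))) : Set (Ideal (𝓞 K)) := {I | I ≠ ⊥ ∧ ∀ p ∈ S, ¬ p ∣ I}

lemma av_step {s : ℝ} (hs : 1 < s) (S : Finset (Ideal (𝓞 K))) {p : Ideal (𝓞 K)} (hp : p ≠ ⊤)
    [DecidableEq (Ideal (𝓞 K))]
    (hfin : ∑' I : Av S, wt s I.1 ≠ ⊤) :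
    ∑' I : Av S, wt s I.1 ≤ 2 * ∑' I : Av (insert p S), wt s I.1 := by
  set A := ∑' I : Av S, wt s I.1
  set B := ∑' I : Av (insert p S), wt s I.1
  have hsub : Av S ⊆ Av (insert p S) ∪ (fun J => p * J) '' Av S := by
    intro I hI
    by_cases h : p ∣ I
    · right
      obtain ⟨J, rfl⟩ := h
      refine ⟨J, ⟨?_, fun q hq hqJ => hI.2 q hq (hqJ.mul_left _)⟩, rfl⟩
      rintro rfl
      exact hI.1 (by simp)
    · left
      refine ⟨hI.1, ?_⟩
      intro q hq
      rcases Finset.mem_insert.1 hq with rfl | hq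
      · exact h
      · exact hI.2 q hq
  have h1 : A ≤ B + 2⁻¹ * A := by
    calc A ≤ ∑' I : ↥(Av (insert p S) ∪ (fun J => p * J) '' Av S), wt s I.1 :=
          ENNReal.tsum_mono_subtype _ hsub
      _ ≤ B + ∑' I : ↥((fun J => p * J) '' Av S), wt s I.1 := ENNReal.tsum_union_le _ _ _
      _ ≤ B + ∑' I : Av S, wt s (p * I.1) := by
          gcongr
          have hsurj : Function.Surjective (fun I : Av S =>
              (⟨p * I.1, ⟨I.1, I.2, rfl⟩⟩ : ↥((fun J => p * J) '' Av S))) := by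
            rintro ⟨_, J, hJ, rfl⟩
            exact ⟨⟨J, hJ⟩, rfl⟩
          exact ENNReal.tsum_le_tsum_comp_of_surjective hsurj
            (fun I : ↥((fun J => p * J) '' Av S) => wt s I.1)
      _ ≤ B + 2⁻¹ * A := by
          gcongr
          rw [← ENNReal.tsum_mul_left]
          apply ENNReal.tsum_le_tsum
          intro I
          rw [wt_mul]
          gcongr
          exact wt_le_half hs hp
  by_cases hB : B = ⊤
  · rw [hB]; simp
  · rw [← ENNReal.toReal_le_toReal hfin (ENNReal.mul_ne_top (by simp) hB)]
    have h2 := ENNReal.toReal_mono (ENNReal.add_ne_top.2 ⟨hB, ENNReal.mul_ne_top (by simp) hfin⟩) h1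
    rw [ENNReal.toReal_add hB (ENNReal.mul_ne_top (by simp) hfin), ENNReal.toReal_mul] at h2
    rw [ENNReal.toReal_mul]
    simp at h2 ⊢
    linarith

lemma av_all {s : ℝ} (hs : 1 < s) (hfin : ∑' I : Ideal (𝓞 K), wt s I ≠ ⊤)
    (S : Finset (Ideal (𝓞 K))) (hS : ∀ p ∈ S, p ≠ ⊤) :
    ∑' I : Ideal (𝓞 K), wt s I ≤ 2 ^ S.card * ∑' I : Av S, wt s I.1 := by
  classical
  induction S using Finset.induction_on with
  | empty =>
    simp only [Finset.card_empty, pow_zero, one_mul]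
    rw [tsum_subtype]
    apply ENNReal.tsum_le_tsum
    intro I
    by_cases h : I = ⊥
    · rw [h, wt_bot (by linarith)]; simp
    · rw [Set.indicator_of_mem]
      exact ⟨h, by simp⟩
  | insert p S hp ih =>
    refine (ih (fun q hq => hS q (Finset.mem_insert_of_mem hq))).trans ?_
    rw [Finset.card_insert_of_notMem hp, pow_succ, mul_assoc]
    gcongr
    apply av_step hs S (hS p (Finset.mem_insert_self _ _))
    refine ne_top_of_le_ne_top hfin ?_
    exact ENNReal.tsum_comp_le_tsum_of_injective Subtype.val_injective _

end

section
variable {K M : Type*} [Field K] [NumberField K] [Field M] [NumberField M]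

open Classical in
theorem no_split (S : Finset (Ideal (𝓞 K))) (hS : ∀ p ∈ S, p ≠ ⊤)
    (P1 P2 : Ideal (𝓞 K) → Ideal (𝓞 M)) (c : Ideal (𝓞 M) → Ideal (𝓞 K))
    (h1 : ∀ p : Ideal (𝓞 K), p.IsPrime → p ≠ ⊥ → p ∉ S →
      (P1 p).IsPrime ∧ P1 p ≠ ⊥ ∧ absNorm (P1 p) = absNorm p ∧ c (P1 p) = p)
    (h2 : ∀ p : Ideal (𝓞 K), p.IsPrime → p ≠ ⊥ → p ∉ S →
      (P2 p).IsPrime ∧ P2 p ≠ ⊥ ∧ absNorm (P2 p) = absNorm p ∧ c (P2 p) = p)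
    (h12 : ∀ p : Ideal (𝓞 K), p.IsPrime → p ≠ ⊥ → p ∉ S → P1 p ≠ P2 p) : False := by
  have hgood : ∀ I ∈ Av S, ∀ p ∈ normalizedFactors I, p.IsPrime ∧ p ≠ ⊥ ∧ p ∉ S := by
    intro I hI p hp
    have h := prime_of_normalized_factor p hp
    exact ⟨isPrime_of_prime h, h.ne_zero, fun h' => hI.2 p h' (dvd_of_mem_normalizedFactors hp)⟩
  -- the map on ideals
  let φ : (Ideal (𝓞 K) → Ideal (𝓞 M)) → Ideal (𝓞 K) → Ideal (𝓞 M) :=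
    fun P I => ((normalizedFactors I).map P).prod
  have hwt : ∀ (s : ℝ) (P : Ideal (𝓞 K) → Ideal (𝓞 M)), (∀ p : Ideal (𝓞 K), p.IsPrime → p ≠ ⊥ → p ∉ S →
      (P p).IsPrime ∧ P p ≠ ⊥ ∧ absNorm (P p) = absNorm p ∧ c (P p) = p) → ∀ I ∈ Av S,
      wt s (φ P I) = wt s I := by
    intro s P hP I hI
    have e : absNorm (φ P I) = absNorm I := by
      conv_rhs => rw [← Ideal.prod_normalizedFactors_eq_self hI.1]
      rw [map_multiset_prod, map_multiset_prod, Multiset.map_map]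
      congr 1
      apply Multiset.map_congr rfl
      intro p hp
      obtain ⟨a, b, d⟩ := hgood I hI p hp
      exact (hP p a b d).2.2.1
    unfold wt
    rw [e]
  have hfac : ∀ I ∈ Av S, ∀ J ∈ Av S, normalizedFactors (φ P1 I * φ P2 J) =
      (normalizedFactors I).map P1 + (normalizedFactors J).map P2 := by
    intro I hI J hJ
    have : φ P1 I * φ P2 J = ((normalizedFactors I).map P1 + (normalizedFactors J).map P2).prod := by
      rw [Multiset.prod_add]
    rw [this, normalizedFactors_prod_of_prime]
    intro Q hQ
    rcases Multiset.mem_add.1 hQ with hQ | hQ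
    · obtain ⟨p, hp, rfl⟩ := Multiset.mem_map.1 hQ
      obtain ⟨a, b, d⟩ := hgood I hI p hp
      have := h1 p a b d
      exact prime_of_isPrime this.2.1 this.1
    · obtain ⟨p, hp, rfl⟩ := Multiset.mem_map.1 hQ
      obtain ⟨a, b, d⟩ := hgood J hJ p hp
      have := h2 p a b d
      exact prime_of_isPrime this.2.1 this.1
  have hinj : Function.Injective (fun x : Av S × Av S => φ P1 x.1.1 * φ P2 x.2.1) := by
    rintro ⟨⟨I, hI⟩, ⟨J, hJ⟩⟩ ⟨⟨I', hI'⟩, ⟨J', hJ'⟩⟩ h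
    have h := congrArg normalizedFactors h
    dsimp only at h
    rw [hfac I hI J hJ, hfac I' hI' J' hJ'] at h
    have key1 : ∀ I ∈ Av S, ((normalizedFactors I).map P1).filter (fun Q => P1 (c Q) = Q) =
        (normalizedFactors I).map P1 := by
      intro I hI
      rw [Multiset.filter_eq_self]
      intro Q hQ
      obtain ⟨p, hp, rfl⟩ := Multiset.mem_map.1 hQ
      obtain ⟨a, b, d⟩ := hgood I hI p hp
      rw [(h1 p a b d).2.2.2]
    have key2 : ∀ I ∈ Av S, ((normalizedFactors I).map P2).filter (fun Q => P1 (c Q) = Q) = 0 := by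
      intro I hI
      rw [Multiset.filter_eq_nil]
      intro Q hQ
      obtain ⟨p, hp, rfl⟩ := Multiset.mem_map.1 hQ
      obtain ⟨a, b, d⟩ := hgood I hI p hp
      rw [(h2 p a b d).2.2.2]
      exact h12 p a b d
    have key3 : ∀ I ∈ Av S, ∀ P : Ideal (𝓞 K) → Ideal (𝓞 M), (∀ p : Ideal (𝓞 K), p.IsPrime → p ≠ ⊥ → p ∉ S →
      (P p).IsPrime ∧ P p ≠ ⊥ ∧ absNorm (P p) = absNorm p ∧ c (P p) = p) →
      (((normalizedFactors I).map P).map c).prod = I := by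
      intro I hI P hP
      conv_rhs => rw [← Ideal.prod_normalizedFactors_eq_self hI.1]
      rw [Multiset.map_map]
      congr 1
      conv_rhs => rw [← Multiset.map_id (normalizedFactors I)]
      apply Multiset.map_congr rfl
      intro p hp
      obtain ⟨a, b, d⟩ := hgood I hI p hp
      exact (hP p a b d).2.2.2
    have e1 := congrArg (Multiset.filter (fun Q => P1 (c Q) = Q)) h
    rw [Multiset.filter_add, Multiset.filter_add, key1 I hI, key1 I' hI', key2 J hJ, key2 J' hJ',
      add_zero, add_zero] at e1
    rw [e1] at h
    have e2 := add_left_cancel h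
    have f1 : I = I' := by rw [← key3 I hI P1 h1, e1, key3 I' hI' P1 h1]
    have f2 : J = J' := by rw [← key3 J hJ P2 h2, e2, key3 J' hJ' P2 h2]
    subst f1 f2
    rfl
  have hsq : ∀ s : ℝ, (∑' I : Av S, wt s I.1) * (∑' I : Av S, wt s I.1) ≤ ∑' I : Ideal (𝓞 M), wt s I := by
    intro s
    rw [← ENNReal.tsum_mul_right]
    simp_rw [← ENNReal.tsum_mul_left]
    rw [← ENNReal.tsum_prod]
    refine le_trans (le_of_eq ?_) (ENNReal.tsum_comp_le_tsum_of_injective hinj _)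
    apply tsum_congr
    rintro ⟨⟨I, hI⟩, ⟨J, hJ⟩⟩
    dsimp only
    rw [wt_mul, hwt s P1 h1 I hI, hwt s P2 h2 J hJ]
  obtain ⟨k1, k2⟩ := zeta_tendsto K
  obtain ⟨m1, m2⟩ := zeta_tendsto M
  have hgt : ∀ᶠ s : ℝ in 𝓝[>] 1, 1 < s := eventually_mem_nhdsWithin
  have hle : ∀ᶠ s : ℝ in 𝓝[>] 1, ((s - 1) * (∑' I : Ideal (𝓞 K), wt s I).toReal) ^ 2 ≤
      (4 ^ S.card * (s - 1)) * ((s - 1) * (∑' I : Ideal (𝓞 M), wt s I).toReal) := by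
    filter_upwards [k1, m1, hgt] with s a b hs
    have l1 := av_all hs a S hS
    have l2 : (∑' I : Ideal (𝓞 K), wt s I) ^ 2 ≤ 4 ^ S.card * ∑' I : Ideal (𝓞 M), wt s I := by
      calc (∑' I : Ideal (𝓞 K), wt s I) ^ 2 ≤ (2 ^ S.card * ∑' I : Av S, wt s I.1) ^ 2 := by gcongr
        _ = 4 ^ S.card * ((∑' I : Av S, wt s I.1) * (∑' I : Av S, wt s I.1)) := by
            rw [mul_pow, ← pow_mul, mul_comm, mul_comm S.card 2, pow_mul, sq]
            norm_num
            ring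
        _ ≤ _ := by gcongr; exact hsq s
    have l3 := ENNReal.toReal_mono (ENNReal.mul_ne_top (by simp) b) l2
    rw [ENNReal.toReal_pow, ENNReal.toReal_mul, ENNReal.toReal_pow] at l3
    simp only [ENNReal.toReal_ofNat] at l3
    rw [mul_pow]
    calc (s - 1) ^ 2 * (∑' I : Ideal (𝓞 K), wt s I).toReal ^ 2
        ≤ (s - 1) ^ 2 * (4 ^ S.card * (∑' I : Ideal (𝓞 M), wt s I).toReal) := by gcongr
      _ = _ := by ring
  have lim1 := k2.pow 2
  have lim0 : Tendsto (fun s : ℝ => (4 : ℝ) ^ S.card * (s - 1)) (𝓝[>] 1) (𝓝 0) := by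
    have : Tendsto (fun s : ℝ => (4 : ℝ) ^ S.card * (s - 1)) (𝓝 1) (𝓝 (4 ^ S.card * (1 - 1))) := by
      apply Continuous.tendsto; fun_prop
    rw [sub_self, mul_zero] at this
    exact this.mono_left nhdsWithin_le_nhds
  have lim2 := lim0.mul m2
  have := le_of_tendsto_of_tendsto lim1 lim2 hle
  rw [zero_mul] at this
  have hp := dedekindZeta_residue_pos K
  nlinarith [pow_pos hp 2]

end
end Sch
end

section
namespace Sch
open NumberField Ideal
open scoped Pointwise

section
variable {L M : Type*} [Field L] [NumberField L] [Field M] [NumberField M] [Algebra L M] [IsGalois L M]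

theorem split_prime (hf : Module.finrank L M = 3) (ω : 𝓞 L) (hω : ω ^ 2 + ω + 1 = 0) (β : 𝓞 L)
    (b : 𝓞 M) (hb : b ^ 3 = algebraMap (𝓞 L) (𝓞 M) β) (σ : Gal(M/L)) (hσ : σ • b ≠ b)
    (p : Ideal (𝓞 L)) [p.IsPrime] (hp0 : p ≠ ⊥) (h3 : 3 * β ∉ p) (r : 𝓞 L) (hr : r ^ 3 - β ∈ p)
    (P : Ideal (𝓞 M)) [P.IsPrime] [P.LiesOver p] :
    σ • P ≠ P ∧ absNorm P = absNorm p ∧ absNorm (σ • P) = absNorm p := by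
  have hmem : ∀ a : 𝓞 L, algebraMap (𝓞 L) (𝓞 M) a ∈ P ↔ a ∈ p := by
    intro a
    rw [Ideal.over_def P p, Ideal.under_def, Ideal.mem_comap]
  -- b is congruent to an element of L
  obtain ⟨r', hr'⟩ : ∃ r' : 𝓞 L, b - algebraMap (𝓞 L) (𝓞 M) r' ∈ P := by
    have h1 : b ^ 3 - (algebraMap (𝓞 L) (𝓞 M) r) ^ 3 ∈ P := by
      have := (hmem _).2 (neg_mem hr)
      rw [hb]
      convert this using 1
      simp
    have hω' : (algebraMap (𝓞 L) (𝓞 M) ω) ^ 2 + algebraMap (𝓞 L) (𝓞 M) ω + 1 = 0 := by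
      have := congrArg (algebraMap (𝓞 L) (𝓞 M)) hω
      simpa using this
    set W := algebraMap (𝓞 L) (𝓞 M) ω
    set R := algebraMap (𝓞 L) (𝓞 M) r
    have h2 : b ^ 3 - R ^ 3 = (b - R) * ((b - W * R) * (b - W ^ 2 * R)) := by
      have w3 : W ^ 3 = 1 := by linear_combination (W - 1) * hω'
      linear_combination (b ^ 2 * R - b * R ^ 2) * hω' + (b * R ^ 2 - R ^ 3) * (-w3)
    rw [h2] at h1
    rcases Ideal.IsPrime.mem_or_mem ‹P.IsPrime› h1 with h | h
    · exact ⟨r, h⟩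
    rcases Ideal.IsPrime.mem_or_mem ‹P.IsPrime› h with h | h
    · exact ⟨ω * r, by simpa using h⟩
    · exact ⟨ω ^ 2 * r, by simpa using h⟩
  have hfix : ∀ (τ : Gal(M/L)) (a : 𝓞 L), τ • (algebraMap (𝓞 L) (𝓞 M) a) = algebraMap (𝓞 L) (𝓞 M) a :=
    fun τ a => smul_algebraMap τ a
  have hne : σ • P ≠ P := by
    intro hPP
    have h1 : σ • b - algebraMap (𝓞 L) (𝓞 M) r' ∈ P := by
      rw [← hPP]
      have := Ideal.smul_mem_pointwise_smul σ _ _ hr'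
      rwa [smul_sub, hfix] at this
    set x := σ • b with hx
    have hx3 : x ^ 3 = b ^ 3 := by
      rw [hx, ← smul_pow', hb, hfix]
    have hq : x ^ 2 + x * b + b ^ 2 = 0 := by
      have : (x - b) * (x ^ 2 + x * b + b ^ 2) = 0 := by linear_combination hx3
      exact (mul_eq_zero.1 this).resolve_left (sub_ne_zero.2 hσ)
    have hxb : x - b ∈ P := by
      have := P.sub_mem h1 hr'
      convert this using 1; ring
    apply h3
    rw [← hmem, map_mul, ← hb]
    have := P.mul_mem_left (-b * (x + 2 * b)) hxb
    convert this using 1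
    simp only [map_ofNat]
    linear_combination b * hq
  have hbr := Ideal.ncard_primesOver_mul_ramificationIdxIn_mul_inertiaDegIn p (𝓞 M) Gal(M/L)
  have hcard : Nat.card Gal(M/L) = 3 := by rw [IsGaloisGroup.card_eq_finrank Gal(M/L) L M, hf]
  have hpmax : p.IsMaximal := Ring.DimensionLEOne.maximalOfPrime hp0 inferInstance
  have hPmax : P.IsMaximal := Ideal.isMaximal_of_isIntegral_of_isMaximal_comap (R := 𝓞 L) P (by
    rw [← Ideal.under_def, ← Ideal.over_def P p]; exact hpmax)
  have hσP : (σ • P).IsPrime := inferInstance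
  have hσL : (σ • P).LiesOver p := inferInstance
  have hg : 2 ≤ (p.primesOver (𝓞 M)).ncard := by
    have hfin : (p.primesOver (𝓞 M)).Finite := by
      apply Set.finite_of_ncard_ne_zero
      intro h0
      rw [h0, hcard] at hbr
      simp at hbr
    have : ({P, σ • P} : Set (Ideal (𝓞 M))) ⊆ p.primesOver (𝓞 M) := by
      rintro Q (rfl | rfl)
      · exact ⟨inferInstance, inferInstance⟩
      · exact ⟨hσP, hσL⟩
    calc 2 = ({P, σ • P} : Set (Ideal (𝓞 M))).ncard := (Set.ncard_pair hne.symm).symm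
      _ ≤ _ := Set.ncard_le_ncard this hfin
  rw [hcard] at hbr
  have hf1 : p.inertiaDegIn (𝓞 M) = 1 := by
    have h1 : (p.primesOver (𝓞 M)).ncard = 3 := by
      rcases (Nat.dvd_prime Nat.prime_three).1 ⟨_, hbr.symm⟩ with h | h
      · omega
      · exact h
    rw [h1] at hbr
    have : p.ramificationIdxIn (𝓞 M) * p.inertiaDegIn (𝓞 M) = 1 := by omega
    exact Nat.eq_one_of_mul_eq_one_left this
  have key : ∀ Q : Ideal (𝓞 M), Q.IsPrime → Q.LiesOver p → absNorm Q = absNorm p := by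
    intro Q _ _
    have hQmax : Q.IsMaximal := Ideal.isMaximal_of_isIntegral_of_isMaximal_comap (R := 𝓞 L) Q (by
      rw [← Ideal.under_def, ← Ideal.over_def Q p]; exact hpmax)
    rw [Ideal.absNorm_eq_pow_inertiaDeg'_of_liesOver Q p inferInstance hp0,
      Ideal.inertiaDeg'_eq_inertiaDeg, ← Ideal.inertiaDegIn_eq_inertiaDeg p Q Gal(M/L), hf1, pow_one]
  exact ⟨hne, key _ inferInstance inferInstance, key _ hσP hσL⟩

end

section
open Polynomial
variable {L : Type*} [Field L] [NumberField L]

theorem cube_of_local (ω : 𝓞 L) (hω : ω ^ 2 + ω + 1 = 0) (β : 𝓞 L) (hβ : β ≠ 0) (n : 𝓞 L) (hn : n ≠ 0)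
    (h : ∀ p : Ideal (𝓞 L), p.IsPrime → p ≠ ⊥ → n ∉ p → ∃ r : 𝓞 L, r ^ 3 - β ∈ p) :
    ∃ x : L, x ^ 3 = (β : L) := by
  classical
  by_contra hcon
  push Not at hcon
  have hirr : Irreducible (X ^ 3 - C (β : L)) := X_pow_sub_C_irreducible_of_prime Nat.prime_three hcon
  have : Fact (Irreducible (X ^ 3 - C (β : L))) := ⟨hirr⟩
  have hωL : (ω : L) ^ 2 + (ω : L) + 1 = 0 := by
    have := congrArg (algebraMap (𝓞 L) L) hω
    simpa using this
  have hprim : (primitiveRoots 3 L).Nonempty := by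
    refine ⟨(ω : L), ?_⟩
    rw [mem_primitiveRoots (by norm_num)]
    rw [← Polynomial.isRoot_cyclotomic_iff, Polynomial.cyclotomic_three]
    simp
    linear_combination hωL
  let M := AdjoinRoot (X ^ 3 - C (β : L))
  have : IsSplittingField L M (X ^ 3 - C (β : L)) := isSplittingField_AdjoinRoot_X_pow_sub_C hprim hirr
  have : IsGalois L M := isGalois_of_isSplittingField_X_pow_sub_C hprim hirr M
  have hf : Module.finrank L M = 3 := finrank_of_isSplittingField_X_pow_sub_C hprim hirr M
  have : FiniteDimensional L M := Module.finite_of_finrank_pos (by omega)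
  have : CharZero M := charZero_of_injective_algebraMap (algebraMap L M).injective
  have : IsScalarTower ℚ L M := inferInstance
  have : FiniteDimensional ℚ M := FiniteDimensional.trans ℚ L M
  have : NumberField M := { to_charZero := inferInstance, to_finiteDimensional := inferInstance }
  let b0 : M := AdjoinRoot.root (X ^ 3 - C (β : L))
  have hb0 : b0 ^ 3 = algebraMap L M (β : L) := by
    have := AdjoinRoot.eval₂_root (X ^ 3 - C (β : L))
    rw [eval₂_sub, eval₂_pow, eval₂_X, eval₂_C, sub_eq_zero] at this
    exact this
  have hintegral : IsIntegral ℤ b0 := by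
    apply IsIntegral.of_pow (n := 3) (by norm_num)
    rw [hb0]
    exact (RingOfIntegers.isIntegral_coe β).algebraMap
  let b : 𝓞 M := ⟨b0, hintegral⟩
  have hb : b ^ 3 = algebraMap (𝓞 L) (𝓞 M) β := by
    apply RingOfIntegers.ext
    simp only [b, map_pow]
    exact hb0
  have hcard : Nat.card Gal(M/L) = 3 := by rw [IsGaloisGroup.card_eq_finrank Gal(M/L) L M, hf]
  obtain ⟨σ, hσ1⟩ : ∃ σ : Gal(M/L), σ ≠ 1 := by
    by_contra hc
    push Not at hc
    have : Subsingleton Gal(M/L) := ⟨fun a c => by rw [hc a, hc c]⟩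
    have := Nat.card_of_subsingleton (1 : Gal(M/L))
    omega
  have hσ : σ • b ≠ b := by
    intro hc
    apply hσ1
    have h1 : σ b0 = b0 := congrArg (algebraMap (𝓞 M) M) hc
    have : (σ : M →ₐ[L] M) = AlgHom.id L M := by
      apply AdjoinRoot.algHom_ext
      exact h1
    ext x
    exact DFunLike.congr_fun this x
  -- bad primes
  have hbad : ({p : Ideal (𝓞 L) | p.IsPrime ∧ p ≠ ⊥ ∧ n * (3 * β) ∈ p}).Finite := by
    have h0 : span {n * (3 * β)} ≠ (0 : Ideal (𝓞 L)) := by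
      rw [Ideal.zero_eq_bot, Ne, Ideal.span_singleton_eq_bot]
      exact mul_ne_zero hn (mul_ne_zero (by norm_num) hβ)
    refine ((Ideal.finite_factors h0).image (fun v => v.asIdeal)).subset ?_
    rintro p ⟨h1, h2, h3⟩
    exact ⟨⟨p, h1, h2⟩, by
      simpa [Ideal.dvd_span_singleton] using h3, rfl⟩
  have hex : ∀ p : Ideal (𝓞 L), ∃ P : Ideal (𝓞 M), p.IsPrime → P.IsPrime ∧ P.LiesOver p := by
    intro p
    by_cases hp : p.IsPrime
    · obtain ⟨⟨P, h1, h2⟩⟩ := (inferInstance : Nonempty (primesOver p (𝓞 M)))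
      exact ⟨P, fun _ => ⟨h1, h2⟩⟩
    · exact ⟨⊥, fun h => absurd h hp⟩
  choose P hP using hex
  refine no_split (K := L) (M := M) hbad.toFinset ?_ P (fun p => σ • P p) (fun Q => Q.under (𝓞 L)) ?_ ?_ ?_
  · intro p hp
    rw [Set.Finite.mem_toFinset] at hp
    exact hp.1.ne_top
  all_goals
    intro p hp hp0 hpS
    rw [Set.Finite.mem_toFinset] at hpS
    have hpS : n * (3 * β) ∉ p := fun hc => hpS ⟨hp, hp0, hc⟩
    obtain ⟨r, hr⟩ := h p hp hp0 (fun hc => hpS (p.mul_mem_right _ hc))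
    have := (hP p hp).1
    have := (hP p hp).2
    obtain ⟨k1, k2, k3⟩ := split_prime hf ω hω β b hb σ hσ p hp0 (fun hc => hpS (p.mul_mem_left _ hc)) r hr (P p)
  · refine ⟨inferInstance, Ideal.ne_bot_of_liesOver_of_ne_bot hp0 _, k2, (Ideal.over_def (P p) p).symm⟩
  · have : (σ • P p).LiesOver p := inferInstance
    refine ⟨inferInstance, Ideal.ne_bot_of_liesOver_of_ne_bot hp0 _, k3, (Ideal.over_def (σ • P p) p).symm⟩
  · exact k1.symm

end
end Sch
end

section
namespace Sch
open NumberField Ideal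

lemma ff_pow_cube {k : Type*} [Field k] [Finite k] {x : k} (hx : x ≠ 0) {m : ℕ}
    (hm : 3 * m = Nat.card k - 1) (h : x ^ m = 1) : ∃ r : k, r ^ 3 = x := by
  have := Fintype.ofFinite k
  obtain ⟨g, hg⟩ := IsCyclic.exists_generator (α := kˣ)
  have ho : orderOf g = 3 * m := by
    rw [orderOf_eq_card_of_forall_mem_zpowers hg, Nat.card_units, hm]
  obtain ⟨j, hj⟩ := Subgroup.mem_zpowers_iff.1 (hg (Units.mk0 x hx))
  have hxm : (Units.mk0 x hx) ^ m = 1 := by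
    ext; simpa using h
  rw [← hj, ← zpow_natCast, ← zpow_mul, ← orderOf_dvd_iff_zpow_eq_one, ho] at hxm
  have hm0 : (m : ℤ) ≠ 0 := by
    have := Finite.one_lt_card (α := k)
    intro h; have : m = 0 := by exact_mod_cast h
    omega
  have h3 : (3 : ℤ) ∣ j := by
    push_cast at hxm
    exact Int.dvd_of_mul_dvd_mul_right hm0 hxm
  obtain ⟨i, rfl⟩ := h3
  refine ⟨((g ^ i : kˣ) : k), ?_⟩
  have : ((g ^ i) ^ 3 : kˣ) = Units.mk0 x hx := by
    rw [← hj, ← zpow_natCast, ← zpow_mul]; congr 1; push_cast; ring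
  have := congrArg (Units.val) this
  simpa using this

lemma ff_cube {k : Type*} [Field k] [Finite k] (p : ℕ) [hp : Fact p.Prime] [CharP k p] (hp2 : p ≠ 2)
    (hp3 : p ≠ 3) {ω ε : k} (hω : ω ^ 2 + ω + 1 = 0) (a b E : ℤ) (hε : ε ^ 2 = E) (hE : (E : k) ≠ 0)
    (hN : (a : k) ^ 2 + 3 * E * b ^ 2 ≠ 0)
    (h : ∀ t : ℤ, (t : k) ^ 2 = E →
      (((a : k) + b * t * (1 + 2 * ω)) ^ 2 * (a - b * t * (1 + 2 * ω))) ^ ((p ^ 2 - 1) / 3) = 1) :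
    ∃ r : k, r ^ 3 = ((a : k) + b * ε * (1 + 2 * ω)) ^ 2 * (a - b * ε * (1 + 2 * ω)) := by
  have hpp := hp.out
  set s := 1 + 2 * ω with hs
  have hs2 : s ^ 2 = -3 := by rw [hs]; linear_combination 4 * hω
  set B := (a : k) + b * ε * s with hB
  set B' := (a : k) - b * ε * s with hB'
  have hBB : B * B' = (a : k) ^ 2 + 3 * E * b ^ 2 := by
    rw [hB, hB']; linear_combination (-(b : k) ^ 2 * s ^ 2) * hε - b ^ 2 * E * hs2
  have hB0 : B ≠ 0 := fun h0 => hN (by rw [← hBB, h0, zero_mul])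
  have hB0' : B' ≠ 0 := fun h0 => hN (by rw [← hBB, h0, mul_zero])
  have hβ0 : B ^ 2 * B' ≠ 0 := mul_ne_zero (pow_ne_zero _ hB0) hB0'
  have hintegral : ∀ n : ℤ, (n : k) ^ p = n := by
    intro n
    have : ((n : ZMod p)) ^ p = n := ZMod.pow_card _
    have := congrArg (ZMod.castHom (dvd_refl p) k) this
    rw [map_pow, map_intCast] at this
    exact this
  have hneg : ∀ x : k, (-x) ^ p = -x ^ p := fun x => by
    rw [(hpp.odd_of_ne_two hp2).neg_pow]
  have hfB : ∀ x : k, ((a : k) + b * x) ^ p = a + b * x ^ p := by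
    intro x; rw [add_pow_char, mul_pow, hintegral, hintegral]
  have hω3 : ω ^ 3 = 1 := by linear_combination (ω - 1) * hω
  have hω1 : ω ≠ 1 := by
    rintro rfl
    have h3 : ((3 : ℕ) : k) = 0 := by push_cast; linear_combination hω
    rw [CharP.cast_eq_zero_iff k p] at h3
    exact hp3 ((Nat.prime_dvd_prime_iff_eq hpp Nat.prime_three).1 h3)
  have hord : orderOf ω = 3 := orderOf_eq_prime hω3 hω1
  have hω0 : ω ≠ 0 := by rintro rfl; simp at hω3
  have hq3 : 3 ∣ Nat.card k - 1 := by
    rw [← hord]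
    apply orderOf_dvd_of_pow_eq_one
    have := Fintype.ofFinite k
    rw [Nat.card_eq_fintype_card]
    exact FiniteField.pow_card_sub_one_eq_one ω hω0
  have hs_p : s ^ p = 1 + 2 * ω ^ p := by
    have := hintegral 2
    push_cast at this
    rw [hs, add_pow_char, one_pow, mul_pow, this]
  have hp12 : p % 3 = 1 ∨ p % 3 = 2 := by
    have : ¬ 3 ∣ p := fun h => hp3 ((Nat.prime_dvd_prime_iff_eq Nat.prime_three hpp).1 h).symm
    omega
  have hsp1 : p % 3 = 1 → s ^ p = s := by
    intro h1
    rw [hs_p, ← Nat.div_add_mod p 3, h1, pow_add, pow_mul, hω3]; simp [hs]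
  have hsp2 : p % 3 = 2 → s ^ p = -s := by
    intro h1
    rw [hs_p, ← Nat.div_add_mod p 3, h1, pow_add, pow_mul, hω3]; rw [hs]
    linear_combination 2 * hω
  obtain ⟨n, hn⟩ : ∃ n : ℕ, Nat.card k = p ^ n := by
    have := Fintype.ofFinite k
    obtain ⟨n, _, hn⟩ := FiniteField.card k p
    exact ⟨n, by rw [Nat.card_eq_fintype_card, hn]⟩
  have hεp : ε ^ p = ε ∨ ε ^ p = -ε := by
    apply sq_eq_sq_iff_eq_or_eq_neg.1
    rw [← pow_mul, mul_comm, pow_mul, hε, hintegral]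
  have hmod1 : ∀ m : ℕ, 1 ≤ p ^ m := fun m => Nat.one_le_pow _ _ hpp.pos
  have hε0 : ε ≠ 0 := by rintro rfl; apply hE; rw [← hε]; simp
  rcases hεp with hεp | hεp
  · -- ε is in the prime field
    obtain ⟨t, ht⟩ : ∃ t : ℤ, (t : k) = ε := by
      have hE0 : (E : ZMod p) ≠ 0 := by
        intro h0; apply hE
        have := congrArg (ZMod.castHom (dvd_refl p) k) h0
        simpa using this
      have hsq : IsSquare (E : ZMod p) := by
        rw [ZMod.euler_criterion p hE0]
        apply (ZMod.castHom (dvd_refl p) k).injective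
        simp only [map_pow, map_intCast, map_one]
        rw [← hε, ← pow_mul]
        have h2 : 2 * (p / 2) = p - 1 := by
          have := hpp.odd_of_ne_two hp2
          obtain ⟨c, hc⟩ := this
          omega
        rw [h2]
        apply mul_right_cancel₀ hε0
        rw [← pow_succ, Nat.sub_add_cancel hpp.one_le, hεp, one_mul]
      obtain ⟨r, hr⟩ := hsq
      obtain ⟨t, rfl⟩ := ZMod.intCast_surjective r
      have h1 : (t : k) ^ 2 = ε ^ 2 := by
        have := congrArg (ZMod.castHom (dvd_refl p) k) hr
        simp at this
        rw [hε, this]; ring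
      rcases sq_eq_sq_iff_eq_or_eq_neg.1 h1 with h1 | h1
      · exact ⟨t, h1⟩
      · exact ⟨-t, by push_cast; rw [h1]; ring⟩
    have h1 := h t (by rw [ht, hε])
    rw [ht] at h1
    have hdiv := three_mul_div hpp hp3
    have hp21 : p ^ 2 - 1 = (p - 1) * (p + 1) := by
      rw [mul_comm, ← Nat.sq_sub_sq]
    rcases hp12 with h12 | h12
    · obtain ⟨c, hc⟩ : 3 ∣ p - 1 := by omega
      have hβp : (B ^ 2 * B') ^ (p - 1) = 1 := by
        apply mul_right_cancel₀ hβ0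
        rw [← pow_succ, Nat.sub_add_cancel hpp.one_le, one_mul, mul_pow, ← pow_mul, mul_comm 2 p, pow_mul]
        have e1 : B ^ p = B := by
          rw [hB, mul_assoc, hfB, mul_pow, hεp, hsp1 h12]
        have e2 : B' ^ p = B' := by
          rw [hB', show (a : k) - b * ε * s = a + b * (-(ε * s)) by ring, hfB, hneg, mul_pow, hεp, hsp1 h12]
        rw [e1, e2]
      have h1' : ((B ^ 2 * B') ^ c) ^ (p + 1) = 1 := by
        rw [← pow_mul]
        convert h1 using 2
        rw [hp21, hc, mul_assoc]; omega
      have h3' : ((B ^ 2 * B') ^ c) ^ 3 = 1 := by rw [← pow_mul, mul_comm c 3, ← hc, hβp]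
      have h4' : (B ^ 2 * B') ^ c = 1 := by
        have : p + 1 = 3 * (p / 3) + 2 := by omega
        rw [this, pow_add, pow_mul, h3', one_pow, one_mul] at h1'
        rw [pow_succ, h1', one_mul] at h3'
        exact h3'
      obtain ⟨d, hd⟩ : p - 1 ∣ Nat.card k - 1 := by
        rw [hn]; simpa using Nat.sub_dvd_pow_sub_pow p 1 n
      apply ff_pow_cube hβ0 (m := c * d) (by rw [hd, hc]; ring)
      rw [pow_mul, h4', one_pow]
    · have hev : 2 ∣ n := by
        by_contra hodd
        rw [hn] at hq3
        have h2 : p ^ n % 3 = 2 := by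
          obtain ⟨j, rfl⟩ : ∃ j, n = 2 * j + 1 := ⟨n / 2, by omega⟩
          rw [pow_succ, pow_mul, Nat.mul_mod, Nat.pow_mod, Nat.pow_mod p, h12]
          norm_num
        have := hmod1 n
        omega
      obtain ⟨j, hj⟩ := hev
      obtain ⟨d, hd⟩ : p ^ 2 - 1 ∣ Nat.card k - 1 := by
        rw [hn, hj, pow_mul]; simpa using Nat.sub_dvd_pow_sub_pow (p ^ 2) 1 j
      apply ff_pow_cube hβ0 (m := (p ^ 2 - 1) / 3 * d) (by rw [hd, ← mul_assoc, hdiv])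
      rw [pow_mul, h1, one_pow]
  · rcases hp12 with h12 | h12
    · have e1 : B ^ p = B' := by
        rw [hB, mul_assoc, hfB, mul_pow, hεp, hsp1 h12, hB']; ring
      refine ⟨B ^ ((p + 2) / 3), ?_⟩
      rw [← pow_mul, show (p + 2) / 3 * 3 = 2 + p by omega, pow_add, e1]
    · have e1 : B ^ p = B := by
        rw [hB, mul_assoc, hfB, mul_pow, hεp, hsp2 h12]; ring
      have e2 : B' ^ p = B' := by
        rw [hB', show (a : k) - b * ε * s = a + b * (-(ε * s)) by ring, hfB, hneg, mul_pow, hεp, hsp2 h12]; ring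
      refine ⟨(B ^ 2 * B') ^ ((2 * p - 1) / 3), ?_⟩
      have e3 : (B ^ 2 * B') ^ p = B ^ 2 * B' := by
        rw [mul_pow, ← pow_mul, mul_comm 2 p, pow_mul, e1, e2]
      have hp1 := hpp.one_le
      rw [← pow_mul, show (2 * p - 1) / 3 * 3 = 2 * p - 1 by omega]
      apply mul_right_cancel₀ hβ0
      rw [← pow_succ, show 2 * p - 1 + 1 = p + p by omega, pow_add, e3]

end Sch
end

section
namespace Sch
open NumberField Ideal

section
variable {K : Type*} [Field K] [NumberField K]

lemma finrank_cyc : Module.finrank K (CyclotomicField 3 K) = 1 ∨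
    Module.finrank K (CyclotomicField 3 K) = 2 := by
  have hζ := IsCyclotomicExtension.zeta_spec 3 K (CyclotomicField 3 K)
  have h1 := (hζ.powerBasis K).finrank
  have h2 : Module.finrank K (CyclotomicField 3 K) ≤ 2 := by
    rw [h1, ← PowerBasis.natDegree_minpoly]
    have h3 : minpoly K (hζ.powerBasis K).gen ∣ Polynomial.cyclotomic 3 K := by
      apply minpoly.dvd
      rw [IsPrimitiveRoot.powerBasis_gen, Polynomial.aeval_def, Polynomial.eval₂_eq_eval_map,
        Polynomial.map_cyclotomic]
      exact Polynomial.isRoot_cyclotomic_iff.2 hζ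
    have := Polynomial.natDegree_le_of_dvd h3 (Polynomial.cyclotomic_ne_zero 3 K)
    rw [Polynomial.natDegree_cyclotomic] at this
    have h4 : Nat.totient 3 = 2 := by decide
    rwa [h4] at this
  have h0 : 0 < Module.finrank K (CyclotomicField 3 K) := Module.finrank_pos
  omega

lemma cube_descent {β : K} (hβ : β ≠ 0) (x : CyclotomicField 3 K)
    (hx : x ^ 3 = algebraMap K (CyclotomicField 3 K) β) : ∃ y : K, y ^ 3 = β := by
  have h := congrArg (Algebra.norm K) hx
  rw [map_pow, Algebra.norm_algebraMap] at h
  rcases finrank_cyc (K := K) with h1 | h1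
  · rw [h1, pow_one] at h; exact ⟨_, h⟩
  · rw [h1] at h
    set y := Algebra.norm K x
    have hy : y ≠ 0 := by
      rintro h0; rw [h0] at h; exact pow_ne_zero 2 hβ (by rw [← h]; simp)
    refine ⟨β / y, ?_⟩
    rw [div_pow, h]; field_simp

theorem lemC (θ : K) (E : ℤ) (hE : E ≠ 0) (hθ : θ ^ 2 = -3 * E) (a b n : ℤ) (hn : n ≠ 0)
    (hne : a ^ 2 + 3 * E * b ^ 2 ≠ 0)
    (h : ∀ p : ℕ, p.Prime → ¬ (p : ℤ) ∣ n → ∀ t : ℤ, (p : ℤ) ∣ t ^ 2 - E →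
      (p : Zw) ∣ (((a : Zw) + (b * t : ℤ) * s3) ^ 2 * ((a : Zw) - (b * t : ℤ) * s3)) ^ ((p ^ 2 - 1) / 3) - 1) :
    ∃ x : K, x ^ 3 = ((a : K) + b * θ) ^ 2 * (a - b * θ) := by
  set L := CyclotomicField 3 K
  have hζ := IsCyclotomicExtension.zeta_spec 3 K L
  set ω0 : L := IsCyclotomicExtension.zeta 3 K L with hω0
  have hω0' : ω0 ^ 2 + ω0 + 1 = 0 := by
    have := Polynomial.isRoot_cyclotomic_iff.2 hζ
    rw [Polynomial.cyclotomic_three] at this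
    simpa using this
  have hω3 : ω0 ^ 3 = 1 := by linear_combination (ω0 - 1) * hω0'
  have hωint : IsIntegral ℤ ω0 := IsIntegral.of_pow (n := 3) (by norm_num) (by rw [hω3]; exact isIntegral_one)
  have hs0 : (1 + 2 * ω0) ^ 2 = -3 := by linear_combination 4 * hω0'
  have hs00 : (1 + 2 * ω0) ≠ 0 := by
    intro h0; rw [h0] at hs0; norm_num at hs0
  set ε0 : L := algebraMap K L θ / (1 + 2 * ω0) with hε0
  have hθL : (algebraMap K L θ) ^ 2 = -3 * E := by
    rw [← map_pow, hθ, map_mul, map_neg, map_ofNat, map_intCast]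
  have hε2 : ε0 ^ 2 = E := by
    rw [hε0, div_pow, hs0, hθL, mul_div_cancel_left₀ _ (by norm_num)]
  have hεint : IsIntegral ℤ ε0 := IsIntegral.of_pow (n := 2) (by norm_num) (by
    rw [hε2]; exact isIntegral_algebraMap (R := ℤ) (x := E))
  have hεs : ε0 * (1 + 2 * ω0) = algebraMap K L θ := by
    rw [hε0]; exact div_mul_cancel₀ _ hs00
  let ω : 𝓞 L := ⟨ω0, hωint⟩
  let ε : 𝓞 L := ⟨ε0, hεint⟩
  have hω : ω ^ 2 + ω + 1 = 0 := by
    apply RingOfIntegers.ext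
    change ω0 ^ 2 + ω0 + 1 = 0
    exact hω0'
  have hε : ε ^ 2 = E := by
    apply RingOfIntegers.ext
    change ε0 ^ 2 = ((E : 𝓞 L) : L)
    rw [hε2]
    exact (map_intCast (algebraMap (𝓞 L) L) E).symm
  have hωc : (ω : L) = ω0 := rfl
  have hεc : (ε : L) = ε0 := rfl
  let β : 𝓞 L := ((a : 𝓞 L) + b * ε * (1 + 2 * ω)) ^ 2 * (a - b * ε * (1 + 2 * ω))
  have hβc : (β : L) = algebraMap K L (((a : K) + b * θ) ^ 2 * (a - b * θ)) := by
    simp only [β, map_mul, map_pow, map_add, map_sub, map_intCast, map_one, map_ofNat]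
    rw [← hεs]
    change ((a : L) + b * ε0 * (1 + 2 * ω0)) ^ 2 * (a - b * ε0 * (1 + 2 * ω0)) = _
    ring
  have hNK : ((a : K) + b * θ) * (a - b * θ) ≠ 0 := by
    have : ((a : K) + b * θ) * (a - b * θ) = ((a ^ 2 + 3 * E * b ^ 2 : ℤ) : K) := by
      push_cast; linear_combination (-(b : K) ^ 2) * hθ
    rw [this]; exact_mod_cast hne
  have hβK : ((a : K) + b * θ) ^ 2 * (a - b * θ) ≠ 0 :=
    mul_ne_zero (pow_ne_zero _ (left_ne_zero_of_mul hNK)) (right_ne_zero_of_mul hNK)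
  have hβ0 : β ≠ 0 := by
    intro h0
    apply hβK
    apply (algebraMap K L).injective
    rw [← hβc, h0]; simp
  obtain ⟨x, hx⟩ : ∃ x : L, x ^ 3 = (β : L) := by
    apply cube_of_local ω hω β hβ0 ((n * 6 * E * (a ^ 2 + 3 * E * b ^ 2) : ℤ) : 𝓞 L)
    · exact_mod_cast mul_ne_zero (mul_ne_zero (mul_ne_zero hn (by norm_num)) hE) hne
    intro P hP hP0 hnP
    have hPm : P.IsMaximal := Ring.DimensionLEOne.maximalOfPrime hP0 hP
    letI : Field (𝓞 L ⧸ P) := Ideal.Quotient.field P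
    have hfin : Finite (𝓞 L ⧸ P) := P.finiteQuotientOfFreeOfNeBot hP0
    obtain ⟨p, hpc⟩ := CharP.exists (𝓞 L ⧸ P)
    have hpp : p.Prime := (CharP.char_is_prime_or_zero (𝓞 L ⧸ P) p).resolve_right
      (CharP.char_ne_zero_of_finite (𝓞 L ⧸ P) p)
    have : Fact p.Prime := ⟨hpp⟩
    have hnp : ∀ m : ℤ, m ∣ n * 6 * E * (a ^ 2 + 3 * E * b ^ 2) → (m : 𝓞 L ⧸ P) ≠ 0 := by
      rintro m ⟨c, hc⟩ h0
      apply hnP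
      rw [hc, ← Ideal.Quotient.eq_zero_iff_mem]
      push_cast
      rw [map_mul, map_intCast, h0, zero_mul]
    have hnd : ∀ m : ℤ, m ∣ n * 6 * E * (a ^ 2 + 3 * E * b ^ 2) → ¬ (p : ℤ) ∣ m := by
      intro m hm hd
      exact hnp m hm ((CharP.intCast_eq_zero_iff _ p m).2 hd)
    set π := Ideal.Quotient.mk P
    have hωk : (π ω) ^ 2 + π ω + 1 = 0 := by
      have := congrArg π hω
      simpa using this
    obtain ⟨r, hr⟩ := ff_cube (k := 𝓞 L ⧸ P) p
      (by rintro rfl; exact hnd 2 ⟨n * 3 * E * (a ^ 2 + 3 * E * b ^ 2), by ring⟩ (by norm_num))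
      (by rintro rfl; exact hnd 3 ⟨n * 2 * E * (a ^ 2 + 3 * E * b ^ 2), by ring⟩ (by norm_num))
      (ω := π ω) (ε := π ε) hωk a b E (by rw [← map_pow, hε, map_intCast])
      (hnp E ⟨n * 6 * (a ^ 2 + 3 * E * b ^ 2), by ring⟩)
      (by
        have := hnp (a ^ 2 + 3 * E * b ^ 2) ⟨n * 6 * E, by ring⟩
        push_cast at this
        exact this)
      (by
        intro t ht
        have htE : (p : ℤ) ∣ t ^ 2 - E := by
          rw [← CharP.intCast_eq_zero_iff (𝓞 L ⧸ P) p]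
          push_cast
          rw [ht, sub_self]
        have h1 := h p hpp (hnd n ⟨6 * E * (a ^ 2 + 3 * E * b ^ 2), by ring⟩) t htE
        have h2 := map_dvd (homOf (π ω) (by linear_combination hωk)) h1
        rw [map_natCast, CharP.cast_eq_zero, zero_dvd_iff] at h2
        have hs : homOf (π ω) (by linear_combination hωk) s3 = 1 + 2 * π ω := by
          rw [hom_apply, homOf_w]; simp [s3]
        simp only [map_sub, map_pow, map_mul, map_add, map_one, hs, map_intCast] at h2
        push_cast at h2
        exact sub_eq_zero.1 h2)
    obtain ⟨r', rfl⟩ := Ideal.Quotient.mk_surjective r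
    refine ⟨r', ?_⟩
    rw [← Ideal.Quotient.eq_zero_iff_mem, map_sub, map_pow, sub_eq_zero, hr]
    simp only [β, map_mul, map_pow, map_add, map_sub, map_intCast, map_one, map_ofNat]
    rfl
  rw [hβc] at hx
  exact cube_descent hβK x hx

end
end Sch
end

section
namespace Sch
open NumberField Ideal UniqueFactorizationMonoid

section
variable {K : Type*} [Field K] [NumberField K]

structure QF (E : ℤ) (ε : 𝓞 K) : Prop where
  sq : ε ^ 2 = E
  four : ¬ (4 : ℤ) ∣ E
  co : ∀ a : 𝓞 K, ∃ x y : ℤ, 2 * a = x + y * ε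
  uniq : ∀ x y : ℤ, (x : 𝓞 K) + y * ε = 0 → x = 0 ∧ y = 0
  nm : ∀ (a : 𝓞 K) (x y : ℤ), 2 * a = x + y * ε → 4 * (absNorm (span {a}) : ℤ) = |x ^ 2 - E * y ^ 2|

variable {E : ℤ} {ε : 𝓞 K}

lemma QF.ext (q : QF E ε) {x y x' y' : ℤ} (h : (x : 𝓞 K) + y * ε = x' + y' * ε) :
    x = x' ∧ y = y' := by
  have := q.uniq (x - x') (y - y') (by push_cast; linear_combination h)
  omega

lemma QF.dvd (q : QF E ε) {n x y : ℤ} (h : (n : 𝓞 K) ∣ x + y * ε) : n ∣ 2 * x ∧ n ∣ 2 * y := by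
  obtain ⟨c, hc⟩ := h
  obtain ⟨s, t, hst⟩ := q.co c
  have := q.ext (x := 2 * x) (y := 2 * y) (x' := n * s) (y' := n * t)
    (by push_cast; linear_combination 2 * hc + n * hst)
  exact ⟨⟨s, this.1⟩, ⟨t, this.2⟩⟩

lemma mem_int {P : Ideal (𝓞 K)} (hP : P.IsPrime) {p : ℕ} (hp : p.Prime) (hpP : (p : 𝓞 K) ∈ P)
    {m : ℤ} : (m : 𝓞 K) ∈ P ↔ (p : ℤ) ∣ m := by
  constructor
  · intro h
    by_contra hd
    have h1 : IsCoprime (p : ℤ) m := (Nat.prime_iff_prime_int.1 hp).coprime_iff_not_dvd.2 hd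
    obtain ⟨a, b, hab⟩ := h1
    apply hP.ne_top
    rw [Ideal.eq_top_iff_one]
    have : (1 : 𝓞 K) = a * p + b * m := by exact_mod_cast hab.symm
    rw [this]
    exact P.add_mem (P.mul_mem_left _ hpP) (P.mul_mem_left _ h)
  · rintro ⟨c, rfl⟩
    push_cast
    exact P.mul_mem_right _ hpP

lemma prime_char {P : Ideal (𝓞 K)} (hP : P.IsPrime) (hP0 : P ≠ ⊥) :
    ∃ p : ℕ, p.Prime ∧ (p : 𝓞 K) ∈ P := by
  have hPm : P.IsMaximal := Ring.DimensionLEOne.maximalOfPrime hP0 hP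
  letI : Field (𝓞 K ⧸ P) := Ideal.Quotient.field P
  have hfin : Finite (𝓞 K ⧸ P) := P.finiteQuotientOfFreeOfNeBot hP0
  obtain ⟨p, hpc⟩ := CharP.exists (𝓞 K ⧸ P)
  have hpp : p.Prime := (CharP.char_is_prime_or_zero (𝓞 K ⧸ P) p).resolve_right
    (CharP.char_ne_zero_of_finite (𝓞 K ⧸ P) p)
  refine ⟨p, hpp, ?_⟩
  rw [← Ideal.Quotient.eq_zero_iff_mem, map_natCast, CharP.cast_eq_zero]

lemma prime_char_unique {P : Ideal (𝓞 K)} (hP : P.IsPrime) {p q : ℕ} (hp : p.Prime) (hq : q.Prime)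
    (hpP : (p : 𝓞 K) ∈ P) (hqP : (q : 𝓞 K) ∈ P) : p = q := by
  have := (mem_int hP hp hpP (m := q)).1 (by simpa using hqP)
  exact (Nat.prime_dvd_prime_iff_eq hp hq).1 (by exact_mod_cast this)

lemma QF.deg1 (q : QF E ε) {P : Ideal (𝓞 K)} (hP : P.IsPrime) {p : ℕ} (hp : p.Prime) (h2 : p ≠ 2)
    {t : ℤ} (hpP : (p : 𝓞 K) ∈ P) (ht : ε - t ∈ P) : P = span {(p : 𝓞 K), ε - t} := by
  apply le_antisymm
  · intro x hx
    obtain ⟨s, y, hs⟩ := q.co x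
    have hI1 : (p : 𝓞 K) ∈ span {(p : 𝓞 K), ε - t} := Ideal.subset_span (by simp)
    have hI2 : ε - t ∈ span {(p : 𝓞 K), ε - t} := Ideal.subset_span (by simp)
    have h1 : ((s + y * t : ℤ) : 𝓞 K) ∈ P := by
      have : ((s + y * t : ℤ) : 𝓞 K) = 2 * x - y * (ε - t) := by rw [hs]; push_cast; ring
      rw [this]
      exact P.sub_mem (P.mul_mem_left _ hx) (P.mul_mem_left _ ht)
    rw [mem_int hP hp hpP] at h1
    obtain ⟨c, hc⟩ := h1
    obtain ⟨k, hk⟩ := hp.odd_of_ne_two h2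
    have hk' : (p : 𝓞 K) = 2 * k + 1 := by rw [hk]; push_cast; ring
    have hc' : (s : 𝓞 K) + y * t = p * c := by exact_mod_cast hc
    have : x = p * (x - k * c) - k * y * (ε - t) := by
      linear_combination (-x) * hk' - (k : 𝓞 K) * hs - (k : 𝓞 K) * hc'
    rw [this]
    exact Ideal.sub_mem _ (Ideal.mul_mem_right _ _ hI1) (Ideal.mul_mem_left _ _ hI2)
  · rw [Ideal.span_le]
    rintro x hx
    rcases hx with rfl | hx
    · exact hpP
    · rw [Set.mem_singleton_iff.1 hx]; exact ht

lemma QF.exists_prime (q : QF E ε) {p : ℕ} (hp : p.Prime) (h2 : p ≠ 2) {t : ℤ}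
    (ht : (p : ℤ) ∣ t ^ 2 - E) :
    ∃ P : Ideal (𝓞 K), P.IsPrime ∧ P ≠ ⊥ ∧ (p : 𝓞 K) ∈ P ∧ ε - t ∈ P := by
  have hne : span {(p : 𝓞 K), ε - t} ≠ ⊤ := by
    intro h
    rw [Ideal.eq_top_iff_one, Ideal.mem_span_pair] at h
    obtain ⟨a, b, hab⟩ := h
    obtain ⟨c, hc⟩ := ht
    have hc' : (t : 𝓞 K) ^ 2 - E = p * c := by exact_mod_cast hc
    have h1 : ((p : ℤ) : 𝓞 K) ∣ (t : ℤ) + (1 : ℤ) * ε := by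
      refine ⟨a * (ε + t) - b * c, ?_⟩
      push_cast
      linear_combination (-(ε + t)) * hab + b * q.sq - b * hc'
    have h3 := (q.dvd h1).2
    have : p ∣ 2 := by exact_mod_cast h3
    exact h2 ((Nat.prime_dvd_prime_iff_eq hp Nat.prime_two).1 this)
  obtain ⟨P, hP, hle⟩ := Ideal.exists_le_maximal _ hne
  have hpP : (p : 𝓞 K) ∈ P := hle (Ideal.subset_span (by simp))
  refine ⟨P, hP.isPrime, ?_, hpP, hle (Ideal.subset_span (by simp))⟩
  rintro rfl
  rw [Ideal.mem_bot] at hpP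
  exact hp.ne_zero (by exact_mod_cast hpP)

lemma QF.absNorm_deg1 (q : QF E ε) {P : Ideal (𝓞 K)} (hP : P.IsPrime) {p : ℕ} (hp : p.Prime)
    (h2 : p ≠ 2) {t : ℤ} (hpP : (p : 𝓞 K) ∈ P) (ht : ε - t ∈ P) : absNorm P = p := by
  have : Fact p.Prime := ⟨hp⟩
  have hc : CharP (𝓞 K ⧸ P) p := by
    refine ⟨fun n => ?_⟩
    have := mem_int hP hp hpP (m := n)
    rw [← Ideal.Quotient.eq_zero_iff_mem] at this
    simp only [map_intCast, Int.cast_natCast, Int.natCast_dvd_natCast] at this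
    exact this
  let f : ZMod p →+* 𝓞 K ⧸ P := ZMod.castHom dvd_rfl _
  have : Nontrivial (𝓞 K ⧸ P) := Ideal.Quotient.nontrivial_iff.2 hP.ne_top
  have hf : Function.Bijective f := by
    refine ⟨f.injective, ?_⟩
    intro z
    obtain ⟨x, rfl⟩ := Ideal.Quotient.mk_surjective z
    obtain ⟨s, y, hs⟩ := q.co x
    obtain ⟨k, hk⟩ := hp.odd_of_ne_two h2
    have hk' : (p : 𝓞 K) = 2 * k + 1 := by rw [hk]; push_cast; ring
    refine ⟨((-k * (s + y * t) : ℤ) : ZMod p), ?_⟩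
    rw [map_intCast, ← map_intCast (Ideal.Quotient.mk P), Ideal.Quotient.eq]
    have : ((-k * (s + y * t) : ℤ) : 𝓞 K) - x = k * y * (ε - t) - p * x := by
      push_cast
      linear_combination (k : 𝓞 K) * hs + x * hk'
    rw [this]
    exact P.sub_mem (P.mul_mem_left _ ht) (P.mul_mem_right _ hpP)
  rw [Ideal.absNorm_apply, Submodule.cardQuot_apply]
  rw [← Nat.card_congr (Equiv.ofBijective f hf), Nat.card_zmod]

open scoped Classical in
noncomputable def phi (ε : 𝓞 K) (u v m : ℤ) (P : Ideal (𝓞 K)) : Zw :=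
  if h : ∃ s : Zw, ∃ (p : ℕ) (t : ℤ), p.Prime ∧ ¬ (p : ℤ) ∣ m ∧ (p : 𝓞 K) ∈ P ∧ ε - t ∈ P ∧
    IsVal u v p t s then h.choose else 1

variable {u v m : ℤ}

lemma phi_cube (P : Ideal (𝓞 K)) : phi ε u v m P ^ 3 = 1 := by
  unfold phi
  split_ifs with h
  · obtain ⟨p, t, -, -, -, -, h⟩ := h.choose_spec
    exact h.1
  · simp

lemma phi_eq {P : Ideal (𝓞 K)} (hP : P.IsPrime) {p : ℕ} {t : ℤ} {s : Zw} (hp : p.Prime)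
    (hpm : ¬ (p : ℤ) ∣ m) (hpP : (p : 𝓞 K) ∈ P) (ht : ε - t ∈ P) (hs : IsVal u v p t s) :
    phi ε u v m P = s := by
  have h : ∃ s : Zw, ∃ (p : ℕ) (t : ℤ), p.Prime ∧ ¬ (p : ℤ) ∣ m ∧ (p : 𝓞 K) ∈ P ∧ ε - t ∈ P ∧
    IsVal u v p t s := ⟨s, p, t, hp, hpm, hpP, ht, hs⟩
  unfold phi
  rw [dif_pos h]
  obtain ⟨p', t', hp', -, hpP', ht', hs'⟩ := h.choose_spec
  obtain rfl := prime_char_unique hP hp hp' hpP hpP'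
  have h1 : ((t' - t : ℤ) : 𝓞 K) ∈ P := by
    have : ((t' - t : ℤ) : 𝓞 K) = (ε - t) - (ε - t') := by push_cast; ring
    rw [this]; exact P.sub_mem ht ht'
  rw [mem_int hP hp hpP] at h1
  exact IsVal.unique hp (hs'.congr h1) hs

lemma phi_one {P : Ideal (𝓞 K)} (hP : P.IsPrime) {p : ℕ} (hp : p.Prime) (hpP : (p : 𝓞 K) ∈ P)
    (h : ∀ (t : ℤ) s, ¬ (p : ℤ) ∣ m → ε - t ∈ P → IsVal u v p t s → s = 1) : phi ε u v m P = 1 := by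
  unfold phi
  split_ifs with h'
  · obtain ⟨p', t', hp', hpm, hpP', ht', hs'⟩ := h'.choose_spec
    obtain rfl := prime_char_unique hP hp hp' hpP hpP'
    exact h _ _ hpm ht' hs'
  · rfl

noncomputable def FF (ε : 𝓞 K) (u v m : ℤ) (I : Ideal (𝓞 K)) : Zw :=
  ((normalizedFactors I).map (phi ε u v m)).prod

lemma FF_mul {I J : Ideal (𝓞 K)} (hI : I ≠ 0) (hJ : J ≠ 0) :
    FF ε u v m (I * J) = FF ε u v m I * FF ε u v m J := by
  unfold FF
  rw [normalizedFactors_mul hI hJ, Multiset.map_add, Multiset.prod_add]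

lemma FF_prime {P : Ideal (𝓞 K)} (hP : P.IsPrime) (h0 : P ≠ ⊥) :
    FF ε u v m P = phi ε u v m P := by
  unfold FF
  rw [normalizedFactors_irreducible ((Ideal.prime_of_isPrime h0 hP).irreducible), normalize_eq]
  simp

lemma FF_cube (I : Ideal (𝓞 K)) : FF ε u v m I ^ 3 = 1 := by
  unfold FF
  rw [← Multiset.prod_map_pow]
  apply Multiset.prod_eq_one
  intro x hx
  obtain ⟨P, -, rfl⟩ := Multiset.mem_map.1 hx
  exact phi_cube P

lemma FF_one : FF ε u v m (1 : Ideal (𝓞 K)) = 1 := by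
  unfold FF; rw [normalizedFactors_one]; simp

end
end Sch
end

section
namespace Sch
open NumberField Ideal UniqueFactorizationMonoid

section
variable {K : Type*} [Field K] [NumberField K] {E : ℤ} {ε : 𝓞 K} {u v : ℤ}

lemma dvd_norm_al {p : ℕ} {t : ℤ} (ht : (p : ℤ) ∣ t ^ 2 - E)
    (h : (p : ℤ) ∣ QuadraticAlgebra.norm (al u v t)) : (p : ℤ) ∣ u ^ 2 + 27 * E * v ^ 2 := by
  rw [norm_al] at h
  obtain ⟨c, hc⟩ := ht
  obtain ⟨k, hk⟩ := h
  exact ⟨k - 27 * v ^ 2 * c, by linear_combination hk - 27 * v ^ 2 * hc⟩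

lemma mu_sq {s : Zw} (h3 : s ^ 3 = 1) (h : s = s ^ 2) : s = 1 := by
  calc s = s ^ 3 * s := by rw [h3, one_mul]
    _ = s ^ 2 * s ^ 2 := by ring
    _ = s * s ^ 2 := by rw [← h]
    _ = s ^ 3 := by ring
    _ = 1 := h3

lemma QF.sq_mem (q : QF E ε) {P : Ideal (𝓞 K)} (hP : P.IsPrime) {p : ℕ} (hp : p.Prime)
    {t : ℤ} (hpP : (p : 𝓞 K) ∈ P) (ht : ε - t ∈ P) : (p : ℤ) ∣ t ^ 2 - E := by
  rw [← mem_int hP hp hpP]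
  have : ((t ^ 2 - E : ℤ) : 𝓞 K) = -(ε + t) * (ε - t) := by
    push_cast; rw [← q.sq]; ring
  rw [this]
  exact P.mul_mem_left _ ht

lemma val_one_of_dvd {p : ℕ} (hp : p.Prime) (hpm : ¬ (p : ℤ) ∣ 6 * (u ^ 2 + 27 * E * v ^ 2)) {t : ℤ}
    (ht : (p : ℤ) ∣ t ^ 2 - E) (hE : (p : ℤ) ∣ E) {s : Zw} (hs : IsVal u v p t s) : s = 1 := by
  have h3 : p ≠ 3 := by rintro rfl; exact hpm (Dvd.dvd.mul_right (by norm_num) _)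
  have hN : ¬ (p : ℤ) ∣ QuadraticAlgebra.norm (al u v t) := fun h =>
    hpm (Dvd.dvd.mul_left (dvd_norm_al ht h) _)
  have hpt : (p : ℤ) ∣ t := by
    apply (Nat.prime_iff_prime_int.1 hp).dvd_of_dvd_pow (n := 2)
    have := dvd_add ht hE
    simpa using this
  have h1 := hs.neg hp h3 hN
  have h2 : IsVal u v p t (s ^ 2) := h1.congr (by
    obtain ⟨c, hc⟩ := hpt
    exact ⟨-2 * c, by rw [hc]; ring⟩)
  exact mu_sq hs.1 (hs.unique hp h2)

lemma QF.FF_prime_int (q : QF E ε) (hu : ¬ (3 : ℤ) ∣ u) {p : ℕ} (hp : p.Prime)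
    (hpm : ¬ (p : ℤ) ∣ 6 * (u ^ 2 + 27 * E * v ^ 2)) :
    FF ε u v (6 * (u ^ 2 + 27 * E * v ^ 2)) (span {(p : 𝓞 K)}) = 1 := by
  have h3 : p ≠ 3 := by rintro rfl; exact hpm (Dvd.dvd.mul_right (by norm_num) _)
  have h2 : p ≠ 2 := by rintro rfl; exact hpm (Dvd.dvd.mul_right (by norm_num) _)
  by_cases hA : ∃ t : ℤ, (p : ℤ) ∣ t ^ 2 - E ∧ ¬ (p : ℤ) ∣ E
  · obtain ⟨t, ht, hE⟩ := hA
    have hpt : IsCoprime (p : ℤ) (2 * t) := by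
      rw [(Nat.prime_iff_prime_int.1 hp).coprime_iff_not_dvd]
      intro h
      rcases (Nat.prime_iff_prime_int.1 hp).dvd_or_dvd h with h | h
      · exact h2 ((Nat.prime_dvd_prime_iff_eq hp Nat.prime_two).1 (by exact_mod_cast h))
      · apply hE
        have := dvd_sub (Dvd.dvd.mul_right h t) ht
        obtain ⟨k, hk⟩ := this
        exact ⟨k, by linear_combination hk⟩
    obtain ⟨P, hP, hP0, hpP, htP⟩ := q.exists_prime hp h2 ht
    obtain ⟨P', hP', hP0', hpP', htP'⟩ := q.exists_prime (t := -t) hp h2 (by simpa using ht)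
    have hPP : span {(p : 𝓞 K)} = P * P' := by
      have e1 := q.deg1 hP hp h2 hpP htP
      have e2 := q.deg1 hP' hp h2 hpP' htP'
      apply le_antisymm
      · rw [Ideal.span_singleton_le_iff_mem]
        obtain ⟨α, β, hab⟩ := hpt
        have hab' : (α : 𝓞 K) * p + β * (2 * t) = 1 := by exact_mod_cast hab
        have : (p : 𝓞 K) = α * (p * p) + β * (p * (ε - (-t : ℤ)) - (ε - t) * p) := by
          push_cast
          linear_combination (-(p : 𝓞 K)) * hab'
        rw [this]
        exact Ideal.add_mem _ (Ideal.mul_mem_left _ _ (Ideal.mul_mem_mul hpP hpP'))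
          (Ideal.mul_mem_left _ _ (Ideal.sub_mem _ (Ideal.mul_mem_mul hpP htP')
            (Ideal.mul_mem_mul htP hpP')))
      · rw [e1, e2, Ideal.span_pair_mul_span_pair, Ideal.span_le]
        obtain ⟨c, hc⟩ := ht
        have hc' : (t : 𝓞 K) ^ 2 - E = p * c := by exact_mod_cast hc
        intro x hx
        rw [SetLike.mem_coe, Ideal.mem_span_singleton]
        simp only [Set.mem_insert_iff, Set.mem_singleton_iff] at hx
        rcases hx with rfl | rfl | rfl | rfl
        · exact ⟨p, rfl⟩
        · exact Dvd.intro _ rfl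
        · exact Dvd.intro_left _ rfl
        · refine ⟨-c, ?_⟩
          push_cast
          linear_combination q.sq - hc'
    have hN : ¬ (p : ℤ) ∣ QuadraticAlgebra.norm (al u v t) := fun h =>
      hpm (Dvd.dvd.mul_left (dvd_norm_al ht h) _)
    obtain ⟨s, hs⟩ := exists_val hu hp h3 hN
    have hs' := hs.neg hp h3 hN
    rw [hPP, FF_mul hP0 hP0', FF_prime hP hP0, FF_prime hP' hP0', phi_eq hP hp hpm hpP htP hs,
      phi_eq hP' hp hpm hpP' htP' hs', ← pow_succ', hs.1]
  · push Not at hA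
    unfold FF
    apply Multiset.prod_eq_one
    intro x hx
    obtain ⟨P, hPm, rfl⟩ := Multiset.mem_map.1 hx
    have hPp := prime_of_normalized_factor P hPm
    have hP := Ideal.isPrime_of_prime hPp
    have hpP : (p : 𝓞 K) ∈ P := by
      rw [← Ideal.span_singleton_le_iff_mem]
      exact Ideal.le_of_dvd (dvd_of_mem_normalizedFactors hPm)
    apply phi_one hP hp hpP
    intro t s _ ht hs
    have h4 := q.sq_mem hP hp hpP ht
    exact val_one_of_dvd hp hpm h4 (hA t h4) hs

lemma QF.FF_nat (q : QF E ε) (hu : ¬ (3 : ℤ) ∣ u) (n : ℕ) (hn : n ≠ 0)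
    (hpm : IsCoprime (n : ℤ) (6 * (u ^ 2 + 27 * E * v ^ 2))) :
    FF ε u v (6 * (u ^ 2 + 27 * E * v ^ 2)) (span {(n : 𝓞 K)}) = 1 := by
  induction n using induction_on_primes with
  | zero => exact absurd rfl hn
  | one =>
    rw [Nat.cast_one, Ideal.span_singleton_one, ← Ideal.one_eq_top, FF_one]
  | prime_mul p a hp ih =>
    have ha : a ≠ 0 := by rintro rfl; simp at hn
    push_cast at hpm ⊢
    rw [← Ideal.span_singleton_mul_span_singleton, FF_mul, q.FF_prime_int hu hp,
      ih ha hpm.of_mul_left_right, one_mul]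
    · exact (Nat.prime_iff_prime_int.1 hp).coprime_iff_not_dvd.1 hpm.of_mul_left_left
    · simpa using hp.ne_zero
    · simpa using ha

lemma QF.FF_int (q : QF E ε) (hu : ¬ (3 : ℤ) ∣ u) (n : ℤ) (hn : n ≠ 0)
    (hpm : IsCoprime n (6 * (u ^ 2 + 27 * E * v ^ 2))) :
    FF ε u v (6 * (u ^ 2 + 27 * E * v ^ 2)) (span {(n : 𝓞 K)}) = 1 := by
  rcases Int.natAbs_eq n with h | h
  · rw [h, Int.cast_natCast]
    exact q.FF_nat hu _ (by simpa using hn) (h ▸ hpm)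
  · rw [h, Int.cast_neg, Ideal.span_singleton_neg, Int.cast_natCast]
    exact q.FF_nat hu _ (by simpa using hn) (by rw [h] at hpm; exact (IsCoprime.neg_left_iff _ _).1 hpm)

end
end Sch
end

section
namespace Sch
open NumberField Ideal UniqueFactorizationMonoid

structure Adm (E u v : ℤ) : Prop where
  cop : IsCoprime u v
  three : ¬ (3 : ℤ) ∣ u
  ne : u ^ 2 + 27 * E * v ^ 2 ≠ 0
  val : ∀ p : ℕ, p.Prime → ¬ (p : ℤ) ∣ 6 * E → 3 ∣ padicValInt p (u ^ 2 + 27 * E * v ^ 2)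
  odd : E % 8 = 5 → (u ^ 2 + 27 * E * v ^ 2) % 2 = 1

section
variable {K : Type*} [Field K] [NumberField K] {E : ℤ} {ε : 𝓞 K} {u v : ℤ}

lemma QF.not_unit (q : QF E ε) {p : ℕ} (hp : p.Prime) : ¬ IsUnit (p : 𝓞 K) := by
  intro h
  obtain ⟨z, hz⟩ := h.exists_right_inv
  obtain ⟨s, t, hst⟩ := q.co z
  have h1 := q.ext (x := 2) (y := 0) (x' := p * s) (y' := p * t)
    (by push_cast; linear_combination (-2) * hz + p * hst)
  have ht : t = 0 := by
    rcases mul_eq_zero.1 h1.2.symm with h | h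
    · exact absurd (by exact_mod_cast h) hp.ne_zero
    · exact h
  have h2 := q.nm z s t hst
  rw [ht] at h2
  have h3 : 4 * (absNorm (span {z}) : ℤ) = s ^ 2 := by
    rw [h2]; rw [abs_of_nonneg (by nlinarith [sq_nonneg s])]; ring
  have h4 : Even s := by
    have : Even (s ^ 2) := ⟨2 * (absNorm (span {z}) : ℤ), by linear_combination -h3⟩
    exact (Int.even_pow.1 this).1
  obtain ⟨r, hr⟩ := h4
  have h5 : (p : ℤ) * r = 1 := by have := h1.1; rw [hr] at this; linarith
  have h6 : (p : ℤ) ∣ 1 := ⟨r, h5.symm⟩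
  exact hp.one_lt.ne' (by exact_mod_cast Int.eq_one_of_dvd_one (by positivity) h6)

lemma int_cop {a b : ℤ} (h : ∀ p : ℕ, p.Prime → (p : ℤ) ∣ a → (p : ℤ) ∣ b → False) : IsCoprime a b := by
  rw [Int.isCoprime_iff_nat_coprime]
  apply Nat.Coprime.symm
  apply Nat.Coprime.symm
  apply Nat.coprime_of_dvd
  intro p hp h1 h2
  exact h p hp (Int.natCast_dvd.2 h1) (Int.natCast_dvd.2 h2)

lemma QF.cop_norm (q : QF E ε) {a : 𝓞 K} {m x y n : ℤ} (hc : IsCoprime a (m : 𝓞 K))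
    (ha : 2 * a = x + y * ε) (hn : 4 * n = x ^ 2 - E * y ^ 2) : IsCoprime n m := by
  apply int_cop
  intro p hp h1 h2
  have hcp : IsCoprime a (p : 𝓞 K) := by
    obtain ⟨c, rfl⟩ := h2
    push_cast at hc
    exact hc.of_mul_right_left
  have hn' : (4 : 𝓞 K) * n = x ^ 2 - E * y ^ 2 := by exact_mod_cast hn
  have hab : a * (x - a) = n := by
    have : (4 : 𝓞 K) * (a * (x - a)) = 4 * n := by
      rw [hn', ← q.sq]
      linear_combination (x - 2 * a - y * ε) * ha
    exact mul_left_cancel₀ (by norm_num) this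
  have h3 : (p : 𝓞 K) ∣ x - a := by
    apply hcp.symm.dvd_of_dvd_mul_left
    rw [hab]
    obtain ⟨c, rfl⟩ := h1
    push_cast
    exact dvd_mul_right _ _
  obtain ⟨c, hc'⟩ := h3
  obtain ⟨s, t, hst⟩ := q.co c
  have h4 := q.ext (x := x) (y := -y) (x' := p * s) (y' := p * t)
    (by push_cast; linear_combination 2 * hc' + ha + p * hst)
  have h5 : (p : 𝓞 K) ∣ a := by
    refine ⟨s - c, ?_⟩
    have : (x : 𝓞 K) = p * s := by exact_mod_cast h4.1
    linear_combination this - hc'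
  exact q.not_unit hp (hcp.isUnit_of_dvd' h5 dvd_rfl)

lemma sq8 {x : ℤ} (h : x % 2 = 1) : ∃ k, x ^ 2 = 8 * k + 1 := by
  obtain ⟨k, rfl⟩ : ∃ k, x = 2 * k + 1 := ⟨x / 2, by omega⟩
  obtain ⟨r, hr⟩ := Int.even_mul_succ_self k
  exact ⟨r, by linear_combination 4 * hr⟩

lemma QF.FF_a (q : QF E ε) (had : Adm E u v) {a : 𝓞 K} (ha0 : a ≠ 0) {x y k : ℤ} (hk : k = 1 ∨ k = 2)
    (ha : k * a = x + y * ε) (hc : IsCoprime a ((6 * (u ^ 2 + 27 * E * v ^ 2) : ℤ) : 𝓞 K))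
    (hxy : IsCoprime x y) (hy3 : ¬ (3 : ℤ) ∣ y) :
    FF ε u v (6 * (u ^ 2 + 27 * E * v ^ 2)) (span {a}) = 1 := by
  obtain ⟨n, hn, hnN, hnm⟩ : ∃ n : ℤ, x ^ 2 - E * y ^ 2 = k ^ 2 * n ∧
      (absNorm (span {a}) : ℤ) = |n| ∧ IsCoprime n (6 * (u ^ 2 + 27 * E * v ^ 2)) := by
    rcases hk with rfl | rfl
    · have ha' : 2 * a = ((2 * x : ℤ) : 𝓞 K) + (2 * y : ℤ) * ε := by
        push_cast at ha ⊢; linear_combination 2 * ha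
      refine ⟨x ^ 2 - E * y ^ 2, by ring, ?_, ?_⟩
      · have := q.nm _ _ _ ha'
        rw [show (2 * x) ^ 2 - E * (2 * y) ^ 2 = 4 * (x ^ 2 - E * y ^ 2) by ring, abs_mul] at this
        rw [show |(4 : ℤ)| = 4 from rfl] at this
        exact mul_left_cancel₀ (by norm_num) this
      · exact q.cop_norm hc ha' (by ring)
    · push_cast at ha
      have h1 := q.nm _ _ _ ha
      rcases abs_choice (x ^ 2 - E * y ^ 2) with h2 | h2
      · rw [h2] at h1
        exact ⟨_, by linear_combination -h1, (abs_of_nonneg (by positivity)).symm,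
          q.cop_norm hc ha h1⟩
      · rw [h2] at h1
        exact ⟨-(absNorm (span {a}) : ℤ), by linear_combination h1,
          by rw [abs_neg, abs_of_nonneg (by positivity)], q.cop_norm hc ha (by linear_combination -h1)⟩
  have hcN : IsCoprime (x ^ 2 - E * y ^ 2) (u ^ 2 + 27 * E * v ^ 2) := by
    rw [hn]
    apply IsCoprime.mul_left _ hnm.of_mul_right_right
    rcases hk with rfl | rfl
    · rw [one_pow]; exact isCoprime_one_left
    · apply IsCoprime.pow_left
      have hn2 : n % 2 = 1 := by
        have : ¬ (2 : ℤ) ∣ n := by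
          intro h
          have h6 : (2 : ℤ) ∣ 6 * (u ^ 2 + 27 * E * v ^ 2) := Dvd.dvd.mul_right (by norm_num) _
          exact Int.prime_two.not_isUnit (hnm.isUnit_of_dvd' h h6)
        omega
      have hy : y % 2 = 1 := by
        by_contra hy
        have hy' : (2 : ℤ) ∣ y := by omega
        have hx : (2 : ℤ) ∣ x ^ 2 := by
          obtain ⟨y', rfl⟩ := hy'
          exact ⟨2 * n + 2 * E * y' ^ 2, by linear_combination hn⟩
        have hx' := Int.prime_two.dvd_of_dvd_pow hx
        exact Int.prime_two.not_isUnit (hxy.isUnit_of_dvd' hx' hy')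
      obtain ⟨y8, hy8⟩ := sq8 hy
      have hx : x % 2 = 1 := by
        by_contra hx
        have hx' : (2 : ℤ) ∣ x := by omega
        obtain ⟨x', rfl⟩ := hx'
        apply q.four
        exact ⟨x' ^ 2 - E * 2 * y8 - n, by linear_combination (-E) * hy8 - hn⟩
      obtain ⟨x8, hx8⟩ := sq8 hx
      have hE : E % 8 = 5 := by
        have : E = 8 * x8 + 1 - 8 * (E * y8) - 4 * n := by linear_combination hx8 - E * hy8 - hn
        generalize E * y8 = z at this
        omega
      have h5 := had.odd hE
      apply IsCoprime.symm
      exact ⟨1, -((u ^ 2 + 27 * E * v ^ 2) / 2), by omega⟩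
  obtain ⟨X, hX1, hXN, hX2, hX⟩ := main_rec E u v x y had.cop had.three hxy hy3 hcN had.ne had.val
  have hfac : ∀ P ∈ normalizedFactors (span {a}), phi ε u v (6 * (u ^ 2 + 27 * E * v ^ 2)) P =
      X (absNorm P : ℕ) := by
    intro P hPm
    have hP := Ideal.isPrime_of_prime (prime_of_normalized_factor P hPm)
    have hP0 : P ≠ ⊥ := (prime_of_normalized_factor P hPm).ne_zero
    have haP : a ∈ P := by
      rw [← Ideal.span_singleton_le_iff_mem]
      exact Ideal.le_of_dvd (dvd_of_mem_normalizedFactors hPm)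
    obtain ⟨p, hp, hpP⟩ := prime_char hP hP0
    have hpm : ¬ (p : ℤ) ∣ 6 * (u ^ 2 + 27 * E * v ^ 2) := by
      intro h
      rw [← mem_int hP hp hpP] at h
      obtain ⟨α, β, hab⟩ := hc
      apply hP.ne_top
      rw [Ideal.eq_top_iff_one, ← hab]
      exact P.add_mem (P.mul_mem_left _ haP) (P.mul_mem_left _ h)
    have h3 : p ≠ 3 := by rintro rfl; exact hpm (Dvd.dvd.mul_right (by norm_num) _)
    have h2 : p ≠ 2 := by rintro rfl; exact hpm (Dvd.dvd.mul_right (by norm_num) _)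
    have hpi := Nat.prime_iff_prime_int.1 hp
    have hpN : (p : ℤ) ∣ x ^ 2 - E * y ^ 2 := by
      rw [← mem_int hP hp hpP]
      have : ((x ^ 2 - E * y ^ 2 : ℤ) : 𝓞 K) = k * (x - y * ε) * a := by
        push_cast; rw [← q.sq]; linear_combination (-(x - y * ε)) * ha
      rw [this]; exact P.mul_mem_left _ haP
    have hpy : ¬ (p : ℤ) ∣ y := by
      intro h
      have hx2 : (p : ℤ) ∣ x ^ 2 := by
        have := dvd_add hpN (Dvd.dvd.mul_left (dvd_pow h two_ne_zero) E)
        simpa using this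
      exact hpi.not_isUnit (hxy.isUnit_of_dvd' (hpi.dvd_of_dvd_pow hx2) h)
    obtain ⟨α, β, hab⟩ := hpi.coprime_iff_not_dvd.2 hpy
    set t := -x * β with ht
    have hxt : (p : ℤ) ∣ x + y * t := ⟨x * α, by rw [ht]; linear_combination (-x) * hab⟩
    have htP : ε - t ∈ P := by
      have h4 : (y : 𝓞 K) * (ε - t) ∈ P := by
        have : (y : 𝓞 K) * (ε - t) = k * a - ((x + y * t : ℤ) : 𝓞 K) := by
          rw [ha]; push_cast; ring
        rw [this]
        exact P.sub_mem (P.mul_mem_left _ haP) ((mem_int hP hp hpP).2 hxt)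
      exact (hP.mem_or_mem h4).resolve_left (fun h => hpy ((mem_int hP hp hpP).1 h))
    have htE := q.sq_mem hP hp hpP htP
    obtain ⟨s, hs⟩ := exists_val had.three hp h3 (t := t) (fun h =>
      hpm (Dvd.dvd.mul_left (dvd_norm_al htE h) _))
    rw [phi_eq hP hp hpm hpP htP hs, q.absNorm_deg1 hP hp h2 hpP htP]
    exact (hX p hp h3 hpN t hxt s hs).symm
  have hFF : FF ε u v (6 * (u ^ 2 + 27 * E * v ^ 2)) (span {a}) = X (absNorm (span {a}) : ℕ) := by
    have h0 : span {a} ≠ (⊥ : Ideal (𝓞 K)) := by simpa using ha0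
    conv_rhs => rw [← Ideal.prod_normalizedFactors_eq_self h0]
    unfold FF
    rw [Multiset.map_congr rfl hfac, map_multiset_prod, Nat.cast_multiset_prod, map_multiset_prod,
      Multiset.map_map, Multiset.map_map]
    rfl
  have hXk : X k = 1 := by
    rcases hk with rfl | rfl
    · exact map_one X
    · apply hX2; rw [hn]; exact ⟨2 * n, by ring⟩
  have hXn : X n = 1 := by
    rw [hn, map_mul, map_pow, hXk, one_pow, one_mul] at hXN; exact hXN
  rw [hFF, hnN]
  rcases abs_choice n with h | h
  · rw [h, hXn]
  · rw [h, show -n = (-1) * n by ring, map_mul, hX1, hXn, one_mul]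

end
end Sch
end

section
namespace Sch
open NumberField Ideal UniqueFactorizationMonoid

section
variable {K : Type*} [Field K] [NumberField K] {E : ℤ} {ε : 𝓞 K} {u v : ℤ}

lemma QF.FF_mul_int (q : QF E ε) (had : Adm E u v) {a b : 𝓞 K} {h : ℤ} (ha0 : a ≠ 0) (hab : a = h * b)
    (hc : IsCoprime a ((6 * (u ^ 2 + 27 * E * v ^ 2) : ℤ) : 𝓞 K)) :
    FF ε u v (6 * (u ^ 2 + 27 * E * v ^ 2)) (span {a}) =
      FF ε u v (6 * (u ^ 2 + 27 * E * v ^ 2)) (span {b}) := by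
  subst hab
  have hh : h ≠ 0 := by rintro rfl; simp at ha0
  have hb : b ≠ 0 := by rintro rfl; simp at ha0
  have h1 : IsCoprime (h ^ 2) (6 * (u ^ 2 + 27 * E * v ^ 2)) :=
    q.cop_norm (x := 2 * h) (y := 0) hc.of_mul_left_left (by push_cast; ring) (by ring)
  rw [← Ideal.span_singleton_mul_span_singleton, FF_mul, q.FF_int had.three h hh, one_mul]
  · rw [pow_two] at h1; exact h1.of_mul_left_left
  · simpa using hh
  · simpa using hb

lemma QF.FF_principal3 (q : QF E ε) (had : Adm E u v) {a : 𝓞 K} (ha0 : a ≠ 0) {x y : ℤ}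
    (ha : 2 * a = x + y * ε) (hc : IsCoprime a ((6 * (u ^ 2 + 27 * E * v ^ 2) : ℤ) : 𝓞 K))
    (hy3 : ¬ (3 : ℤ) ∣ y) :
    FF ε u v (6 * (u ^ 2 + 27 * E * v ^ 2)) (span {a}) = 1 := by
  have hy0 : y ≠ 0 := by rintro rfl; simp at hy3
  obtain ⟨g, x', y', hg, hxy, rfl, rfl⟩ : ∃ g x' y' : ℤ, g ≠ 0 ∧ IsCoprime x' y' ∧ x = g * x' ∧ y = g * y' := by
    refine ⟨Int.gcd x y, x / Int.gcd x y, y / Int.gcd x y, ?_, ?_, ?_, ?_⟩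
    · have := Int.gcd_ne_zero_right (a := x) hy0
      exact_mod_cast this
    · have := Int.gcd_ne_zero_right (a := x) hy0
      exact isCoprime_div_gcd_div_gcd hy0
    · exact (Int.mul_ediv_cancel' (Int.gcd_dvd_left ..)).symm
    · exact (Int.mul_ediv_cancel' (Int.gcd_dvd_right ..)).symm
  have hy3' : ¬ (3 : ℤ) ∣ y' := fun h => hy3 (Dvd.dvd.mul_left h _)
  push_cast at ha
  rcases Int.even_or_odd' g with ⟨h, rfl | rfl⟩
  · have hab : a = h * (x' + y' * ε) := by
      have : 2 * a = 2 * (h * (x' + y' * ε)) := by push_cast at ha; linear_combination ha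
      exact mul_left_cancel₀ (by norm_num) this
    rw [q.FF_mul_int had ha0 hab hc]
    refine q.FF_a had (k := 1) ?_ (Or.inl rfl) (by push_cast; ring) ?_ hxy hy3'
    · intro h0; rw [hab, h0] at ha0; simp at ha0
    · rw [hab] at hc; exact hc.of_mul_left_right
  · have hb : 2 * (a - h * (x' + y' * ε)) = x' + y' * ε := by push_cast at ha; linear_combination ha
    have hab : a = (2 * h + 1 : ℤ) * (a - h * (x' + y' * ε)) := by
      have : 2 * a = 2 * ((2 * h + 1 : ℤ) * (a - h * (x' + y' * ε))) := by
        push_cast at ha ⊢; linear_combination ha - (2 * h + 1) * hb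
      exact mul_left_cancel₀ (by norm_num) this
    rw [q.FF_mul_int had ha0 hab hc]
    refine q.FF_a had (k := 2) ?_ (Or.inr rfl) (by push_cast; exact hb) ?_ hxy hy3'
    · intro h0; rw [h0, mul_zero] at hab; exact ha0 hab
    · rw [hab] at hc; exact hc.of_mul_left_right

theorem QF.FF_principal (q : QF E ε) (had : Adm E u v) {a : 𝓞 K} (ha0 : a ≠ 0)
    (hc : IsCoprime a ((6 * (u ^ 2 + 27 * E * v ^ 2) : ℤ) : 𝓞 K)) :
    FF ε u v (6 * (u ^ 2 + 27 * E * v ^ 2)) (span {a}) = 1 := by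
  obtain ⟨x, y, ha⟩ := q.co a
  by_cases hy3 : (3 : ℤ) ∣ y
  swap
  · exact q.FF_principal3 had ha0 ha hc hy3
  set M := u ^ 2 + 27 * E * v ^ 2 with hM
  have hM3 : ¬ (3 : ℤ) ∣ M := by
    intro h
    have : (3 : ℤ) ∣ u ^ 2 := by
      obtain ⟨k, hk⟩ := h
      exact ⟨k - 9 * E * v ^ 2, by linear_combination hk - hM⟩
    exact had.three (Int.prime_three.dvd_of_dvd_pow this)
  have hx3 : ¬ (3 : ℤ) ∣ x := by
    intro h
    obtain ⟨n, hn⟩ : ∃ n : ℤ, 4 * n = x ^ 2 - E * y ^ 2 := by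
      have := q.nm _ _ _ ha
      rcases abs_choice (x ^ 2 - E * y ^ 2) with h2 | h2
      · exact ⟨_, this.trans h2⟩
      · exact ⟨-(absNorm (span {a}) : ℤ), by linear_combination (-1 : ℤ) * (this.trans h2)⟩
    have h1 := q.cop_norm hc ha hn
    have h2 : (3 : ℤ) ∣ 4 * n := by
      rw [hn]; exact dvd_sub (dvd_pow h two_ne_zero) (Dvd.dvd.mul_left (dvd_pow hy3 two_ne_zero) _)
    have h3 : (3 : ℤ) ∣ n := by omega
    exact Int.prime_three.not_isUnit (h1.isUnit_of_dvd' h3 (Dvd.dvd.mul_right (by norm_num) _))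
  obtain ⟨k, hk⟩ : ∃ k : ℤ, ¬ (3 : ℤ) ∣ (1 + 2 * M * k) ^ 2 - E * (2 * M) ^ 2 := by
    have hM' : M % 3 = 1 ∨ M % 3 = 2 := by omega
    have hE' : E % 3 = 0 ∨ E % 3 = 1 ∨ E % 3 = 2 := by omega
    have key : ∀ k : ℤ, ((1 + 2 * M * k) ^ 2 - E * (2 * M) ^ 2) % 3 =
        ((1 + 2 * (M % 3) * k) ^ 2 - (E % 3) * (2 * (M % 3)) ^ 2) % 3 := by
      intro k
      have h1 : M ≡ M % 3 [ZMOD 3] := (Int.mod_modEq _ _).symm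
      have h2 : E ≡ E % 3 [ZMOD 3] := (Int.mod_modEq _ _).symm
      exact Int.ModEq.sub (((h1.mul_left 2).mul_right k).add_left 1 |>.pow 2) (h2.mul ((h1.mul_left 2).pow 2))
    simp only [Int.dvd_iff_emod_eq_zero, key]
    rcases hM' with h | h <;> rcases hE' with h' | h' | h' <;> rw [h, h']
    · exact ⟨0, by norm_num⟩
    · exact ⟨1, by norm_num⟩
    · exact ⟨0, by norm_num⟩
    · exact ⟨0, by norm_num⟩
    · exact ⟨-1, by norm_num⟩
    · exact ⟨0, by norm_num⟩
  set X := 1 + 2 * M * k with hX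
  set n := X ^ 2 - E * (2 * M) ^ 2 with hn
  set b : 𝓞 K := X + (2 * M : ℤ) * ε with hb
  have hnm : IsCoprime n (6 * M) := by
    have h1 : IsCoprime n (2 * M) := ⟨1, -(X ^ 2 - 1) / (2 * M) + E * (2 * M), by
      have : X ^ 2 - 1 = (2 * M) * (2 * k + 2 * M * k ^ 2) := by rw [hX]; ring
      rw [this, ← mul_neg, Int.mul_ediv_cancel_left _ (mul_ne_zero two_ne_zero had.ne), hn, hX]
      ring⟩
    have h2 : IsCoprime n 3 := (Int.prime_three.coprime_iff_not_dvd.2 hk).symm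
    have := h2.mul_right h1
    rwa [show 3 * (2 * M) = 6 * M by ring] at this
  have hbc : IsCoprime b ((6 * M : ℤ) : 𝓞 K) := by
    have h1 : IsCoprime (n : 𝓞 K) ((6 * M : ℤ) : 𝓞 K) := hnm.map (Int.castRingHom (𝓞 K))
    refine h1.of_isCoprime_of_dvd_left ⟨X - (2 * M : ℤ) * ε, ?_⟩
    rw [hb, hn]
    push_cast
    linear_combination (2 * (M : 𝓞 K)) ^ 2 * q.sq
  have hn0 : n ≠ 0 := by rintro h; rw [h] at hk; simp at hk
  have hb0 : b ≠ 0 := by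
    intro h
    have := q.uniq X (2 * M) h
    exact had.ne (by omega)
  have hFb := q.FF_principal3 (x := 2 * X) (y := 2 * (2 * M)) had hb0
    (by rw [hb]; push_cast; ring) hbc (by omega)
  have hFab := q.FF_principal3 (x := x * X + 2 * M * y * E) (y := x * (2 * M) + y * X) had
    (mul_ne_zero ha0 hb0)
    (by rw [hb]; push_cast; linear_combination (X + 2 * M * ε) * ha + 2 * (M : 𝓞 K) * y * q.sq)
    (hc.mul_left hbc) (by
      intro h
      have h1 : (3 : ℤ) ∣ x * (2 * M) := (Int.dvd_add_left (Dvd.dvd.mul_right hy3 X)).1 h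
      rcases Int.prime_three.dvd_or_dvd h1 with h1 | h1
      · exact hx3 h1
      · exact hM3 (by omega))
  rw [← Ideal.span_singleton_mul_span_singleton, FF_mul, ← hM, hFb, mul_one] at hFab
  · exact hFab
  · simpa using ha0
  · simpa using hb0

end
end Sch
end

section
namespace Sch
open NumberField Ideal UniqueFactorizationMonoid nonZeroDivisors

noncomputable def om : ℂ := Complex.exp (2 * Real.pi * Complex.I / 3)

lemma om_prim : IsPrimitiveRoot om 3 := by
  have := Complex.isPrimitiveRoot_exp 3 (by norm_num)
  simpa [om] using this

lemma om_eq : om * om = -1 - om := by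
  have h := om_prim.geom_sum_eq_zero (by norm_num)
  simp [Finset.sum_range_succ] at h
  linear_combination h

noncomputable def io : Zw →+* ℂ := homOf om om_eq

lemma io_inj {s s' : Zw} (h : s ^ 3 = 1) (h' : s' ^ 3 = 1) (e : io s = io s') : s = s' := by
  have hw : io w = om := homOf_w _ _
  have h1 : om ≠ 1 := om_prim.ne_one (by norm_num)
  have h0 : om ≠ 0 := om_prim.ne_zero (by norm_num)
  have h2 : om ^ 2 ≠ 1 := om_prim.pow_ne_one_of_pos_of_lt (by norm_num) (by norm_num)
  have h3 : om ^ 2 ≠ om := by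
    intro h; apply h1; apply mul_left_cancel₀ h0; rw [mul_one, ← pow_two, h]
  rcases mu3_cases h with rfl | rfl | rfl <;> rcases mu3_cases h' with rfl | rfl | rfl <;>
    simp only [map_one, map_pow, hw] at e <;> first | rfl | (exfalso; first | exact h1 e | exact h2 e | exact h3 e | exact h1 e.symm | exact h2 e.symm | exact h3 e.symm)

section
variable {K : Type*} [Field K] [NumberField K] {E : ℤ} {ε : 𝓞 K} {u v : ℤ}

lemma exists_rep (c : ClassGroup (𝓞 K)) {m : 𝓞 K} (hm : m ≠ 0) :
    ∃ I : (Ideal (𝓞 K))⁰, ClassGroup.mk0 I = c ∧ (I : Ideal (𝓞 K)) ⊔ span {m} = ⊤ := by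
  obtain ⟨J, hJ⟩ := ClassGroup.mk0_surjective c⁻¹
  have hJ0 : (J : Ideal (𝓞 K)) ≠ ⊥ := nonZeroDivisors.coe_ne_zero J
  have hm0 : span {m} ≠ (⊥ : Ideal (𝓞 K)) := by simpa using hm
  obtain ⟨a, ha⟩ := IsDedekindDomain.exists_sup_span_eq (I := (J : Ideal (𝓞 K)) * span {m}) (J := J)
    Ideal.mul_le_left (mul_ne_zero hJ0 hm0)
  have haJ : span {a} ≤ (J : Ideal (𝓞 K)) := by rw [← ha]; exact le_sup_right
  obtain ⟨I, hI⟩ := Ideal.dvd_iff_le.2 haJ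
  have hcop : I ⊔ span {m} = ⊤ := by
    have : (J : Ideal (𝓞 K)) * (I ⊔ span {m}) = J * ⊤ := by
      rw [Ideal.mul_sup, ← hI, sup_comm, ha, Ideal.mul_top]
    exact mul_left_cancel₀ hJ0 this
  by_cases h0 : a = 0
  · obtain ⟨I', hI'⟩ := ClassGroup.mk0_surjective c
    refine ⟨I', hI', ?_⟩
    have : I = ⊥ := by
      rw [h0, Ideal.span_singleton_eq_bot.2 rfl] at hI
      exact (mul_eq_zero.1 hI.symm).resolve_left hJ0
    rw [this, bot_sup_eq] at hcop
    rw [hcop]; simp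
  · have hI0 : I ≠ ⊥ := by
      rintro rfl
      rw [Ideal.mul_bot, Ideal.span_singleton_eq_bot] at hI
      exact h0 hI
    refine ⟨⟨I, mem_nonZeroDivisors_of_ne_zero hI0⟩, ?_, hcop⟩
    have : ClassGroup.mk0 ⟨I, mem_nonZeroDivisors_of_ne_zero hI0⟩ = (ClassGroup.mk0 J)⁻¹ := by
      rw [ClassGroup.mk0_eq_mk0_inv_iff]
      exact ⟨a, h0, by rw [hI, mul_comm]⟩
    rw [this, hJ, inv_inv]

theorem QF.exists_char (q : QF E ε) (had : Adm E u v) :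
    ∃ χ : ClassGroup (𝓞 K) →* ℂˣ, χ ^ 3 = 1 ∧ ∀ (P : (Ideal (𝓞 K))⁰) (p : ℕ) (t : ℤ) (s : Zw),
      (P : Ideal (𝓞 K)).IsPrime → p.Prime → ¬ (p : ℤ) ∣ 6 * (u ^ 2 + 27 * E * v ^ 2) →
      (p : 𝓞 K) ∈ (P : Ideal (𝓞 K)) → ε - t ∈ (P : Ideal (𝓞 K)) → IsVal u v p t s →
      ((χ (ClassGroup.mk0 P) : ℂˣ) : ℂ) = io s := by
  set m := 6 * (u ^ 2 + 27 * E * v ^ 2) with hm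
  have hm0 : (m : 𝓞 K) ≠ 0 := by
    have : m ≠ 0 := mul_ne_zero (by norm_num) had.ne
    exact_mod_cast this
  let F := FF ε u v m
  have hF1 : ∀ I : (Ideal (𝓞 K))⁰, ClassGroup.mk0 I = 1 → (I : Ideal (𝓞 K)) ⊔ span {(m : 𝓞 K)} = ⊤ →
      F I = 1 := by
    intro I hI hc
    rw [ClassGroup.mk0_eq_one_iff] at hI
    obtain ⟨a, ha⟩ := hI.principal
    have ha' : (I : Ideal (𝓞 K)) = span {a} := ha
    have ha0 : a ≠ 0 := by
      rintro rfl
      exact nonZeroDivisors.coe_ne_zero I (by rw [ha']; simp)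
    rw [ha'] at hc
    rw [ha']
    apply q.FF_principal had ha0
    rw [← Ideal.isCoprime_span_singleton_iff]
    exact Ideal.isCoprime_iff_sup_eq.2 hc
  have hmulc : ∀ I J : (Ideal (𝓞 K))⁰, (I : Ideal (𝓞 K)) ⊔ span {(m : 𝓞 K)} = ⊤ →
      (J : Ideal (𝓞 K)) ⊔ span {(m : 𝓞 K)} = ⊤ → ((I * J : (Ideal (𝓞 K))⁰) : Ideal (𝓞 K)) ⊔ span {(m : 𝓞 K)} = ⊤ := by
    intro I J h1 h2
    rw [← Ideal.isCoprime_iff_sup_eq] at *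
    exact h1.mul_left h2
  have hmul : ∀ I J : (Ideal (𝓞 K))⁰, F (I * J : (Ideal (𝓞 K))⁰) = F I * F J := fun I J =>
    FF_mul (nonZeroDivisors.coe_ne_zero I) (nonZeroDivisors.coe_ne_zero J)
  choose r hr hrc using fun c : ClassGroup (𝓞 K) => exists_rep c hm0
  have hwd : ∀ I J : (Ideal (𝓞 K))⁰, ClassGroup.mk0 I = ClassGroup.mk0 J →
      (I : Ideal (𝓞 K)) ⊔ span {(m : 𝓞 K)} = ⊤ → (J : Ideal (𝓞 K)) ⊔ span {(m : 𝓞 K)} = ⊤ → F I = F J := by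
    intro I J h h1 h2
    have e1 := hF1 (I * r (ClassGroup.mk0 I)⁻¹) (by rw [map_mul, hr]; simp) (hmulc _ _ h1 (hrc _))
    have e2 := hF1 (J * r (ClassGroup.mk0 I)⁻¹) (by rw [map_mul, hr, h]; simp) (hmulc _ _ h2 (hrc _))
    rw [hmul] at e1 e2
    exact mul_right_cancel₀ (right_ne_zero_of_mul_eq_one e1) (e1.trans e2.symm)
  let χ0 : ClassGroup (𝓞 K) →* ℂ :=
    { toFun := fun c => io (F (r c))
      map_one' := by rw [hF1 _ (hr 1) (hrc 1), map_one]
      map_mul' := by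
        intro c d
        rw [← map_mul, ← hmul, hwd _ (r c * r d) (by rw [hr, map_mul, hr, hr]) (hrc _)
          (hmulc _ _ (hrc _) (hrc _))] }
  refine ⟨MonoidHom.toHomUnits χ0, ?_, ?_⟩
  · ext c
    simp only [MonoidHom.pow_apply, Units.val_pow_eq_pow_val, MonoidHom.coe_toHomUnits,
      MonoidHom.one_apply, Units.val_one]
    change io (F (r c)) ^ 3 = 1
    rw [← map_pow, FF_cube, map_one]
  · intro P p t s hP hp hpm hpP ht hs
    rw [MonoidHom.coe_toHomUnits]
    change io (F (r _)) = _
    rw [hwd _ P (hr _) (hrc _)]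
    change io (FF ε u v m P) = io s
    rw [FF_prime hP (nonZeroDivisors.coe_ne_zero P),
      phi_eq hP hp hpm hpP ht hs]
    by_contra h
    have hPm : (P : Ideal (𝓞 K)).IsMaximal :=
      Ring.DimensionLEOne.maximalOfPrime (nonZeroDivisors.coe_ne_zero P) hP
    have h1 := hPm.eq_of_le h le_sup_left
    have h2 : (m : 𝓞 K) ∈ (P : Ideal (𝓞 K)) := by
      rw [h1]; exact le_sup_right (α := Ideal (𝓞 K)) (Ideal.mem_span_singleton_self _)
    exact hpm ((mem_int hP hp hpP).1 h2)

end
end Sch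
end

section
namespace Sch
open NumberField

section
variable {K : Type*} [Field K] [NumberField K]

structure QK (c : ℤ) (θ : K) : Prop where
  sq : θ ^ 2 = c
  ex : ∀ x : K, ∃ a b : ℚ, x = a + b * θ
  uniq : ∀ a b : ℚ, (a : K) + b * θ = 0 → a = 0 ∧ b = 0
  nm : ∀ a b : ℚ, Algebra.norm ℚ ((a : K) + b * θ) = a ^ 2 - c * b ^ 2
  tr : ∀ a b : ℚ, Algebra.trace ℚ K ((a : K) + b * θ) = 2 * a

theorem QK.mk' {c : ℤ} {θ : K} (h : θ ^ 2 = c) (hns : ¬ IsSquare (c : ℚ))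
    (had : Algebra.adjoin ℚ {θ} = ⊤) : QK c θ := by
  have ex : ∀ x : K, ∃ a b : ℚ, x = a + b * θ := by
    intro x
    have hx : x ∈ Algebra.adjoin ℚ {θ} := by rw [had]; trivial
    induction hx using Algebra.adjoin_induction with
    | mem x hx => rw [Set.mem_singleton_iff] at hx; exact ⟨0, 1, by simp [hx]⟩
    | algebraMap r => exact ⟨r, 0, by simp⟩
    | add x y _ _ hx hy =>
      obtain ⟨a, b, rfl⟩ := hx
      obtain ⟨a', b', rfl⟩ := hy
      exact ⟨a + a', b + b', by push_cast; ring⟩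
    | mul x y _ _ hx hy =>
      obtain ⟨a, b, rfl⟩ := hx
      obtain ⟨a', b', rfl⟩ := hy
      exact ⟨a * a' + c * (b * b'), a * b' + a' * b, by push_cast; linear_combination (b * b' : K) * h⟩
  have uniq : ∀ a b : ℚ, (a : K) + b * θ = 0 → a = 0 ∧ b = 0 := by
    intro a b hab
    have h1 : ((a ^ 2 : ℚ) : K) = ((c * b ^ 2 : ℚ) : K) := by
      push_cast
      rw [← h]
      linear_combination ((a : K) - b * θ) * hab
    have h2 : a ^ 2 = c * b ^ 2 := by exact_mod_cast h1
    have hb : b = 0 := by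
      by_contra hb
      apply hns
      refine ⟨a / b, ?_⟩
      field_simp
      linarith
    refine ⟨?_, hb⟩
    rw [hb] at h2
    have : a ^ 2 = 0 := by rw [h2]; ring
    exact pow_eq_zero_iff (two_ne_zero) |>.1 this
  have li : LinearIndependent ℚ ![(1 : K), θ] := by
    rw [LinearIndependent.pair_iff]
    intro s t hst
    apply uniq
    simpa [Algebra.smul_def] using hst
  have sp : ⊤ ≤ Submodule.span ℚ (Set.range ![(1 : K), θ]) := by
    intro x _
    obtain ⟨a, b, rfl⟩ := ex x
    rw [Matrix.range_cons, Matrix.range_cons, Matrix.range_empty, Set.union_empty,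
      Set.singleton_union, Submodule.mem_span_pair]
    exact ⟨a, b, by simp [Algebra.smul_def]⟩
  let B := Module.Basis.mk li sp
  have hB0 : B 0 = 1 := by simp [B]
  have hB1 : B 1 = θ := by simp [B]
  have key : ∀ a b : ℚ, Matrix.toLin B B !![a, c * b; b, a] = Algebra.lmul ℚ K ((a : K) + b * θ) := by
    intro a b
    apply B.ext
    intro i
    fin_cases i
    · change Matrix.toLin B B _ (B 0) = _ * (B 0)
      rw [Matrix.toLin_self, Fin.sum_univ_two, hB0, hB1]
      simp [Algebra.smul_def]
    · change Matrix.toLin B B _ (B 1) = _ * (B 1)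
      rw [Matrix.toLin_self, Fin.sum_univ_two, hB0, hB1]
      simp [Algebra.smul_def]
      rw [← h]; ring
  refine ⟨h, ex, uniq, ?_, ?_⟩
  · intro a b
    rw [Algebra.norm_apply, ← key, LinearMap.det_toLin, Matrix.det_fin_two_of]
    ring
  · intro a b
    rw [Algebra.trace_apply, ← key, LinearMap.trace_eq_matrix_trace ℚ B, LinearMap.toMatrix_toLin, Matrix.trace_fin_two_of]
    ring

lemma sqf_int {E : ℤ} (hE : Squarefree E) {r : ℚ} {k : ℤ} (h : E * r ^ 2 = k) : ∃ n : ℤ, r = n := by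
  have hd : (r.den : ℚ) ≠ 0 := by exact_mod_cast r.den_ne_zero
  have h1 : E * r.num ^ 2 = k * r.den ^ 2 := by
    have : (E : ℚ) * r.num ^ 2 = k * r.den ^ 2 := by
      have h5 : r * r.den = r.num := Rat.mul_den_eq_num r
      rw [← h, ← h5]; ring
    exact_mod_cast this
  have h2 : (r.den : ℤ) * r.den ∣ E := by
    have hc : IsCoprime ((r.den : ℤ) * r.den) (r.num ^ 2) := by
      have : IsCoprime (r.den : ℤ) r.num := (Rat.isCoprime_num_den r).symm
      exact (this.mul_left this).pow_right
    exact hc.dvd_of_dvd_mul_right ⟨k, by rw [h1]; ring⟩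
  have h3 := hE _ h2
  have h4 : r.den = 1 := by simpa using Int.isUnit_iff_natAbs_eq.1 h3
  exact ⟨r.num, (Rat.den_eq_one_iff r |>.1 h4).symm⟩

lemma isInt_rat {r : ℚ} (h : IsIntegral ℤ r) : ∃ n : ℤ, r = n := by
  obtain ⟨n, hn⟩ := IsIntegrallyClosed.isIntegral_iff.1 h
  exact ⟨n, by simpa using hn.symm⟩

lemma QK.integral {c : ℤ} {θ : K} (q : QK c θ) {a b : ℚ} (h : IsIntegral ℤ ((a : K) + b * θ)) :
    (∃ s : ℤ, 2 * a = s) ∧ ∃ n : ℤ, a ^ 2 - c * b ^ 2 = n := by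
  constructor
  · apply isInt_rat
    rw [← q.tr a b]
    exact Algebra.isIntegral_trace h
  · apply isInt_rat
    rw [← q.nm a b]
    exact Algebra.isIntegral_norm ℚ h

theorem QK.qf {E : ℤ} {ε : 𝓞 K} (q : QK E (ε : K)) (hE : Squarefree E) : QF E ε where
  sq := by
    apply RingOfIntegers.ext
    have := q.sq
    simpa using this
  four := by
    intro h
    have := hE 2 h
    exact Int.prime_two.not_isUnit this
  co := by
    intro x
    obtain ⟨a, b, hx⟩ := q.ex x
    obtain ⟨⟨s, hs⟩, n, hn⟩ := q.integral (a := a) (b := b) (by rw [← hx]; exact x.isIntegral_coe)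
    obtain ⟨t, ht⟩ := sqf_int hE (r := 2 * b) (k := s ^ 2 - 4 * n) (by
      push_cast
      rw [← hs, ← hn]; ring)
    refine ⟨s, t, ?_⟩
    apply RingOfIntegers.ext
    have h1 : ((2 * a : ℚ) : K) = s := by rw [hs]; simp
    have h2 : ((2 * b : ℚ) : K) = t := by rw [ht]; simp
    push_cast at h1 h2
    simp only [map_mul, map_add, map_intCast, map_ofNat]
    change (2 : K) * (x : K) = s + t * (ε : K)
    rw [hx]
    linear_combination h1 + (ε : K) * h2
  uniq := by
    intro x y h
    have h1 := congrArg (algebraMap (𝓞 K) K) h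
    simp only [map_mul, map_add, map_intCast, map_zero] at h1
    have := q.uniq x y (by simpa using h1)
    exact_mod_cast this
  nm := by
    intro a x y h
    have h1 : (2 : K) * a = x + y * ε := by
      have h1 := congrArg (algebraMap (𝓞 K) K) h
      simpa only [map_mul, map_add, map_intCast, map_ofNat] using h1
    have h2 : (a : K) = ((x / 2 : ℚ) : K) + ((y / 2 : ℚ) : K) * ε := by
      push_cast
      linear_combination (1 / 2) * h1
    have h3 : (4 : ℤ) * Algebra.norm ℤ a = x ^ 2 - E * y ^ 2 := by
      have : (4 : ℚ) * (Algebra.norm ℤ a : ℤ) = x ^ 2 - E * y ^ 2 := by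
        rw [Algebra.coe_norm_int, h2, q.nm]; ring
      exact_mod_cast this
    rw [Ideal.absNorm_span_singleton, ← h3, abs_mul, Int.natCast_natAbs]
    rfl

end
end Sch
end

section
namespace Sch
open NumberField nonZeroDivisors FractionalIdeal

section
variable {K : Type*} [Field K] [NumberField K]

def InG (γ : K) : Prop := γ ≠ 0 ∧ ∃ J : FractionalIdeal (𝓞 K)⁰ K, spanSingleton (𝓞 K)⁰ γ = J ^ 3

theorem InG.mul {x y : K} (hx : InG x) (hy : InG y) : InG (x * y) := by
  obtain ⟨hx0, I, hI⟩ := hx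
  obtain ⟨hy0, J, hJ⟩ := hy
  exact ⟨mul_ne_zero hx0 hy0, I * J, by rw [← spanSingleton_mul_spanSingleton, hI, hJ, mul_pow]⟩

theorem InG.cube {z : K} (hz : z ≠ 0) : InG (z ^ 3) :=
  ⟨pow_ne_zero 3 hz, spanSingleton _ z, by rw [spanSingleton_pow]⟩

theorem InG.norm {γ : K} (h : InG γ) : ∃ r : ℚ, Algebra.norm ℚ γ = r ^ 3 := by
  obtain ⟨h0, J, hJ⟩ := h
  have h1 := congrArg FractionalIdeal.absNorm hJ
  rw [map_pow, FractionalIdeal.absNorm_span_singleton] at h1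
  rcases abs_choice (Algebra.norm ℚ γ) with h | h
  · exact ⟨_, by rw [← h]; exact h1⟩
  · exact ⟨-FractionalIdeal.absNorm J, by rw [h] at h1; linear_combination -h1⟩

theorem InG.exists_int {γ : K} (h : InG γ) : ∃ c : K, c ≠ 0 ∧ ∃ η : 𝓞 K,
    (η : K) = c ^ 3 * γ ∧ IsCoprime η 6 := by
  obtain ⟨h0, J, hJ⟩ := h
  have hJ0 : J ≠ 0 := by
    rintro rfl
    rw [zero_pow three_ne_zero, spanSingleton_eq_zero_iff] at hJ
    exact h0 hJ
  obtain ⟨I, hI, hcop⟩ := exists_rep (ClassGroup.mk K (Units.mk0 J hJ0)) (m := (6 : 𝓞 K)) (by norm_num)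
  rw [← ClassGroup.mk_mk0 K] at hI
  have h1 : ClassGroup.mk K (FractionalIdeal.mk0 K I / Units.mk0 J hJ0) = 1 := by
    rw [map_div, hI, div_self']
  rw [ClassGroup.mk_eq_one_iff] at h1
  obtain ⟨x, hx⟩ := @Submodule.IsPrincipal.principal _ _ _ _ _ _ h1
  have hx' : ((FractionalIdeal.mk0 K I / Units.mk0 J hJ0 : (FractionalIdeal (𝓞 K)⁰ K)ˣ) :
      FractionalIdeal (𝓞 K)⁰ K) = spanSingleton (𝓞 K)⁰ x := by
    apply Subtype.coe_injective
    simp only [val_eq_coe, hx, coe_spanSingleton]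
  have h2 : ((I : Ideal (𝓞 K)) : FractionalIdeal (𝓞 K)⁰ K) = spanSingleton (𝓞 K)⁰ x * J := by
    rw [← hx', Units.val_div_eq_div_val, FractionalIdeal.coe_mk0, Units.val_mk0, div_mul_cancel₀ _ hJ0]
  have hI0 : (I : Ideal (𝓞 K)) ≠ 0 := nonZeroDivisors.coe_ne_zero I
  have hx0 : x ≠ 0 := by
    rintro rfl
    rw [spanSingleton_zero, zero_mul] at h2
    exact hI0 (coeIdeal_eq_zero.1 h2)
  have h3 : (((I : Ideal (𝓞 K)) ^ 3 : Ideal (𝓞 K)) : FractionalIdeal (𝓞 K)⁰ K) =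
      spanSingleton (𝓞 K)⁰ (x ^ 3 * γ) := by
    rw [coeIdeal_pow, h2, mul_pow, ← hJ, spanSingleton_pow, spanSingleton_mul_spanSingleton]
  have h4 : x ^ 3 * γ ∈ (((I : Ideal (𝓞 K)) ^ 3 : Ideal (𝓞 K)) : FractionalIdeal (𝓞 K)⁰ K) := by
    rw [h3]; exact mem_spanSingleton_self _ _
  rw [mem_coeIdeal] at h4
  obtain ⟨η, hη, he⟩ := h4
  refine ⟨x, hx0, η, he, ?_⟩
  have h5 : Ideal.span {η} = (I : Ideal (𝓞 K)) ^ 3 := by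
    rw [← coeIdeal_inj (K := K), h3, coeIdeal_span_singleton, ← he]
  rw [← Ideal.isCoprime_span_singleton_iff, h5]
  apply IsCoprime.pow_left
  rw [Ideal.isCoprime_iff_sup_eq]
  exact hcop

end
end Sch
end

section
namespace Sch
open NumberField nonZeroDivisors FractionalIdeal

section
variable {K : Type*} [Field K] [NumberField K]

theorem QK.uniq2 {c : ℤ} {θ : K} (q : QK c θ) {a b a' b' : ℚ}
    (h : (a : K) + b * θ = a' + b' * θ) : a = a' ∧ b = b' := by
  have := q.uniq (a - a') (b - b') (by push_cast; linear_combination h)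
  exact ⟨by linarith [this.1], by linarith [this.2]⟩

theorem QK.norm_not_dvd {c : ℤ} {θ : K} (q : QK c θ) {a b : ℚ} {η : 𝓞 K} (hη : (η : K) = a + b * θ)
    {s n : ℤ} (hs : 2 * a = s) (hn : a ^ 2 - c * b ^ 2 = n) {p : ℤ} (hp : Prime p)
    (hc : IsCoprime η (p : 𝓞 K)) : ¬ p ∣ n := by
  rintro ⟨k, rfl⟩
  have hsK : (2 : K) * a = s := by exact_mod_cast congrArg (fun x : ℚ => (x : K)) hs
  have hnK : (a : K) ^ 2 - c * b ^ 2 = p * k := by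
    exact_mod_cast congrArg (fun x : ℚ => (x : K)) hn
  have h1 : η * (s - η) = p * k := by
    apply RingOfIntegers.ext
    simp only [map_mul, map_sub, map_intCast]
    change (η : K) * (s - (η : K)) = p * k
    rw [hη, ← hsK, ← hnK]
    linear_combination (-(b : K) ^ 2) * q.sq
  have h2 : (p : 𝓞 K) ∣ s - η := by
    apply hc.symm.dvd_of_dvd_mul_left
    rw [h1]; exact dvd_mul_right _ _
  obtain ⟨δ, hδ⟩ := h2
  have hδK : (s : K) - η = p * δ := by
    have := congrArg (fun x : 𝓞 K => (x : K)) hδ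
    simpa using this
  obtain ⟨a', b', hδ'⟩ := q.ex (δ : K)
  obtain ⟨⟨s', hs'⟩, -⟩ := q.integral (a := a') (b := b') (hδ' ▸ δ.isIntegral_coe)
  have h3 := q.uniq2 (a := a) (b := -b) (a' := p * a') (b' := p * b') (by
    push_cast
    rw [hη, ← hsK, hδ'] at hδK
    linear_combination hδK)
  have h4 : s = p * s' := by
    have : (s : ℚ) = p * s' := by rw [← hs, ← hs', h3.1]; ring
    exact_mod_cast this
  have h5 : (p : 𝓞 K) ∣ η := ⟨s' - δ, by
    have : (s : 𝓞 K) = p * s' := by rw [h4]; push_cast; ring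
    linear_combination this - hδ⟩
  have h6 : IsUnit (p : 𝓞 K) := hc.isUnit_of_dvd' h5 dvd_rfl
  obtain ⟨y, hy⟩ := h6.exists_right_inv
  have hyK : (p : K) * y = 1 := by
    have := congrArg (fun x : 𝓞 K => (x : K)) hy
    simpa using this
  obtain ⟨a'', b'', hy'⟩ := q.ex (y : K)
  obtain ⟨-, m, hm⟩ := q.integral (a := a'') (b := b'') (hy' ▸ y.isIntegral_coe)
  have h7 := q.uniq2 (a := p * a'') (b := p * b'') (a' := 1) (b' := 0) (by
    push_cast
    rw [hy'] at hyK
    linear_combination hyK)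
  have hp0 : (p : ℚ) ≠ 0 := by exact_mod_cast hp.ne_zero
  have hb0 : b'' = 0 := by
    rcases mul_eq_zero.1 h7.2 with h | h
    · exact absurd h hp0
    · exact h
  have h8 : (p ^ 2 * m : ℤ) = 1 := by
    have : (p : ℚ) ^ 2 * m = 1 := by
      rw [← hm, hb0]; linear_combination (p * a'' + 1) * h7.1
    exact_mod_cast this
  exact hp.not_unit (isUnit_of_dvd_one ⟨p * m, by linarith⟩)

theorem QK.coords {E : ℤ} {θ : K} (q : QK (-3 * E) θ) (hE : Squarefree E) {η : 𝓞 K}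
    (hc : IsCoprime η 6) : ∃ s t n : ℤ, (2 : K) * η = s + t * (θ / 3) ∧ 3 * s ^ 2 + E * t ^ 2 = 12 * n
      ∧ n % 2 = 1 ∧ ¬ (3 : ℤ) ∣ n := by
  obtain ⟨a, b, hη⟩ := q.ex (η : K)
  obtain ⟨⟨s, hs⟩, n, hn⟩ := q.integral (a := a) (b := b) (hη ▸ η.isIntegral_coe)
  have h2 : ¬ (2 : ℤ) ∣ n := q.norm_not_dvd hη hs hn Int.prime_two (by
    push_cast
    rw [show (6 : 𝓞 K) = 2 * 3 by norm_num] at hc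
    exact hc.of_mul_right_left)
  have h3 : ¬ (3 : ℤ) ∣ n := q.norm_not_dvd hη hs hn Int.prime_three (by
    push_cast
    rw [show (6 : 𝓞 K) = 2 * 3 by norm_num] at hc
    exact hc.of_mul_right_right)
  have e1 : (E : ℚ) * (6 * b) ^ 2 = ((12 * n - 3 * s ^ 2 : ℤ) : ℚ) := by
    push_cast
    rw [← hn, ← hs]; push_cast; ring
  obtain ⟨t, ht⟩ := sqf_int hE e1
  refine ⟨s, t, n, ?_, ?_, by omega, h3⟩
  · have hsK : (2 : K) * a = s := by exact_mod_cast congrArg (fun x : ℚ => (x : K)) hs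
    have htK : (6 : K) * b = t := by exact_mod_cast congrArg (fun x : ℚ => (x : K)) ht
    rw [hη, ← hsK, ← htK]; ring
  · rw [ht] at e1
    have : E * t ^ 2 = 12 * n - 3 * s ^ 2 := by exact_mod_cast e1
    linarith

def QL (E : ℤ) (θ η : K) (l : ZMod 3) : Prop :=
  ∃ s t : ℤ, 2 * η = s + t * θ ∧ ¬ (3 : ℤ) ∣ s ∧ (s ^ 2 + 3 * E * t ^ 2) % 8 = 4 ∧
    ((s * t : ℤ) : ZMod 3) = l

theorem z3 (a : ℤ) : ((a : ℤ) : ZMod 3) = 0 ↔ (3 : ℤ) ∣ a := ZMod.intCast_zmod_eq_zero_iff_dvd a 3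

theorem zsq3 {s : ℤ} (h : ¬ (3 : ℤ) ∣ s) : ((s : ZMod 3)) ^ 2 = 1 := by
  have : (s : ZMod 3) ≠ 0 := by rwa [Ne, ZMod.intCast_zmod_eq_zero_iff_dvd]
  revert this
  generalize (s : ZMod 3) = x
  revert x; decide

theorem par_aux {E s t : ℤ} (hE : Squarefree E) (h : (s ^ 2 + 3 * E * t ^ 2) % 8 = 4) :
    (s % 2 = 0 ∧ t % 2 = 0) ∨ (s % 2 = 1 ∧ t % 2 = 1 ∧ E % 2 = 1) := by
  have h4 : ¬ (4 : ℤ) ∣ E := by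
    intro h4
    have := hE 2 (by simpa using h4)
    rw [Int.isUnit_iff] at this
    omega
  rcases Int.even_or_odd s with ⟨a, ha⟩ | ⟨a, ha⟩ <;> rcases Int.even_or_odd t with ⟨b, hb⟩ | ⟨b, hb⟩
  · left; omega
  · exfalso
    have : s ^ 2 + 3 * E * t ^ 2 = 4 * (a ^ 2 + 3 * E * (b ^ 2 + b)) + 3 * E := by rw [ha, hb]; ring
    omega
  · exfalso
    have : s ^ 2 + 3 * E * t ^ 2 = 4 * (a ^ 2 + a + 3 * E * b ^ 2) + 1 := by rw [ha, hb]; ring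
    omega
  · have : s ^ 2 + 3 * E * t ^ 2 = 4 * (a ^ 2 + a + 3 * E * (b ^ 2 + b)) + 1 + 3 * E := by
      rw [ha, hb]; ring
    right; omega

theorem QL.mul {E : ℤ} (hE : Squarefree E) {θ η η' : K} (hθ : θ ^ 2 = ((-3 * E : ℤ) : K))
    {l l' : ZMod 3} (h : QL E θ η l) (h' : QL E θ η' l') : QL E θ (η * η') (l + l') := by
  obtain ⟨s, t, h1, h2, h3, h4⟩ := h
  obtain ⟨s', t', h1', h2', h3', h4'⟩ := h'
  have ⟨S, hS⟩ : ∃ S, s * s' - 3 * E * (t * t') = 2 * S := by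
    rw [← dvd_def]
    rcases par_aux hE h3 with ⟨ha, hb⟩ | ⟨ha, hb, hc⟩ <;>
    rcases par_aux hE h3' with ⟨ha', hb'⟩ | ⟨ha', hb', hc'⟩ <;>
    rw [Int.dvd_iff_emod_eq_zero] <;> simp [Int.sub_emod, Int.mul_emod, *]
  have ⟨T, hT⟩ : ∃ T, s * t' + s' * t = 2 * T := by
    rw [← dvd_def]
    rcases par_aux hE h3 with ⟨ha, hb⟩ | ⟨ha, hb, hc⟩ <;>
    rcases par_aux hE h3' with ⟨ha', hb'⟩ | ⟨ha', hb', hc'⟩ <;>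
    rw [Int.dvd_iff_emod_eq_zero] <;> simp [Int.add_emod, Int.mul_emod, *]
  have e3 : (3 : ZMod 3) = 0 := by decide
  have hSz := congrArg (fun x : ℤ => (x : ZMod 3)) hS
  have hTz := congrArg (fun x : ℤ => (x : ZMod 3)) hT
  push_cast at hSz hTz
  refine ⟨S, T, ?_, ?_, ?_, ?_⟩
  · have hSK := congrArg (fun x : ℤ => (x : K)) hS
    have hTK := congrArg (fun x : ℤ => (x : K)) hT
    push_cast at hSK hTK hθ
    have h20 : (2 : K) ≠ 0 := two_ne_zero
    apply mul_left_cancel₀ h20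
    linear_combination (2 * η') * h1 + (s + t * θ) * h1' + hSK + θ * hTK + t * t' * hθ
  · intro h3S
    have : (3 : ℤ) ∣ s * s' := by
      obtain ⟨k, hk⟩ := h3S
      exact ⟨E * (t * t') + 2 * k, by linear_combination hS + 2 * hk⟩
    rcases Int.prime_three.dvd_or_dvd this with h | h
    · exact h2 h
    · exact h2' h
  · have e : 4 * (S ^ 2 + 3 * E * T ^ 2) = (s ^ 2 + 3 * E * t ^ 2) * (s' ^ 2 + 3 * E * t' ^ 2) := by
      linear_combination -(s * s' - 3 * E * (t * t') + 2 * S) * hS - 3 * E * (s * t' + s' * t + 2 * T) * hT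
    obtain ⟨k, hk⟩ : ∃ k, s ^ 2 + 3 * E * t ^ 2 = 8 * k + 4 := ⟨(s ^ 2 + 3 * E * t ^ 2) / 8, by omega⟩
    obtain ⟨k', hk'⟩ : ∃ k, s' ^ 2 + 3 * E * t' ^ 2 = 8 * k + 4 :=
      ⟨(s' ^ 2 + 3 * E * t' ^ 2) / 8, by omega⟩
    rw [hk, hk'] at e
    have : S ^ 2 + 3 * E * T ^ 2 = 8 * (2 * k * k' + k + k') + 4 := by linarith
    omega
  · rw [← h4, ← h4']
    push_cast
    have a1 := zsq3 h2
    have a2 := zsq3 h2'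
    linear_combination (-(S : ZMod 3) * T) * e3 + (s' * t' : ZMod 3) * a1 + (s * t : ZMod 3) * a2
      - 2 * T * hSz - (s * s' - 3 * E * (t * t') : ZMod 3) * hTz - (E * (t * t') * (s * t' + s' * t)) * e3

theorem aux_dec : ∀ s t e : ZMod 3, s ^ 2 + e * t ^ 2 ≠ 0 → t ≠ 0 → e ≠ 0 →
    s * t * (s ^ 2 - e * t ^ 2) = 0 := by decide

theorem QL.exists {E : ℤ} (hE : Squarefree E) {θ : K} (q : QK (-3 * E) θ) {γ : K} (h : InG γ) :
    ∃ c : K, c ≠ 0 ∧ ∃ l, QL E θ (c ^ 3 * γ) l := by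
  obtain ⟨c, hc, η, he, hcop⟩ := h.exists_int
  have key : ∀ (η : 𝓞 K) (s t n : ℤ), (2 : K) * η = s + t * (θ / 3) → 3 * s ^ 2 + E * t ^ 2 = 12 * n
      → n % 2 = 1 → ¬ (3 : ℤ) ∣ n → (3 : ℤ) ∣ t → ∃ l, QL E θ (η : K) l := by
    rintro η s t n h1 h2 h3 h4 ⟨k, rfl⟩
    refine ⟨_, s, k, ?_, ?_, ?_, rfl⟩
    · rw [h1]; push_cast; ring
    · rintro ⟨m, rfl⟩
      apply h4
      exact ⟨3 * m ^ 2 + E * k ^ 2 - n, by linarith⟩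
    · have : s ^ 2 + 3 * E * k ^ 2 = 4 * n := by linarith
      omega
  obtain ⟨s, t, n, h1, h2, h3, h4⟩ := q.coords hE hcop
  by_cases ht : (3 : ℤ) ∣ t
  · obtain ⟨l, hl⟩ := key η s t n h1 h2 h3 h4 ht
    exact ⟨c, hc, l, he ▸ hl⟩
  obtain ⟨s', t', n', h1', h2', h3', h4'⟩ := q.coords hE (η := η ^ 4) (hcop.pow_left)
  have hE3 : (3 : ℤ) ∣ E := by
    have : (3 : ℤ) ∣ E * t ^ 2 := ⟨4 * n - s ^ 2, by linarith⟩
    rcases Int.prime_three.dvd_or_dvd this with h | h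
    · exact h
    · exact absurd (Int.prime_three.dvd_of_dvd_pow h) ht
  obtain ⟨E1, rfl⟩ := hE3
  have hE1 : ¬ (3 : ℤ) ∣ E1 := by
    rintro ⟨k, rfl⟩
    have := hE 3 ⟨k, by ring⟩
    rw [Int.isUnit_iff] at this
    omega
  have h5 : 8 * t' = 4 * s * t * (s ^ 2 - E1 * t ^ 2) := by
    have hsq := q.sq
    push_cast at hsq
    have e1 : (16 : K) * (η : K) ^ 4 = (s + t * (θ / 3)) ^ 4 := by rw [← h1]; ring
    have e2 : (η ^ 4 : 𝓞 K) = ((η : K) ^ 4 : K) := by simp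
    rw [e2] at h1'
    have := q.uniq2 (a := 8 * s') (b := 8 * t' / 3)
      (a' := s ^ 4 - 6 * s ^ 2 * t ^ 2 * E1 + t ^ 4 * E1 ^ 2)
      (b' := 4 * s * t * (s ^ 2 - E1 * t ^ 2) / 3) (by
        push_cast
        linear_combination (-8 : K) * h1' + e1 + (6 * s ^ 2 * t ^ 2 / 9 + 4 * s * t ^ 3 * θ / 27
          + t ^ 4 * (θ ^ 2 - 9 * E1) / 81) * hsq)
    have := this.2
    have h6 : (8 : ℚ) * t' = 4 * s * t * (s ^ 2 - E1 * t ^ 2) := by linarith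
    exact_mod_cast h6
  have h6 : (3 : ℤ) ∣ t' := by
    have e3 : (3 : ZMod 3) = 0 := by decide
    rw [← z3]
    have hz := congrArg (fun x : ℤ => (x : ZMod 3)) h5
    push_cast at hz
    have hn := congrArg (fun x : ℤ => (x : ZMod 3)) (show s ^ 2 + E1 * t ^ 2 = 4 * n by linarith)
    push_cast at hn
    rw [← z3] at hE1 h4 ht
    push_cast at hE1 h4 ht
    have h7 : (s : ZMod 3) ^ 2 + E1 * t ^ 2 ≠ 0 := by
      rw [hn]; intro h; apply h4; linear_combination h - n * e3
    have h8 := aux_dec (s : ZMod 3) t E1 h7 ht hE1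
    linear_combination (3 * t' : ZMod 3) * e3 - hz - 4 * h8
  obtain ⟨l, hl⟩ := key _ s' t' n' h1' h2' h3' h4' h6
  refine ⟨c ^ 4 * γ, mul_ne_zero (pow_ne_zero 4 hc) h.1, l, ?_⟩
  have : (c ^ 4 * γ) ^ 3 * γ = ((η ^ 4 : 𝓞 K) : K) := by
    simp only [map_pow]
    change _ = (η : K) ^ 4
    rw [he]; ring
  rw [this]; exact hl

end
end Sch
end

section
namespace Sch
open NumberField nonZeroDivisors FractionalIdeal IsDedekindDomain

section
variable {K : Type*} [Field K] [NumberField K]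

noncomputable def ev (v : HeightOneSpectrum (𝓞 K)) (x : K) : ℤ := count K v (spanSingleton (𝓞 K)⁰ x)

theorem ev_mul (v : HeightOneSpectrum (𝓞 K)) {x y : K} (hx : x ≠ 0) (hy : y ≠ 0) :
    ev v (x * y) = ev v x + ev v y := by
  rw [ev, ← spanSingleton_mul_spanSingleton, count_mul]
  · rfl
  · rwa [spanSingleton_ne_zero_iff]
  · rwa [spanSingleton_ne_zero_iff]

theorem ev_pow (v : HeightOneSpectrum (𝓞 K)) (x : K) (n : ℕ) :
    ev v (x ^ n) = n * ev v x := by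
  rw [ev, ← spanSingleton_pow, count_pow]; rfl

theorem ev_le_iff (v : HeightOneSpectrum (𝓞 K)) {x : 𝓞 K} (hx : x ≠ 0) (k : ℕ) :
    (k : ℤ) ≤ ev v (x : K) ↔ v.asIdeal ^ k ∣ Ideal.span {x} := by
  classical
  have h0 : Ideal.span {x} ≠ 0 := by
    rw [Ne, Ideal.zero_eq_bot, Ideal.span_singleton_eq_bot]; exact hx
  have h1 : ev v (x : K) = count K v ((Ideal.span {x} : Ideal (𝓞 K)) : FractionalIdeal (𝓞 K)⁰ K) := by
    rw [coeIdeal_span_singleton]; rfl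
  rw [h1, count_coe K v h0, Nat.cast_le,
    ← Associates.prime_pow_dvd_iff_le (Associates.mk_ne_zero.2 h0) v.associates_irreducible,
    ← Associates.mk_pow, Associates.mk_le_mk_iff_dvd]

theorem ev_nonneg (v : HeightOneSpectrum (𝓞 K)) {x : 𝓞 K} (hx : x ≠ 0) : 0 ≤ ev v (x : K) := by
  have := (ev_le_iff v hx 0).2 (by simp)
  simpa using this

theorem ev_eq_zero (v : HeightOneSpectrum (𝓞 K)) {x : 𝓞 K} (hx : x ∉ v.asIdeal) : ev v (x : K) = 0 := by
  have hx0 : x ≠ 0 := by rintro rfl; exact hx (zero_mem _)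
  have h1 := ev_nonneg v hx0
  have h2 := (ev_le_iff v hx0 1).not.2 (by
    rw [pow_one, Ideal.dvd_span_singleton]; exact hx)
  push_cast at h2
  omega

theorem InG.ev {γ : K} (h : InG γ) (v : HeightOneSpectrum (𝓞 K)) : 3 ∣ ev v γ := by
  obtain ⟨h0, J, hJ⟩ := h
  rw [Sch.ev, hJ, count_pow]
  exact dvd_mul_right _ _

theorem QK.ev_prime {c : ℤ} {θ : K} (q : QK c θ) (v : HeightOneSpectrum (𝓞 K)) {p : ℕ} (hp : p.Prime)
    (h : (p : 𝓞 K) ∈ v.asIdeal) : ¬ (3 : ℤ) ∣ ev v (p : K) := by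
  have hp0 : (p : 𝓞 K) ≠ 0 := by exact_mod_cast hp.ne_zero
  have e0 : ((p : 𝓞 K) : K) = (p : K) := by simp
  have h1 : (1 : ℤ) ≤ ev v (p : K) := by
    have := (ev_le_iff v hp0 1).2 (by rw [pow_one, Ideal.dvd_span_singleton]; exact h)
    rw [e0] at this
    exact_mod_cast this
  have h2 : ¬ (3 : ℤ) ≤ ev v (p : K) := by
    intro h3
    have h4 := (ev_le_iff v hp0 3).1 (by rw [e0]; exact_mod_cast h3)
    have h5 := map_dvd Ideal.absNorm h4
    have h6 : Ideal.absNorm (Ideal.span {(p : 𝓞 K)}) = p ^ 2 := by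
      rw [Ideal.absNorm_span_singleton]
      have : (Algebra.norm ℤ (p : 𝓞 K) : ℚ) = ((p ^ 2 : ℤ) : ℚ) := by
        rw [Algebra.coe_norm_int, e0]
        have := q.nm p 0
        simpa using this
      have : Algebra.norm ℤ (p : 𝓞 K) = (p ^ 2 : ℤ) := by exact_mod_cast this
      rw [this]
      simp [Int.natAbs_pow]
    rw [h6, map_pow] at h5
    have h7 : p ∣ Ideal.absNorm v.asIdeal := by
      have := Ideal.absNorm_mem v.asIdeal
      have h8 := (mem_int v.isPrime hp h (m := (Ideal.absNorm v.asIdeal : ℤ))).1 (by exact_mod_cast this)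
      exact_mod_cast h8
    have h8 := (pow_dvd_pow_of_dvd h7 3).trans h5
    have := (Nat.pow_dvd_pow_iff_le_right hp.one_lt).1 h8
    omega
  omega

end
end Sch
end

section
namespace Sch
open NumberField nonZeroDivisors FractionalIdeal IsDedekindDomain

section
variable {K : Type*} [Field K] [NumberField K]

theorem QK.int_ne {c : ℤ} {θ : K} (q : QK c θ) {a b : ℤ} (ha : a ≠ 0) : (a : K) + b * θ ≠ 0 := by
  intro h
  have := q.uniq a b (by exact_mod_cast h)
  exact ha (by exact_mod_cast this.1)

theorem ev_int_dvd (v : HeightOneSpectrum (𝓞 K)) {p : ℕ} (hp : p.Prime)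
    (hpv : (p : 𝓞 K) ∈ v.asIdeal) (h3 : ¬ (3 : ℤ) ∣ ev v (p : K)) {g : ℤ} (hg : g ≠ 0)
    (h : (3 : ℤ) ∣ ev v (g : K)) : 3 ∣ padicValInt p g := by
  haveI := Fact.mk hp
  obtain ⟨g', hg'⟩ := padicValInt_dvd (p := p) g
  have hnd : ¬ (p : ℤ) ∣ g' := by
    rintro ⟨k, hk⟩
    have : (p : ℤ) ^ (padicValInt p g + 1) ∣ g := ⟨k, by
      conv_lhs => rw [hg', hk]
      ring⟩
    rw [padicValInt_dvd_iff] at this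
    rcases this with h | h
    · exact hg h
    · omega
  have e1 : ev v (g' : K) = 0 := by
    have := ev_eq_zero v (x := (g' : 𝓞 K)) (by rw [mem_int v.isPrime hp hpv]; exact hnd)
    simpa using this
  have hg0 : g' ≠ 0 := by rintro rfl; simp at hnd
  have e2 : ev v (g : K) = padicValInt p g * ev v (p : K) := by
    have : (g : K) = (p : K) ^ (padicValInt p g) * (g' : K) := by
      conv_lhs => rw [hg']
      push_cast; ring
    rw [this, ev_mul v (pow_ne_zero _ (by exact_mod_cast hp.ne_zero)) (by exact_mod_cast hg0), e1,
      ev_pow, add_zero]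
  rw [e2] at h
  rcases Int.prime_three.dvd_or_dvd h with h | h
  · exact_mod_cast h
  · exact absurd h h3

theorem rep_val {E : ℤ} {θ : K} (q : QK (-3 * E) θ) {η : K} (hη : InG η)
    {u v g : ℤ} (hg : g ≠ 0) (hu : u ≠ 0) (hcop : IsCoprime u v) (h2 : 2 * η = g * (u + 3 * v * θ)) {r : ℚ}
    (hr0 : r ≠ 0) (hN0 : u ^ 2 + 27 * E * v ^ 2 ≠ 0)
    (hr : ((g ^ 2 * (u ^ 2 + 27 * E * v ^ 2) : ℤ) : ℚ) = 4 * r ^ 3) {p : ℕ} (hp : p.Prime)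
    (hpE : ¬ (p : ℤ) ∣ 6 * E) : 3 ∣ padicValInt p (u ^ 2 + 27 * E * v ^ 2) := by
  haveI := Fact.mk hp
  have hp2 : ¬ (p : ℤ) ∣ 2 := fun h => hpE (Dvd.dvd.mul_right (h.trans (by norm_num)) _)
  have hp3 : ¬ (p : ℤ) ∣ 3 := fun h => hpE (Dvd.dvd.mul_right (h.trans (by norm_num)) _)
  have hpE' : ¬ (p : ℤ) ∣ E := fun h => hpE (Dvd.dvd.mul_left h _)
  have hpp : Prime (p : ℤ) := Nat.prime_iff_prime_int.1 hp
  by_cases hpN : (p : ℤ) ∣ u ^ 2 + 27 * E * v ^ 2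
  swap
  · have : padicValInt p (u ^ 2 + 27 * E * v ^ 2) = 0 := padicValInt.eq_zero_of_not_dvd hpN
    rw [this]; exact dvd_zero _
  have hpu : ¬ (p : ℤ) ∣ u := by
    intro h
    have h1 : (p : ℤ) ∣ 27 * E * v ^ 2 := by
      rw [← dvd_add_right (h.mul_left u |>.trans (dvd_of_eq (pow_two u).symm))]
      exact hpN
    have h27 : ¬ (p : ℤ) ∣ 27 := fun h => hp3 (hpp.dvd_of_dvd_pow (n := 3) (by norm_num; exact h))
    rcases hpp.dvd_or_dvd h1 with h' | h'
    · rcases hpp.dvd_or_dvd h' with h' | h'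
      · exact h27 h'
      · exact hpE' h'
    · exact hpp.not_unit (hcop.isUnit_of_dvd' h (hpp.dvd_of_dvd_pow h'))
  -- prime above p
  obtain ⟨P, hPm, hP⟩ : ∃ P : Ideal (𝓞 K), P.IsMaximal ∧ Ideal.span {(p : 𝓞 K)} ≤ P := by
    apply Ideal.exists_le_maximal
    intro h
    rw [Ideal.span_singleton_eq_top] at h
    have h' : Ideal.absNorm (Ideal.span {(p : 𝓞 K)}) = 1 := by
      rw [Ideal.span_singleton_eq_top.2 h, Ideal.absNorm_top]
    rw [Ideal.absNorm_span_singleton] at h'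
    have h3 : (Algebra.norm ℤ (p : 𝓞 K) : ℚ) = ((p ^ 2 : ℤ) : ℚ) := by
      rw [Algebra.coe_norm_int]
      have := q.nm p 0
      simpa using this
    have h4 : Algebra.norm ℤ (p : 𝓞 K) = (p ^ 2 : ℤ) := by exact_mod_cast h3
    rw [h4] at h'
    simp [Int.natAbs_pow] at h'
    exact hp.one_lt.ne' h'
  have hpP : (p : 𝓞 K) ∈ P := hP (Ideal.mem_span_singleton_self _)
  have hP0 : P ≠ ⊥ := by
    rintro rfl
    rw [Ideal.mem_bot] at hpP
    exact hp.ne_zero (by exact_mod_cast hpP)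
  let w : HeightOneSpectrum (𝓞 K) := ⟨P, hPm.isPrime, hP0⟩
  have hpw : (p : 𝓞 K) ∈ w.asIdeal := hpP
  have hintegral : IsIntegral ℤ θ := by
    refine IsIntegral.of_pow (n := 2) two_pos ?_
    rw [q.sq]; exact isIntegral_intCast _
  let θ' : 𝓞 K := ⟨θ, hintegral⟩
  have hθ' : (θ' : K) = θ := rfl
  let A : 𝓞 K := u + 3 * v * θ'
  let B : 𝓞 K := u - 3 * v * θ'
  have hm3 : (algebraMap (𝓞 K) K) 3 = 3 := map_ofNat _ 3
  have hm2 : (algebraMap (𝓞 K) K) 2 = 2 := map_ofNat _ 2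
  have hA : (A : K) = u + 3 * v * θ := by simp [A, hθ', hm3]
  have hB : (B : K) = u - 3 * v * θ := by simp [B, hθ', hm3]
  have hA0 : (A : K) ≠ 0 := by
    rw [hA]
    have := q.int_ne (b := 3 * v) hu
    push_cast at this; exact this
  have hB0 : (B : K) ≠ 0 := by
    rw [hB]
    have := q.int_ne (b := -(3 * v)) hu
    push_cast at this
    intro h; apply this; linear_combination h
  have hAB : A ∉ w.asIdeal ∨ B ∉ w.asIdeal := by
    by_contra! h
    have h1 : ((2 * u : ℤ) : 𝓞 K) ∈ w.asIdeal := by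
      have : ((2 * u : ℤ) : 𝓞 K) = A + B := by simp only [A, B]; push_cast; ring
      rw [this]; exact add_mem h.1 h.2
    rw [mem_int w.isPrime hp hpw] at h1
    rcases hpp.dvd_or_dvd h1 with h | h
    · exact hp2 h
    · exact hpu h
  have hgK : (g : K) ≠ 0 := by exact_mod_cast hg
  have ev2 : ev w (2 : K) = 0 := by
    have := ev_eq_zero w (x := ((2 : ℤ) : 𝓞 K)) (by rw [mem_int w.isPrime hp hpw]; exact hp2)
    rw [Int.cast_ofNat] at this
    rw [← hm2]
    exact this
  have e1 : (3 : ℤ) ∣ ev w (g : K) + ev w (A : K) := by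
    rw [← ev_mul w hgK hA0, hA, ← h2, ev_mul w two_ne_zero hη.1, ev2, zero_add]
    exact hη.ev w
  have e2 : (3 : ℤ) ∣ (ev w (g : K) + ev w (A : K)) + (ev w (g : K) + ev w (B : K)) := by
    rw [← ev_mul w hgK hA0, ← ev_mul w hgK hB0, ← ev_mul w (mul_ne_zero hgK hA0) (mul_ne_zero hgK hB0)]
    have : (g * A : K) * (g * B) = 2 ^ 2 * (r : K) ^ 3 := by
      have h3 := congrArg (fun x : ℚ => (x : K)) hr
      push_cast at h3
      have hsq := q.sq
      push_cast at hsq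
      rw [hA, hB]
      linear_combination h3 - 9 * g ^ 2 * v ^ 2 * hsq
    have hrK : (r : K) ≠ 0 := by exact_mod_cast hr0
    rw [this, ev_mul w (by norm_num) (pow_ne_zero _ hrK), ev_pow, ev_pow, ev2]
    exact ⟨ev w (r : K), by push_cast; ring⟩
  have e3 : (3 : ℤ) ∣ ev w (g : K) := by
    rcases hAB with h | h
    · rw [ev_eq_zero w h, add_zero] at e1; exact e1
    · have := (Int.dvd_add_right e1).1 e2
      rw [ev_eq_zero w h, add_zero] at this; exact this
  have e4 := ev_int_dvd w hp hpw (q.ev_prime w hp hpw) hg e3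
  have e5 := congrArg (padicValRat p) hr
  rw [padicValRat.of_int, padicValInt.mul (pow_ne_zero 2 hg) hN0, pow_two g, padicValInt.mul hg hg,
    padicValRat.mul (by norm_num) (pow_ne_zero _ hr0), padicValRat.pow r,
    show (4 : ℚ) = ((4 : ℤ) : ℚ) by norm_num, padicValRat.of_int,
    padicValInt.eq_zero_of_not_dvd (z := 4) (fun h => hp2 (hpp.dvd_of_dvd_pow (n := 2) (by norm_num; exact h)))] at e5
  push_cast at e5
  omega

theorem QL.rep {E : ℤ} {θ : K} (q : QK (-3 * E) θ) {η : K} (hη : InG η)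
    (h : QL E θ η 0) : ∃ u v : ℤ, Adm E u v ∧ ∃ z : K, z ≠ 0 ∧
      ((u : K) + 3 * v * θ) * ((u ^ 2 + 27 * E * v ^ 2 : ℤ) : K) = z ^ 3 * η := by
  obtain ⟨s, t, h1, h2, h3, h4⟩ := h
  have ht : (3 : ℤ) ∣ t := by
    rw [z3] at h4
    exact (Int.prime_three.dvd_or_dvd h4).resolve_left h2
  obtain ⟨t, rfl⟩ := ht
  have hs0 : s ≠ 0 := by rintro rfl; simp at h2
  obtain ⟨g, u, v, hg, hcop, rfl, rfl⟩ : ∃ g u v : ℤ, g ≠ 0 ∧ IsCoprime u v ∧ s = g * u ∧ t = g * v := by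
    have hg : 0 < Int.gcd s t := Int.gcd_pos_of_ne_zero_left _ hs0
    obtain ⟨u, v, hc, e1, e2⟩ := Int.exists_gcd_one hg
    exact ⟨Int.gcd s t, u, v, by exact_mod_cast hg.ne', Int.isCoprime_iff_gcd_eq_one.2 hc,
      by rw [mul_comm]; exact e1, by rw [mul_comm]; exact e2⟩
  have hu0 : u ≠ 0 := by rintro rfl; simp at hs0
  have h2' : 2 * η = g * (u + 3 * v * θ) := by rw [h1]; push_cast; ring
  obtain ⟨r, hr⟩ := hη.norm
  have hr0 : r ≠ 0 := by
    rintro rfl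
    rw [zero_pow three_ne_zero, Algebra.norm_eq_zero_iff] at hr
    exact hη.1 hr
  have hN : ((g ^ 2 * (u ^ 2 + 27 * E * v ^ 2) : ℤ) : ℚ) = 4 * r ^ 3 := by
    have e1 : η = ((g * u / 2 : ℚ) : K) + ((3 * g * v / 2 : ℚ) : K) * θ := by
      push_cast
      have h20 : (2 : K) ≠ 0 := two_ne_zero
      field_simp
      linear_combination h2'
    rw [e1, q.nm] at hr
    rw [← hr]; push_cast; ring
  have hN0 : u ^ 2 + 27 * E * v ^ 2 ≠ 0 := by
    intro h
    rw [h, mul_zero, Int.cast_zero] at hN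
    have := pow_ne_zero 3 hr0
    apply this; linarith
  refine ⟨u, v, ⟨hcop, fun h => h2 (h.mul_left g), hN0, ?_, ?_⟩, ?_⟩
  · intro p hp hpE
    exact rep_val q hη hg hu0 hcop h2' hr0 hN0 hN hp hpE
  · intro hE
    by_contra hodd
    rcases Int.even_or_odd u with ⟨a, ha⟩ | ⟨a, ha⟩ <;> rcases Int.even_or_odd v with ⟨b, hb⟩ | ⟨b, hb⟩
    · have := hcop.isUnit_of_dvd' (x := 2) ⟨a, by omega⟩ ⟨b, by omega⟩
      rw [Int.isUnit_iff] at this; omega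
    · have : u ^ 2 + 27 * E * v ^ 2 = 2 * (2 * a ^ 2 + 27 * E * (2 * b ^ 2 + 2 * b)) + 27 * E := by
        rw [ha, hb]; ring
      omega
    · have : u ^ 2 + 27 * E * v ^ 2 = 2 * (2 * a ^ 2 + 2 * a + 27 * E * (2 * b ^ 2)) + 1 := by
        rw [ha, hb]; ring
      omega
    · obtain ⟨k, hk⟩ := sq8 (x := u) (by omega)
      obtain ⟨l, hl⟩ := sq8 (x := v) (by omega)
      obtain ⟨m, hm⟩ : ∃ m, E = 8 * m + 5 := ⟨E / 8, by omega⟩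
      have : (g * u) ^ 2 + 3 * E * (3 * (g * v)) ^ 2 =
          8 * (g ^ 2 * (k + 17 + 27 * (m * (8 * l + 1) + 5 * l))) := by
        have : (g * u) ^ 2 + 3 * E * (3 * (g * v)) ^ 2 = g ^ 2 * (u ^ 2 + 27 * E * v ^ 2) := by ring
        rw [this, hk, hl, hm]; ring
      omega
  · have hgK : (g : K) ≠ 0 := by exact_mod_cast hg
    refine ⟨2 * r / g, ?_, ?_⟩
    · have : (r : K) ≠ 0 := by exact_mod_cast hr0
      exact div_ne_zero (mul_ne_zero two_ne_zero this) hgK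
    · have h5 := congrArg (fun x : ℚ => (x : K)) hN
      push_cast at h5 ⊢
      field_simp
      linear_combination (-(g : K) ^ 2 * (u ^ 2 + 27 * E * v ^ 2)) * h2' + (2 * η) * h5

end
end Sch
end

section
namespace Sch
open NumberField nonZeroDivisors

section
variable {K : Type*} [Field K] [NumberField K] {K' : Type*} [Field K'] [NumberField K']

def ChiOf (E : ℤ) (ε : 𝓞 K') (u v : ℤ) (χ : ClassGroup (𝓞 K') →* ℂˣ) : Prop :=
  ∀ (P : (Ideal (𝓞 K'))⁰) (p : ℕ) (t : ℤ) (s : Zw),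
      (P : Ideal (𝓞 K')).IsPrime → p.Prime → ¬ (p : ℤ) ∣ 6 * (u ^ 2 + 27 * E * v ^ 2) →
      (p : 𝓞 K') ∈ (P : Ideal (𝓞 K')) → ε - t ∈ (P : Ideal (𝓞 K')) → IsVal u v p t s →
      ((χ (ClassGroup.mk0 P) : ℂˣ) : ℂ) = io s

theorem al_mulnorm (u v t : ℤ) : al u v t * ((QuadraticAlgebra.norm (al u v t) : ℤ) : Zw) =
    ((u : Zw) + 3 * v * t * s3) ^ 2 * ((u : Zw) - 3 * v * t * s3) := by
  rw [norm_al, al]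
  push_cast
  linear_combination (9 * v ^ 2 * t ^ 2 * (u + 3 * v * t * s3) : Zw) * s3_sq

theorem comb_val {E u v u' v' : ℤ} {p : ℕ} {t : ℤ} (ht : (p : ℤ) ∣ t ^ 2 - E)
    {s : Zw} (hs : IsVal u v p t s) (hs' : IsVal u' v' p t s) {a b : ℤ}
    (ha : a = u * (u' ^ 2 - 27 * E * v' ^ 2) - 9 * E * v * (6 * u' * v'))
    (hb : b = u * (6 * u' * v') + 3 * v * (u' ^ 2 - 27 * E * v' ^ 2)) :
    (p : Zw) ∣ (((a : Zw) + (b * t : ℤ) * s3) ^ 2 * ((a : Zw) - (b * t : ℤ) * s3)) ^ ((p ^ 2 - 1) / 3) - 1 := by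
  obtain ⟨hs3, h1⟩ := hs
  obtain ⟨-, h2⟩ := hs'
  obtain ⟨k, hk⟩ := ht
  have hkz := congrArg (fun x : ℤ => (x : Zw)) hk
  push_cast at hkz
  rw [al_mulnorm] at h1 h2
  set A : Zw := (u : Zw) + 3 * v * t * s3 with hA
  set A1 : Zw := (u : Zw) - 3 * v * t * s3 with hA1
  set B : Zw := (u' : Zw) + 3 * v' * t * s3 with hB
  set B1 : Zw := (u' : Zw) - 3 * v' * t * s3 with hB1
  have e1 : (p : Zw) ∣ ((a : Zw) + (b * t : ℤ) * s3) - A * B ^ 2 := by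
    refine ⟨k * (27 * u * v' ^ 2 + 54 * v * u' * v' + 81 * v * v' ^ 2 * t * s3), ?_⟩
    rw [ha, hb, hA, hB]
    push_cast
    linear_combination (27 * u * v' ^ 2 + 54 * v * u' * v' + 81 * v * v' ^ 2 * t * s3 : Zw) * hkz
      + (-9 * u * v' ^ 2 * t ^ 2 - 18 * v * u' * v' * t ^ 2 - 27 * v * v' ^ 2 * t ^ 3 * s3 : Zw) * s3_sq
  have e2 : (p : Zw) ∣ ((a : Zw) - (b * t : ℤ) * s3) - A1 * B1 ^ 2 := by
    refine ⟨k * (27 * u * v' ^ 2 + 54 * v * u' * v' - 81 * v * v' ^ 2 * t * s3), ?_⟩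
    rw [ha, hb, hA1, hB1]
    push_cast
    linear_combination (27 * u * v' ^ 2 + 54 * v * u' * v' - 81 * v * v' ^ 2 * t * s3 : Zw) * hkz
      + (-9 * u * v' ^ 2 * t ^ 2 - 18 * v * u' * v' * t ^ 2 + 27 * v * v' ^ 2 * t ^ 3 * s3 : Zw) * s3_sq
  set X : Zw := (a : Zw) + (b * t : ℤ) * s3
  set X1 : Zw := (a : Zw) - (b * t : ℤ) * s3
  have e3 : (p : Zw) ∣ X ^ 2 * X1 - (A ^ 2 * A1) * (B ^ 2 * B1) ^ 2 := by
    obtain ⟨c, hc⟩ := e1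
    obtain ⟨d, hd⟩ := e2
    exact ⟨c * (X + A * B ^ 2) * X1 + (A * B ^ 2) ^ 2 * d, by
      linear_combination (X + A * B ^ 2) * X1 * hc + (A * B ^ 2) ^ 2 * hd⟩
  have e4 := sub_dvd_pow ((p ^ 2 - 1) / 3) e3
  have e5 : (p : Zw) ∣ ((A ^ 2 * A1) * (B ^ 2 * B1) ^ 2) ^ ((p ^ 2 - 1) / 3) - s * s ^ 2 := by
    rw [mul_pow, ← pow_mul, mul_comm 2, pow_mul]
    obtain ⟨c, hc⟩ := h1
    obtain ⟨d, hd⟩ := h2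
    set Y := (A ^ 2 * A1) ^ ((p ^ 2 - 1) / 3)
    set Z := (B ^ 2 * B1) ^ ((p ^ 2 - 1) / 3)
    exact ⟨c * Z ^ 2 + s * d * (Z + s), by linear_combination Z ^ 2 * hc + s * (Z + s) * hd⟩
  have e6 := dvd_add e4 e5
  rw [show s * s ^ 2 = 1 by rw [← hs3]; ring] at e6
  rw [sub_add_sub_cancel] at e6
  exact e6

theorem chi_eq_cube {E : ℤ} {θ : K} (qK : QK (-3 * E) θ) (hE : E ≠ 0) {ε : 𝓞 K'} (qf : QF E ε)
    {u v u' v' : ℤ} (ha : Adm E u v) (ha' : Adm E u' v') {χ : ClassGroup (𝓞 K') →* ℂˣ}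
    (h : ChiOf E ε u v χ) (h' : ChiOf E ε u' v' χ) :
    ∃ x : K, x ^ 3 = (((u : K) + 3 * v * θ) * ((u ^ 2 + 27 * E * v ^ 2 : ℤ) : K)) *
      (((u' : K) + 3 * v' * θ) * ((u' ^ 2 + 27 * E * v' ^ 2 : ℤ) : K)) ^ 2 := by
  obtain ⟨a, hA⟩ : ∃ a, a = u * (u' ^ 2 - 27 * E * v' ^ 2) - 9 * E * v * (6 * u' * v') := ⟨_, rfl⟩
  obtain ⟨b, hB⟩ : ∃ b, b = u * (6 * u' * v') + 3 * v * (u' ^ 2 - 27 * E * v' ^ 2) := ⟨_, rfl⟩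
  have hsq := qK.sq
  push_cast at hsq
  have hnm : a ^ 2 + 3 * E * b ^ 2 = (u ^ 2 + 27 * E * v ^ 2) * (u' ^ 2 + 27 * E * v' ^ 2) ^ 2 := by
    rw [hA, hB]; ring
  obtain ⟨x, hx⟩ := lemC θ E hE hsq a b
    (6 * (u ^ 2 + 27 * E * v ^ 2) * (6 * (u' ^ 2 + 27 * E * v' ^ 2)))
    (mul_ne_zero (mul_ne_zero (by norm_num) ha.ne) (mul_ne_zero (by norm_num) ha'.ne))
    (by rw [hnm]; exact mul_ne_zero ha.ne (pow_ne_zero 2 ha'.ne)) (by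
      intro p hp hpn t ht
      have hp1 : ¬ (p : ℤ) ∣ 6 * (u ^ 2 + 27 * E * v ^ 2) := fun h => hpn (h.mul_right _)
      have hp2 : ¬ (p : ℤ) ∣ 6 * (u' ^ 2 + 27 * E * v' ^ 2) := fun h => hpn (h.mul_left _)
      have hp6 : ¬ (p : ℤ) ∣ 6 := fun h => hp1 (h.mul_right _)
      have h2 : p ≠ 2 := by rintro rfl; exact hp6 (by norm_num)
      have h3 : p ≠ 3 := by rintro rfl; exact hp6 (by norm_num)
      obtain ⟨s, hs⟩ := exists_val ha.three hp h3 (t := t) (v := v)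
        (fun h => hp1 ((dvd_norm_al ht h).mul_left _))
      obtain ⟨s', hs'⟩ := exists_val ha'.three hp h3 (t := t) (v := v')
        (fun h => hp2 ((dvd_norm_al ht h).mul_left _))
      obtain ⟨P, hP, hP0, hpP, htP⟩ := qf.exists_prime hp h2 ht
      have hP0' : P ∈ (Ideal (𝓞 K'))⁰ := mem_nonZeroDivisors_iff_ne_zero.2 hP0
      have k1 := h ⟨P, hP0'⟩ p t s hP hp hp1 hpP htP hs
      have k2 := h' ⟨P, hP0'⟩ p t s' hP hp hp2 hpP htP hs'
      have k3 : s = s' := io_inj hs.1 hs'.1 (k1.symm.trans k2)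
      subst k3
      exact comb_val ht hs hs' hA hB)
  refine ⟨x, ?_⟩
  rw [hx]
  have eA : (a : K) + b * θ = (u + 3 * v * θ) * (u' + 3 * v' * θ) ^ 2 := by
    rw [hA, hB]; push_cast
    linear_combination (-(9 * u * v' ^ 2 + 18 * v * u' * v' + 27 * v * v' ^ 2 * θ : K)) * hsq
  have eN : ((a : K) + b * θ) * (a - b * θ) =
      ((u ^ 2 + 27 * E * v ^ 2 : ℤ) : K) * ((u' ^ 2 + 27 * E * v' ^ 2 : ℤ) : K) ^ 2 := by
    have := congrArg (fun x : ℤ => (x : K)) hnm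
    push_cast at this ⊢
    linear_combination this - (b : K) ^ 2 * hsq
  rw [pow_two, mul_assoc, eN, eA]
  ring

theorem card_chi : Nat.card {χ : ClassGroup (𝓞 K') →* ℂˣ // χ ^ 3 = 1} =
    Nat.card {c : ClassGroup (𝓞 K') // c ^ 3 = 1} := by
  obtain ⟨e⟩ := CommGroup.monoidHom_mulEquiv_of_hasEnoughRootsOfUnity (ClassGroup (𝓞 K')) ℂ
  refine Nat.card_congr (e.toEquiv.subtypeEquiv ?_)
  intro χ
  change χ ^ 3 = 1 ↔ (e χ) ^ 3 = 1
  rw [← map_pow, map_eq_one_iff e e.injective]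

theorem count {E : ℤ} (hE : Squarefree E) {θ : K} (qK : QK (-3 * E) θ) {ε : 𝓞 K'} (qf : QF E ε)
    {S : Type*} (f : S → K) (hf : ∀ s, InG (f s))
    (hinj : ∀ s s', (∃ z : K, f s = z ^ 3 * f s') → s = s') :
    Nat.card S ≤ 3 * Nat.card {c : ClassGroup (𝓞 K') // c ^ 3 = 1} := by
  classical
  rcases isEmpty_or_nonempty S with hS | hS
  · simp
  choose c hc l hl using fun s => QL.exists hE qK (hf s)
  let σ : ZMod 3 → S := Function.invFun l
  have hσ : ∀ s, l (σ (l s)) = l s := fun s => Function.invFun_eq ⟨s, rfl⟩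
  have hη : ∀ s, InG (c s ^ 3 * f s) := fun s => (InG.cube (hc s)).mul (hf s)
  have hG : ∀ s, InG ((c s ^ 3 * f s) * ((c (σ (l s)) ^ 3 * f (σ (l s))) * (c (σ (l s)) ^ 3 * f (σ (l s))))) :=
    fun s => (hη s).mul ((hη _).mul (hη _))
  have hQ : ∀ s, QL E θ ((c s ^ 3 * f s) * ((c (σ (l s)) ^ 3 * f (σ (l s))) * (c (σ (l s)) ^ 3 * f (σ (l s))))) 0 := by
    intro s
    have := (hl s).mul hE qK.sq ((hl (σ (l s))).mul hE qK.sq (hl (σ (l s))))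
    rw [hσ] at this
    have e : l s + (l s + l s) = 0 := by
      generalize l s = x
      revert x; decide
    rwa [e] at this
  choose u v hadm z hz huv using fun s => QL.rep qK (hG s) (hQ s)
  choose χ hχ3 hχ using fun s => qf.exists_char (hadm s)
  have hχ' : ∀ s, ChiOf E ε (u s) (v s) (χ s) := hχ
  let F : S → ZMod 3 × {χ : ClassGroup (𝓞 K') →* ℂˣ // χ ^ 3 = 1} := fun s => (l s, ⟨χ s, hχ3 s⟩)
  have hF : Function.Injective F := by
    intro s s' hss
    have h1 : l s = l s' := congrArg Prod.fst hss
    have h2 : χ s = χ s' := congrArg (fun x => x.2.1) hss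
    obtain ⟨x, hx⟩ := chi_eq_cube qK hE.ne_zero qf (hadm s) (hadm s') (hχ' s) (h2 ▸ hχ' s')
    rw [huv s, huv s', h1] at hx
    apply hinj
    have a1 := hz s
    have a2 := hz s'
    have a3 := hc s
    have a4 := hc s'
    have a5 := (hη (σ (l s'))).1
    have a6 := (hf s').1
    set η0 := c (σ (l s')) ^ 3 * f (σ (l s'))
    refine ⟨x / (z s * z s' ^ 2 * c s * c s' ^ 2 * η0 ^ 2 * f s'), ?_⟩
    rw [div_pow, hx]
    field_simp
  haveI : Finite (ClassGroup (𝓞 K') →* ℂˣ) := by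
    obtain ⟨e⟩ := CommGroup.monoidHom_mulEquiv_of_hasEnoughRootsOfUnity (ClassGroup (𝓞 K')) ℂ
    exact Finite.of_equiv _ e.symm.toEquiv
  have := Nat.card_le_card_of_injective F hF
  rw [Nat.card_prod, card_chi, Nat.card_zmod] at this
  exact this

end
end Sch
end

section
namespace Sch
open NumberField nonZeroDivisors

section
variable {K : Type*} [Field K] [NumberField K] {K' : Type*} [Field K'] [NumberField K']

theorem exists_gen (c : {c : ClassGroup (𝓞 K) // c ^ 3 = 1}) :
    ∃ (I : (Ideal (𝓞 K))⁰) (g : 𝓞 K), ClassGroup.mk0 I = c.1 ∧ g ≠ 0 ∧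
      (I : Ideal (𝓞 K)) ^ 3 = Ideal.span {g} := by
  obtain ⟨I, hI⟩ := ClassGroup.mk0_surjective c.1
  have h1 : ClassGroup.mk0 (I ^ 3) = 1 := by rw [map_pow, hI, c.2]
  have h2 : I ^ 3 = ⟨(I : Ideal (𝓞 K)) ^ 3, pow_mem I.2 3⟩ := rfl
  rw [h2, ClassGroup.mk0_eq_one_iff] at h1
  obtain ⟨g, hg⟩ := h1.principal
  have hg' : (I : Ideal (𝓞 K)) ^ 3 = Ideal.span {g} := hg
  refine ⟨I, g, hI, ?_, hg'⟩
  rintro rfl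
  rw [Ideal.span_singleton_eq_bot.2 rfl] at hg'
  exact nonZeroDivisors.coe_ne_zero I (pow_eq_zero_iff three_ne_zero |>.1 hg')

theorem lower {E : ℤ} (hE : Squarefree E) {θ : K} (qK : QK (-3 * E) θ) {ε : 𝓞 K'} (qf : QF E ε)
    {τ : Type*} (e : τ → (𝓞 K)ˣ)
    (he : ∀ i j, (∃ z : K, ((e i : 𝓞 K) : K) = z ^ 3 * ((e j : 𝓞 K) : K)) → i = j) :
    Nat.card {c : ClassGroup (𝓞 K) // c ^ 3 = 1} * Nat.card τ ≤
      3 * Nat.card {c : ClassGroup (𝓞 K') // c ^ 3 = 1} := by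
  choose I g hI hg0 hg using exists_gen (K := K)
  have hK0 : ∀ c, (g c : K) ≠ 0 := fun c => by
    rw [Ne, RingOfIntegers.coe_eq_zero_iff]; exact hg0 c
  have heK : ∀ i, ((e i : 𝓞 K) : K) ≠ 0 := fun i => by
    rw [Ne, RingOfIntegers.coe_eq_zero_iff]; exact (e i).ne_zero
  have hspan : ∀ c i, Ideal.span {g c * (e i : 𝓞 K)} = (I c : Ideal (𝓞 K)) ^ 3 := fun c i => by
    rw [hg c, Ideal.span_singleton_mul_right_unit (e i).isUnit]
  rw [← Nat.card_prod]
  refine count hE qK qf (fun s => (g s.1 : K) * ((e s.2 : 𝓞 K) : K)) ?_ ?_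
  · rintro ⟨c, i⟩
    refine ⟨mul_ne_zero (hK0 c) (heK i), ((I c : Ideal (𝓞 K)) : FractionalIdeal (𝓞 K)⁰ K), ?_⟩
    rw [← FractionalIdeal.coeIdeal_pow, ← hspan c i, FractionalIdeal.coeIdeal_span_singleton, map_mul]
  · rintro ⟨c, i⟩ ⟨c', i'⟩ ⟨z, hz⟩
    dsimp only at hz
    obtain ⟨a, b, hb, rfl⟩ := IsFractionRing.div_surjective (A := 𝓞 K) z
    have hb0 : b ≠ 0 := nonZeroDivisors.ne_zero hb
    have hbK : (b : K) ≠ 0 := by rw [Ne, RingOfIntegers.coe_eq_zero_iff]; exact hb0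
    have hz' : b ^ 3 * (g c * (e i : 𝓞 K)) = a ^ 3 * (g c' * (e i' : 𝓞 K)) := by
      apply RingOfIntegers.ext
      simp only [map_mul, map_pow]
      rw [div_pow] at hz
      field_simp at hz
      linear_combination hz
    have ha0 : a ≠ 0 := by
      rintro rfl
      have := mul_ne_zero (pow_ne_zero 3 hb0) (mul_ne_zero (hg0 c) (e i).ne_zero)
      rw [hz'] at this
      simp at this
    have h3 : (Ideal.span {b} * (I c : Ideal (𝓞 K))) ^ 3 = (Ideal.span {a} * (I c' : Ideal (𝓞 K))) ^ 3 := by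
      rw [mul_pow, mul_pow, ← hspan c i, ← hspan c' i', Ideal.span_singleton_pow, Ideal.span_singleton_pow,
        Ideal.span_singleton_mul_span_singleton, Ideal.span_singleton_mul_span_singleton, hz']
    have h4 := pow_left_injective three_ne_zero h3
    have h5 : c = c' := by
      apply Subtype.ext
      rw [← hI c, ← hI c', ClassGroup.mk0_eq_mk0_iff]
      exact ⟨b, a, hb0, ha0, h4⟩
    subst h5
    have h6 : i = i' := by
      apply he
      refine ⟨algebraMap (𝓞 K) K a / algebraMap (𝓞 K) K b, mul_left_cancel₀ (hK0 c) ?_⟩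
      rw [hz]; ring
    rw [h6]

theorem QK.finrank {c : ℤ} {θ : K} (q : QK c θ) : Module.finrank ℚ K = 2 := by
  have h1 := q.nm 2 0
  have h2 : ((2 : ℚ) : K) + ((0 : ℚ) : K) * θ = algebraMap ℚ K 2 := by simp
  rw [h2, Algebra.norm_algebraMap] at h1
  have h3 : (2 : ℚ) ^ Module.finrank ℚ K = 2 ^ 2 := by rw [h1]; norm_num
  exact pow_right_injective₀ (by norm_num) (by norm_num) h3

theorem QK.rank {c : ℤ} (hc : 0 < c) {θ : K} (q : QK c θ) : Units.rank K = 1 := by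
  have hre : IsTotallyReal K := ⟨by
    intro w
    rw [InfinitePlace.isReal_iff, ComplexEmbedding.isReal_iff]
    ext x
    obtain ⟨a, b, rfl⟩ := q.ex x
    have h1 : (w.embedding θ) ^ 2 = ((Real.sqrt c : ℝ) : ℂ) ^ 2 := by
      rw [← map_pow, q.sq, map_intCast, ← Complex.ofReal_pow, Real.sq_sqrt (by exact_mod_cast hc.le)]
      simp
    have h2 : (starRingEnd ℂ) (w.embedding θ) = w.embedding θ := by
      rcases sq_eq_sq_iff_eq_or_eq_neg.1 h1 with h | h <;> rw [h] <;> simp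
    simp [ComplexEmbedding.conjugate_coe_eq, h2]⟩
  have h1 := InfinitePlace.card_add_two_mul_card_eq_rank K
  have h2 := InfinitePlace.card_eq_nrRealPlaces_add_nrComplexPlaces K
  rw [nrComplexPlaces_eq_zero_iff.2 hre] at h1 h2
  rw [q.finrank] at h1
  rw [Units.rank]
  omega

theorem exists_noncube (h : Units.rank K = 1) : ∃ η : (𝓞 K)ˣ, ∀ z : K, z ^ 3 ≠ ((η : 𝓞 K) : K) := by
  let i : Fin (Units.rank K) := ⟨0, by omega⟩
  refine ⟨Units.fundSystem K i, ?_⟩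
  intro z hz
  set η := Units.fundSystem K i with hη
  have hintegral : IsIntegral ℤ z := by
    refine IsIntegral.of_pow (n := 3) (by norm_num) ?_
    rw [hz]; exact RingOfIntegers.isIntegral_coe _
  let y : 𝓞 K := ⟨z, hintegral⟩
  have hy : y ^ 3 = (η : 𝓞 K) := by
    apply RingOfIntegers.ext
    simp only [map_pow]; exact hz
  have hyu : IsUnit y := by
    rw [← isUnit_pow_iff (n := 3) three_ne_zero, hy]; exact η.isUnit
  obtain ⟨y', hy'⟩ := hyu
  have h1 : y' ^ 3 = η := by
    apply Units.ext
    rw [Units.val_pow_eq_pow_val, hy', hy]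
  obtain ⟨ζe, hζe, -⟩ := Units.exist_unique_eq_mul_prod K y'
  obtain ⟨ζ1, -, hu⟩ := Units.exist_unique_eq_mul_prod K η
  have e1 := hu (ζe.1 ^ 3, fun j => ζe.2 j * 3) (by
    rw [← h1, hζe, mul_pow, ← Finset.prod_pow]
    simp only [Subgroup.coe_pow, zpow_mul]
    rfl)
  have e2 := hu (1, Pi.single i 1) (by
    simp only [Subgroup.coe_one, one_mul]
    rw [Finset.prod_eq_single i]
    · simp [hη]
    · intro b _ hb
      simp [hb]
    · simp)
  have e3 := congrFun (congrArg Prod.snd (e1.trans e2.symm)) i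
  simp only [Pi.single_eq_same] at e3
  omega

theorem lower_real {E : ℤ} (hE : Squarefree E) {θ : K} (qK : QK (-3 * E) θ) {ε : 𝓞 K'} (qf : QF E ε)
    (hneg : E < 0) :
    Nat.card {c : ClassGroup (𝓞 K) // c ^ 3 = 1} ≤ Nat.card {c : ClassGroup (𝓞 K') // c ^ 3 = 1} := by
  obtain ⟨η, hη⟩ := exists_noncube (qK.rank (by linarith))
  have h0 : ((η : 𝓞 K) : K) ≠ 0 := by
    rw [Ne, RingOfIntegers.coe_eq_zero_iff]; exact η.ne_zero
  have := lower hE qK qf (τ := Fin 3) (fun i => η ^ (i : ℕ)) (by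
    intro i j
    rintro ⟨z, hz⟩
    simp only [Units.val_pow_eq_pow_val, map_pow] at hz
    have hz0 : z ≠ 0 := by
      rintro rfl
      rw [zero_pow three_ne_zero, zero_mul] at hz
      exact pow_ne_zero _ h0 hz
    obtain ⟨x, hx⟩ : ∃ x : K, (algebraMap (𝓞 K) K) (η : 𝓞 K) = x := ⟨_, rfl⟩
    have hη' : ∀ w : K, w ^ 3 ≠ x := fun w => hx ▸ hη w
    have hx0 : x ≠ 0 := hx ▸ h0
    rw [hx] at hz
    fin_cases i <;> fin_cases j <;> simp at hz ⊢
    · exact hη' z⁻¹ (by rw [inv_pow]; field_simp; linear_combination hz)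
    · exact hη' (z * x) (by linear_combination - x * hz)
    · exact hη' z (by linear_combination -hz)
    · exact hη' z⁻¹ (by rw [inv_pow]; field_simp; apply mul_left_cancel₀ hx0; linear_combination hz)
    · exact hη' (x / z) (by rw [div_pow]; field_simp; linear_combination hz)
    · exact hη' z (by apply mul_left_cancel₀ hx0; linear_combination -hz))
  rw [Nat.card_eq_fintype_card (α := Fin 3), Fintype.card_fin] at this
  omega

end
end Sch
end

namespace Sch
open NumberField

section
variable {K : Type*} [Field K] [NumberField K]

theorem not_sq_of_neg {c : ℤ} (h : c < 0) : ¬ IsSquare (c : ℚ) := by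
  rintro ⟨r, hr⟩
  have h1 : (c : ℚ) < 0 := by exact_mod_cast h
  nlinarith [mul_self_nonneg r]

theorem not_sq_of_sqfree {d : ℕ} (hsf : Squarefree d) (h1 : d ≠ 1) : ¬ IsSquare ((d : ℤ) : ℚ) := by
  rw [Rat.isSquare_intCast_iff, Int.isSquare_natCast_iff]
  rintro ⟨r, rfl⟩
  have := hsf r (dvd_refl _)
  rw [Nat.isUnit_iff] at this
  subst this
  exact h1 rfl

theorem adjoin_scale {a b : K} {t : ℚ} (h : Algebra.adjoin ℚ {a} = ⊤) (hab : a = t • b) :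
    Algebra.adjoin ℚ {b} = ⊤ := by
  rw [eq_top_iff, ← h, Algebra.adjoin_le_iff, Set.singleton_subset_iff, hab]
  exact Subalgebra.smul_mem (Algebra.adjoin ℚ {b}) (Algebra.subset_adjoin (Set.mem_singleton b)) t

theorem integral_of_sq {c : ℤ} {a : K} (h : a ^ 2 = c) : IsIntegral ℤ a := by
  refine IsIntegral.of_pow (n := 2) (by norm_num) ?_
  rw [h]; exact isIntegral_intCast c

end
end Sch

theorem stmt17 (d : ℕ) (hsf : Squarefree d) (hpos : 0 < d) (h1 : d ≠ 1) (h3 : d ≠ 3)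
    (K₁ K₂ : Type*) [Field K₁] [NumberField K₁] [Field K₂] [NumberField K₂]
    (α : K₁) (β : K₂) (hα : α ^ 2 = (d : K₁)) (hβ : β ^ 2 = -(3 * d : K₂))
    (hK₁ : Algebra.adjoin ℚ {α} = ⊤) (hK₂ : Algebra.adjoin ℚ {β} = ⊤) (r₁ r₂ : ℕ)
    (hr₁ : Nat.card {c : ClassGroup (NumberField.RingOfIntegers K₁) // c ^ 3 = 1} = 3 ^ r₁)
    (hr₂ : Nat.card {c : ClassGroup (NumberField.RingOfIntegers K₂) // c ^ 3 = 1} = 3 ^ r₂) :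
    r₂ = r₁ ∨ r₂ = r₁ + 1 := by
  have hdsf : Squarefree (d : ℤ) := by
    rw [← Int.squarefree_natAbs, Int.natAbs_natCast]; exact hsf
  have hnsq := Sch.not_sq_of_sqfree hsf h1
  have hd0 : (0 : ℤ) < d := by exact_mod_cast hpos
  have qα : Sch.QK (d : ℤ) α := Sch.QK.mk' (by rw [hα]; simp) hnsq hK₁
  have qβ : Sch.QK (-3 * (d : ℤ)) β :=
    Sch.QK.mk' (by rw [hβ]; push_cast; ring) (Sch.not_sq_of_neg (by linarith)) hK₂
  have hup : r₂ ≤ r₁ + 1 := by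
    have qf : Sch.QF (d : ℤ) (⟨α, Sch.integral_of_sq qα.sq⟩ : NumberField.RingOfIntegers K₁) :=
      Sch.QK.qf qα hdsf
    have h := Sch.lower hdsf qβ qf (τ := Unit) (fun _ => 1) (fun _ _ _ => rfl)
    rw [hr₁, hr₂, Nat.card_unique, mul_one, mul_comm, ← pow_succ] at h
    exact (Nat.pow_le_pow_iff_right (by norm_num)).1 h
  have hlow : r₁ ≤ r₂ := by
    suffices h : Nat.card {c : ClassGroup (NumberField.RingOfIntegers K₁) // c ^ 3 = 1} ≤
        Nat.card {c : ClassGroup (NumberField.RingOfIntegers K₂) // c ^ 3 = 1} by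
      rw [hr₁, hr₂] at h
      exact (Nat.pow_le_pow_iff_right (by norm_num)).1 h
    by_cases h3d : 3 ∣ d
    · obtain ⟨m, rfl⟩ := h3d
      have hm0 : (0 : ℤ) < m := by push_cast at hd0; linarith
      have hE : Squarefree (-(m : ℤ)) := by
        rw [← Int.squarefree_natAbs, Int.natAbs_neg, Int.natAbs_natCast]
        exact hsf.squarefree_of_dvd (Dvd.intro_left 3 rfl)
      have qK : Sch.QK (-3 * (-(m : ℤ))) α := by
        have : (-3 * (-(m : ℤ))) = ((3 * m : ℕ) : ℤ) := by push_cast; ring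
        rw [this]; exact qα
      have hsq : (β / 3) ^ 2 = ((-(m : ℤ) : ℤ) : K₂) := by
        rw [div_pow, hβ]; push_cast; ring
      have qb : Sch.QK (-(m : ℤ)) (β / 3) :=
        Sch.QK.mk' hsq (Sch.not_sq_of_neg (by linarith))
          (Sch.adjoin_scale (t := 3) hK₂ (by rw [Algebra.smul_def]; simp; field_simp))
      have qf : Sch.QF (-(m : ℤ)) (⟨β / 3, Sch.integral_of_sq hsq⟩ : NumberField.RingOfIntegers K₂) :=
        Sch.QK.qf qb hE
      exact Sch.lower_real hE qK qf (by linarith)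
    · have hE : Squarefree (-3 * (d : ℤ)) := by
        rw [← Int.squarefree_natAbs, Int.natAbs_mul, Int.natAbs_natCast]
        change Squarefree (3 * d)
        rw [Nat.squarefree_mul ((Nat.Prime.coprime_iff_not_dvd Nat.prime_three).2 h3d)]
        exact ⟨Nat.prime_three.prime.squarefree, hsf⟩
      have qK : Sch.QK (-3 * (-3 * (d : ℤ))) (3 * α) := by
        refine Sch.QK.mk' (by rw [mul_pow, hα]; push_cast; ring) ?_
          (Sch.adjoin_scale (t := 1 / 3) hK₁ (by rw [Algebra.smul_def]; simp))
        rintro ⟨r, hr⟩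
        exact hnsq ⟨r / 3, by push_cast at hr ⊢; linarith⟩
      have qf : Sch.QF (-3 * (d : ℤ)) (⟨β, Sch.integral_of_sq qβ.sq⟩ : NumberField.RingOfIntegers K₂) :=
        Sch.QK.qf qβ hE
      exact Sch.lower_real hE qK qf (by linarith)
  omega
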